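/- For every integer ℓ ≥ 2 there exist a constant c > 0 and a real X₀ such that for all X ≥ X₀, the number of squarefree positive integers d ≤ X whose 2-class group Cl₂(−d) is cyclic of order 2^ℓ (isomorphic to ℤ/2^ℓℤ) is at least c · X^{1/2 + 1/2^{ℓ+1}} / (log X)². -/

import Mathlib

open NumberField

/-- `twoClassGroupIso d G` says: for any realization `K` of the imaginary quadratic field
`ℚ(√-d)` (i.e. a number field generated over `ℚ` by a square root of `-d`), every Sylow
2-subgroup of the ideal class group of its ring of integers (the 2-class group `Cl₂(-d)`)
is isomorphic to `G`. -/
def twoClassGroupIso (d : ℕ) (G : Type) [Group G] : Prop :=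
  ∀ (K : Type) [Field K] [NumberField K] (α : K),
    α ^ 2 = -(d : K) →
    IntermediateField.adjoin ℚ {α} = ⊤ →
    ∀ P : Sylow 2 (ClassGroup (NumberField.RingOfIntegers K)),
      Nonempty ((P : Subgroup (ClassGroup (NumberField.RingOfIntegers K))) ≃* G)

section
lemma cl_sylow_cyclic {G : Type*} [CommGroup G] [Finite G] (n : ℕ) (g c : G) (hg : g ≠ 1)
    (htor : ∀ x : G, x ^ 2 = 1 → x = 1 ∨ x = g) (hg2 : g ^ 2 = 1) (hc : c ^ (2 ^ n) = g)
    (hns : ∀ x : G, x ^ 2 ≠ c) (P : Sylow 2 G) :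
    Nonempty ((P : Subgroup G) ≃* Multiplicative (ZMod (2 ^ (n + 1)))) := by
  have : Fact (Nat.Prime 2) := ⟨Nat.prime_two⟩
  have hord : orderOf c = 2 ^ (n + 1) := by
    apply orderOf_eq_prime_pow
    · rw [hc]; exact hg
    · rw [pow_succ, pow_mul, hc, hg2]
  have key : ∀ j : ℕ, ∀ x : G, x ^ (2 ^ j) = 1 → x ∈ Subgroup.zpowers c := by
    intro j
    induction j with
    | zero => intro x hx; simp at hx; rw [hx]; exact one_mem _
    | succ j ih =>
      intro x hx
      have h1 : x ^ 2 ∈ Subgroup.zpowers c := ih _ (by rw [← pow_mul, ← pow_succ']; exact hx)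
      obtain ⟨i, hi⟩ := Subgroup.mem_zpowers_iff.mp h1
      rcases Int.even_or_odd' i with ⟨k, hk | hk⟩
      · have h2 : (x * (c ^ k)⁻¹) ^ 2 = 1 := by
          rw [mul_pow, ← hi, hk, inv_pow, ← zpow_natCast (c ^ k), ← zpow_mul, mul_comm]
          norm_num [mul_comm]
        rcases htor _ h2 with h | h
        · rw [mul_inv_eq_one] at h
          exact Subgroup.mem_zpowers_iff.mpr ⟨k, h.symm⟩
        · rw [mul_inv_eq_iff_eq_mul] at h
          rw [h, ← hc]
          exact mul_mem (Subgroup.npow_mem_zpowers _ _) (Subgroup.zpow_mem_zpowers _ _)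
      · exfalso
        have hcop : IsCoprime i ((2 : ℤ) ^ (n + 1)) := by
          apply IsCoprime.pow_right
          rw [hk]
          exact ⟨1, -k, by ring⟩
        obtain ⟨u, v, huv⟩ := hcop
        apply hns (x ^ u)
        have h3 : c ^ ((2 : ℤ) ^ (n + 1)) = 1 := by
          have := pow_orderOf_eq_one c
          rw [hord] at this
          exact_mod_cast this
        calc (x ^ u) ^ 2 = (x ^ 2) ^ u := by
              rw [← zpow_natCast (x ^ u), ← zpow_mul, mul_comm, zpow_mul, zpow_natCast]
          _ = c ^ (u * i) * (c ^ ((2 : ℤ) ^ (n + 1))) ^ v := by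
              rw [h3, one_zpow, mul_one, ← hi, ← zpow_mul, mul_comm]
          _ = c ^ (u * i + v * 2 ^ (n + 1)) := by
              rw [← zpow_mul, ← zpow_add, mul_comm v]
          _ = c := by rw [huv, zpow_one]
  have hP : (P : Subgroup G) = Subgroup.zpowers c := by
    apply le_antisymm
    · intro x hx
      obtain ⟨j, hj⟩ := (P.isPGroup') ⟨x, hx⟩
      exact key j x (by simpa using congrArg Subtype.val hj)
    · have hpg : IsPGroup 2 (Subgroup.zpowers c) := by
        rw [IsPGroup.iff_card]
        exact ⟨n + 1, by rw [Nat.card_zpowers, hord]⟩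
      obtain ⟨Q, hQ⟩ := hpg.exists_le_sylow
      have hPn : (P : Subgroup G).Normal := inferInstance
      have := P.unique_of_normal hPn
      have hQP : Q = P := Subsingleton.elim _ _
      rw [← hQP]; exact hQ
  rw [hP]
  have : IsCyclic (Subgroup.zpowers c) := inferInstance
  have : IsCyclic (Multiplicative (ZMod (2 ^ (n + 1)))) := inferInstance
  exact ⟨mulEquivOfCyclicCardEq (by rw [Nat.card_zpowers, hord]; simp)⟩

lemma cl_descent (p q : ℕ) (hp : p.Prime) (hq : q.Prime) (hpq : p ≠ q) (hp8 : p % 8 = 3) :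
    ∀ A B C : ℤ, 2 * A ^ 2 = B ^ 2 + p * q * C ^ 2 → A = 0 := by
  have hpp : Prime (p : ℤ) := Nat.prime_iff_prime_int.mp hp
  have : Fact p.Prime := ⟨hp⟩
  have main : ∀ n : ℕ, ∀ A B C : ℤ, A.natAbs ≤ n → 2 * A ^ 2 = B ^ 2 + p * q * C ^ 2 → A = 0 := by
    intro n
    induction n using Nat.strong_induction_on with
    | _ n ih =>
    intro A B C hA h
    by_contra hA0
    have hpA : (p : ℤ) ∣ A := by
      by_contra hpA
      have h2 : IsSquare (2 : ZMod p) := by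
        have h3 : ((2 * A ^ 2 : ℤ) : ZMod p) = ((B ^ 2 + p * q * C ^ 2 : ℤ) : ZMod p) := by rw [h]
        push_cast at h3
        rw [CharP.cast_eq_zero, zero_mul, zero_mul, add_zero] at h3
        have hA' : (A : ZMod p) ≠ 0 := by
          rwa [Ne, ZMod.intCast_zmod_eq_zero_iff_dvd]
        refine ⟨B / A, ?_⟩
        field_simp
        linear_combination h3
      rw [ZMod.exists_sq_eq_two_iff (by rintro rfl; simp at hp8)] at h2
      omega
    have hpB : (p : ℤ) ∣ B := by
      apply hpp.dvd_of_dvd_pow (n := 2)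
      have : B ^ 2 = 2 * A ^ 2 - p * (q * C ^ 2) := by linear_combination -h
      rw [this]
      exact dvd_sub (Dvd.dvd.mul_left (dvd_pow hpA two_ne_zero) _) (dvd_mul_right _ _)
    obtain ⟨A', rfl⟩ := hpA
    obtain ⟨B', rfl⟩ := hpB
    have hp0 : (p : ℤ) ≠ 0 := hpp.ne_zero
    have h4 : (p : ℤ) * (2 * A' ^ 2 - B' ^ 2) = q * C ^ 2 := by
      apply mul_left_cancel₀ hp0
      linear_combination h
    have hpC : (p : ℤ) ∣ C := by
      have : (p : ℤ) ∣ q * C ^ 2 := ⟨_, h4.symm⟩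
      rcases hpp.dvd_or_dvd this with h5 | h5
      · exfalso
        rw [Int.natCast_dvd_natCast] at h5
        exact hpq ((Nat.prime_dvd_prime_iff_eq hp hq).mp h5)
      · exact hpp.dvd_of_dvd_pow h5
    obtain ⟨C', rfl⟩ := hpC
    have h6 : 2 * A' ^ 2 = B' ^ 2 + p * q * C' ^ 2 := by
      apply mul_left_cancel₀ hp0
      linear_combination h4
    have hA'0 : A' ≠ 0 := by rintro rfl; simp at hA0
    have hlt : A'.natAbs < n := by
      rw [Int.natAbs_mul, Int.natAbs_natCast] at hA
      have := Int.natAbs_pos.mpr hA'0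
      have := hp.two_le
      nlinarith
    exact hA'0 (ih _ hlt A' B' C' le_rfl h6)
  exact fun A B C h => main _ A B C le_rfl h

end

section
section field
variable {K : Type} [Field K] [NumberField K] {d : ℕ} {α : K}

lemma cl_repr (hα : α ^ 2 = -(d : K)) (htop : IntermediateField.adjoin ℚ {α} = ⊤) (x : K) :
    ∃ a b : ℚ, x = a + b * α := by
  have h1 : Algebra.adjoin ℚ {α} = ⊤ := by
    rw [← IntermediateField.adjoin_simple_toSubalgebra_of_isAlgebraic (Algebra.IsAlgebraic.isAlgebraic α),
      htop]; rfl
  have hx : x ∈ Algebra.adjoin ℚ {α} := by rw [h1]; trivial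
  induction hx using Algebra.adjoin_induction with
  | mem y hy => exact ⟨0, 1, by simp at hy; simp [hy]⟩
  | algebraMap r => exact ⟨r, 0, by simp⟩
  | add y z _ _ hy hz =>
    obtain ⟨a, b, rfl⟩ := hy; obtain ⟨a', b', rfl⟩ := hz
    exact ⟨a + a', b + b', by push_cast; ring⟩
  | mul y z _ _ hy hz =>
    obtain ⟨a, b, rfl⟩ := hy; obtain ⟨a', b', rfl⟩ := hz
    exact ⟨a * a' - d * b * b', a * b' + a' * b, by push_cast; linear_combination (b * b' : K) * hα⟩

lemma cl_indep (hd : 0 < d) (hα : α ^ 2 = -(d : K)) {a b : ℚ} (h : (a : K) + b * α = 0) :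
    a = 0 ∧ b = 0 := by
  have h2 : (a : K) ^ 2 + d * (b : K) ^ 2 = 0 := by
    linear_combination (a - b * α : K) * h + (b : K) ^ 2 * hα
  have h3 : a ^ 2 + d * b ^ 2 = 0 := by exact_mod_cast h2
  have hd' : (0 : ℚ) < d := by exact_mod_cast hd
  constructor
  · nlinarith [sq_nonneg a, mul_nonneg hd'.le (sq_nonneg b)]
  · have : (d : ℚ) * b ^ 2 = 0 := by nlinarith [sq_nonneg a, mul_nonneg hd'.le (sq_nonneg b)]
    simpa [hd'.ne'] using this

lemma cl_norm_trace (hd : 0 < d) (hα : α ^ 2 = -(d : K))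
    (htop : IntermediateField.adjoin ℚ {α} = ⊤) (a b : ℚ) :
    Algebra.norm ℚ ((a : K) + b * α) = a ^ 2 + d * b ^ 2 ∧
      Algebra.trace ℚ K ((a : K) + b * α) = 2 * a := by
  have hli : LinearIndependent ℚ ![(1 : K), α] := by
    rw [LinearIndependent.pair_iff]
    intro s t h
    exact cl_indep hd hα (by simpa [Algebra.smul_def] using h)
  let B : Module.Basis (Fin 2) ℚ K := Module.Basis.mk hli (by
    intro x _
    obtain ⟨u, v, rfl⟩ := cl_repr hα htop x
    rw [Matrix.range_cons, Matrix.range_cons, Matrix.range_empty, Set.union_empty,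
      Set.singleton_union, Submodule.mem_span_pair]
    exact ⟨u, v, by simp [Algebra.smul_def]⟩)
  have hB0 : B 0 = 1 := by simp [B]
  have hB1 : B 1 = α := by simp [B]
  have hr : ∀ u v : ℚ, B.repr ((u : K) + v * α) = Finsupp.single 0 u + Finsupp.single 1 v := by
    intro u v
    have : (u : K) + v * α = u • B 0 + v • B 1 := by rw [hB0, hB1]; simp [Algebra.smul_def]
    rw [this]; simp
  have e1 : ((a : K) + b * α) * α = ((-(d * b) : ℚ) : K) + a * α := by
    push_cast; linear_combination (b : K) * hα
  have hM : Algebra.leftMulMatrix B ((a : K) + b * α) = !![a, -(d * b); b, a] := by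
    ext i j
    rw [Algebra.leftMulMatrix_eq_repr_mul]
    fin_cases j
    · change B.repr (_ * B 0) i = _
      rw [hB0, mul_one, hr]; fin_cases i <;> simp
    · change B.repr (_ * B 1) i = _
      rw [hB1, e1, hr]; fin_cases i <;> simp
  constructor
  · rw [Algebra.norm_eq_matrix_det B, hM, Matrix.det_fin_two_of]; ring
  · rw [Algebra.trace_eq_matrix_trace B, hM, Matrix.trace_fin_two_of]; ring

lemma cl_int_repr (hd : 0 < d) (hsq : Squarefree d) (hα : α ^ 2 = -(d : K))
    (htop : IntermediateField.adjoin ℚ {α} = ⊤) (x : NumberField.RingOfIntegers K) :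
    ∃ T B N : ℤ, 2 * (x : K) = T + B * α ∧ 4 * N = T ^ 2 + d * B ^ 2 ∧ Algebra.norm ℤ x = N := by
  obtain ⟨a, b, hx⟩ := cl_repr hα htop (x : K)
  obtain ⟨hn, ht⟩ := cl_norm_trace hd hα htop a b
  rw [← hx] at hn ht
  have hN := Algebra.coe_norm_int x
  have hT := Algebra.coe_trace_int x
  rw [hn] at hN; rw [ht] at hT
  set N := Algebra.norm ℤ x
  set T := Algebra.trace ℤ _ x
  have hB : (d : ℚ) * (2 * b) ^ 2 = ((4 * N - T ^ 2 : ℤ) : ℚ) := by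
    push_cast; rw [hN, hT]; ring
  have key : ∃ B : ℤ, 2 * b = B := by
    refine ⟨(2 * b).num, ?_⟩
    set c := 2 * b
    have h1 : (d : ℤ) * c.num ^ 2 = (4 * N - T ^ 2) * c.den ^ 2 := by
      have h0 : (c.den : ℚ) ≠ 0 := by exact_mod_cast c.den_ne_zero
      have h2 : c = c.num / c.den := (Rat.num_div_den c).symm
      rw [h2] at hB
      field_simp at hB
      rw [mul_comm (4 * N - T ^ 2)]; exact_mod_cast hB
    have h3 : ((c.den : ℤ)) ^ 2 ∣ d := by
      have hc : IsCoprime ((c.den : ℤ) ^ 2) (c.num ^ 2) := by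
        apply IsCoprime.pow
        exact (Int.isCoprime_iff_gcd_eq_one.2 (by simpa [Int.gcd] using c.reduced)).symm
      exact hc.dvd_of_dvd_mul_right ⟨4 * N - T ^ 2, by rw [h1]; ring⟩
    have h4 : c.den * c.den ∣ d := by
      have : ((c.den * c.den : ℕ) : ℤ) ∣ (d : ℤ) := by push_cast; rwa [← sq]
      exact_mod_cast this
    have h5 : c.den = 1 := by simpa using hsq _ h4
    conv_lhs => rw [← Rat.num_div_den c, h5]
    simp
  obtain ⟨B, hB'⟩ := key
  refine ⟨T, B, N, ?_, ?_, rfl⟩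
  · have : (T : K) = ((2 * a : ℚ) : K) := by rw [← hT]; simp
    rw [this]
    have : (B : K) = ((2 * b : ℚ) : K) := by rw [hB']; simp
    rw [this, hx]; push_cast; ring
  · rw [hB'] at hB
    have : (d : ℤ) * B ^ 2 = 4 * N - T ^ 2 := by exact_mod_cast hB
    linarith

lemma cl_int_mk (hα : α ^ 2 = -(d : K)) {T B N : ℤ} (h : 4 * N = T ^ 2 + d * B ^ 2) :
    ∃ x : NumberField.RingOfIntegers K, 2 * (x : K) = T + B * α := by
  have hint : IsIntegral ℤ (((T : K) + B * α) / 2) := by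
    refine ⟨Polynomial.X ^ 2 - Polynomial.C T * Polynomial.X + Polynomial.C N, ?_, ?_⟩
    · monicity!
    · simp only [Polynomial.eval₂_add, Polynomial.eval₂_sub, Polynomial.eval₂_mul,
        Polynomial.eval₂_pow, Polynomial.eval₂_X, Polynomial.eval₂_C]
      have : (4 : K) * N = T ^ 2 + d * B ^ 2 := by exact_mod_cast h
      simp only [eq_intCast]
      linear_combination (1 / 4 : K) * this + (B : K) ^ 2 / 4 * hα
  exact ⟨⟨_, hint⟩, by
    change 2 * (((T : K) + B * α) / 2) = _; ring⟩

lemma cl_int_uniq (hd : 0 < d) (hα : α ^ 2 = -(d : K)) {T B T' B' : ℤ}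
    (h : (T : K) + B * α = T' + B' * α) : T = T' ∧ B = B' := by
  have := cl_indep hd hα (a := T - T') (b := B - B') (by push_cast; linear_combination h)
  constructor
  · exact_mod_cast sub_eq_zero.1 this.1
  · exact_mod_cast sub_eq_zero.1 this.2

end field

end

section
open NumberField

lemma cl_pow_inj {A : Type*} [CommRing A] [IsDedekindDomain A] {I J : Ideal A} {n : ℕ} (hn : n ≠ 0)
    (h : I ^ n = J ^ n) : I = J :=
  dvd_antisymm ((UniqueFactorizationMonoid.pow_dvd_pow_iff_dvd hn).1 h.dvd)
    ((UniqueFactorizationMonoid.pow_dvd_pow_iff_dvd hn).1 h.symm.dvd)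

open Classical in
/-- class of an ideal -/
noncomputable def clc {A : Type*} [CommRing A] [IsDedekindDomain A] (J : Ideal A) : ClassGroup A :=
  if h : J ≠ 0 then ClassGroup.mk0 ⟨J, mem_nonZeroDivisors_of_ne_zero h⟩ else 1

section
variable {A : Type*} [CommRing A] [IsDedekindDomain A]
lemma clc_of {J : Ideal A} (h : J ≠ 0) :
    clc J = ClassGroup.mk0 ⟨J, mem_nonZeroDivisors_of_ne_zero h⟩ := by
  rw [clc, dif_pos h]
lemma clc_mul {I J : Ideal A} (hI : I ≠ 0) (hJ : J ≠ 0) : clc (I * J) = clc I * clc J := by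
  rw [clc_of hI, clc_of hJ, clc_of (mul_ne_zero hI hJ), ← map_mul]; rfl
lemma clc_span (x : A) : clc (Ideal.span {x}) = 1 := by
  by_cases h : Ideal.span {x} = (0 : Ideal A)
  · rw [clc, dif_neg (by simpa using h)]
  · rw [clc_of h, ClassGroup.mk0_eq_one_iff]; exact ⟨⟨x, rfl⟩⟩
lemma clc_pow {I : Ideal A} (hI : I ≠ 0) (n : ℕ) : clc (I ^ n) = clc I ^ n := by
  induction n with
  | zero => have := clc_span (1 : A); simpa using this
  | succ n ih => rw [pow_succ, clc_mul (pow_ne_zero _ hI) hI, ih, pow_succ]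
lemma clc_surj (x : ClassGroup A) : ∃ I : Ideal A, I ≠ 0 ∧ clc I = x := by
  obtain ⟨I, rfl⟩ := ClassGroup.mk0_surjective x
  have h := nonZeroDivisors.ne_zero I.2
  exact ⟨I, h, by rw [clc_of h]⟩
lemma clc_one {I : Ideal A} (hI : I ≠ 0) (h : clc I = 1) : ∃ x, I = Ideal.span {x} := by
  rw [clc_of hI, ClassGroup.mk0_eq_one_iff] at h
  obtain ⟨x, hx⟩ := h.principal
  exact ⟨x, hx⟩
lemma clc_eq {I J : Ideal A} (hI : I ≠ 0) (hJ : J ≠ 0) (h : clc I = clc J) :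
    ∃ x y : A, x ≠ 0 ∧ y ≠ 0 ∧ Ideal.span {x} * I = Ideal.span {y} * J := by
  rw [clc_of hI, clc_of hJ, ClassGroup.mk0_eq_mk0_iff] at h
  obtain ⟨x, y, hx, hy, h⟩ := h
  exact ⟨x, y, hx, hy, h⟩
end

section field
variable {K : Type} [Field K] [NumberField K] {d : ℕ} {α : K}

lemma cl_rad (hd : d % 4 = 3) (hsq : Squarefree d) (hα : α ^ 2 = -(d : K))
    (htop : IntermediateField.adjoin ℚ {α} = ⊤) {r : ℕ} (hr : r.Prime) (hrd : ¬ r ∣ d) (x : 𝓞 K)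
    (h : (r : 𝓞 K) ∣ x ^ 2) : (r : 𝓞 K) ∣ x := by
  have hd0 : 0 < d := by omega
  obtain ⟨z, hz⟩ := h
  obtain ⟨T, B, N, hx, hN, -⟩ := cl_int_repr hd0 hsq hα htop x
  obtain ⟨T', B', N', hz', hN', -⟩ := cl_int_repr hd0 hsq hα htop z
  have hz2 : (x : K) ^ 2 = r * (z : K) := by exact_mod_cast congrArg (algebraMap (𝓞 K) K) hz
  obtain ⟨e1, e2⟩ := cl_int_uniq hd0 hα (T := T ^ 2 - d * B ^ 2) (B := 2 * T * B)
    (T' := 2 * r * T') (B' := 2 * r * B') (by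
      push_cast
      linear_combination (-2 * (x : K) - T - B * α) * hx + 4 * hz2 + 2 * r * hz' - (B : K) ^ 2 * hα)
  have hrp : Prime (r : ℤ) := Nat.prime_iff_prime_int.1 hr
  have hrd' : ¬ (r : ℤ) ∣ d := by exact_mod_cast hrd
  have hTB : (r : ℤ) ∣ T * B := ⟨B', by linarith⟩
  have h12 : (r : ℤ) ∣ T ∧ (r : ℤ) ∣ B := by
    rcases hrp.dvd_or_dvd hTB with h | h
    · refine ⟨h, ?_⟩
      have : (r : ℤ) ∣ d * B ^ 2 := by
        rw [show (d : ℤ) * B ^ 2 = T * T - r * (2 * T') by linarith]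
        exact dvd_sub (h.mul_right _) (dvd_mul_right _ _)
      exact hrp.dvd_of_dvd_pow ((hrp.dvd_or_dvd this).resolve_left hrd')
    · refine ⟨?_, h⟩
      have : (r : ℤ) ∣ T ^ 2 := by
        rw [show T ^ 2 = B * (d * B) + r * (2 * T') by linarith]
        exact dvd_add (h.mul_right _) (dvd_mul_right _ _)
      exact hrp.dvd_of_dvd_pow this
  obtain ⟨⟨T1, rfl⟩, ⟨B1, rfl⟩⟩ := h12
  have h4 : (4 : ℤ) ∣ T1 ^ 2 + d * B1 ^ 2 := by
    rcases hr.eq_two_or_odd with h2 | h2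
    · subst h2
      have hT' : T' = T1 ^ 2 - d * B1 ^ 2 := by push_cast at e1; linarith
      have hB' : B' = 2 * T1 * B1 := by push_cast at e2; linarith
      have hev : (2 : ℤ) ∣ (T1 ^ 2 + d * B1 ^ 2) ^ 2 := ⟨2 * N', by
        rw [hT', hB'] at hN'; linear_combination -hN'⟩
      have hev' := Int.prime_two.dvd_of_dvd_pow hev
      obtain ⟨e, he⟩ : ∃ e, d = 4 * e + 3 := ⟨d / 4, by omega⟩
      subst he
      obtain ⟨f, hf⟩ := hev'
      push_cast at hf ⊢
      rcases Int.even_or_odd' T1 with ⟨u, hu | hu⟩ <;> rcases Int.even_or_odd' B1 with ⟨v, hv | hv⟩ <;>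
        subst hu hv
      · exact ⟨u ^ 2 + (4 * e + 3) * v ^ 2, by ring⟩
      · exfalso
        have : 2 * (2 * u ^ 2 + (4 * e + 3) * (2 * v ^ 2 + 2 * v) + 2 * e + 1 - f) = (-1 : ℤ) := by
          linear_combination hf
        omega
      · exfalso
        have : 2 * (2 * u ^ 2 + 2 * u + (4 * e + 3) * (2 * v ^ 2) - f) = (-1 : ℤ) := by
          linear_combination hf
        omega
      · exact ⟨u ^ 2 + u + (4 * e + 3) * (v ^ 2 + v) + e + 1, by ring⟩
    · have hc : IsCoprime (4 : ℤ) ((r : ℤ) ^ 2) := by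
        rw [Int.isCoprime_iff_nat_coprime]
        simp only [Int.natAbs_pow, Int.natAbs_natCast]
        have : Nat.Coprime 2 r := (Nat.coprime_primes Nat.prime_two hr).2 (by omega)
        exact Nat.Coprime.pow 2 2 this
      exact hc.dvd_of_dvd_mul_left ⟨N, by linear_combination -hN⟩
  obtain ⟨M, hM⟩ := h4
  obtain ⟨y, hy⟩ := cl_int_mk hα hM.symm
  refine ⟨y, ?_⟩
  have : (2 : K) * x = 2 * (r * y) := by rw [hx]; push_cast; linear_combination -(r : K) * hy
  have h2 := mul_left_cancel₀ two_ne_zero this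
  exact RingOfIntegers.ext (by push_cast; exact h2)

lemma cl_int_dvd (hd : 0 < d) (hsq : Squarefree d) (hα : α ^ 2 = -(d : K))
    (htop : IntermediateField.adjoin ℚ {α} = ⊤) {s t : ℤ} (h : (s : 𝓞 K) ∣ t) : s ∣ t := by
  obtain ⟨z, hz⟩ := h
  obtain ⟨T, B, N, hx, hN, -⟩ := cl_int_repr hd hsq hα htop z
  have hz2 : (t : K) = s * (z : K) := by simpa using congrArg (algebraMap (𝓞 K) K) hz
  obtain ⟨e1, e2⟩ := cl_int_uniq hd hα (T := 2 * t) (B := 0) (T' := s * T) (B' := s * B) (by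
    push_cast; linear_combination 2 * hz2 + s * hx)
  by_cases hs : s = 0
  · subst hs; simp at e1; simp [e1]
  have hB : B = 0 := by simpa [hs] using e2.symm
  subst hB
  have : (2 : ℤ) ∣ T := Int.prime_two.dvd_of_dvd_pow (n := 2) ⟨2 * N, by linarith⟩
  obtain ⟨u, rfl⟩ := this
  exact ⟨u, by linarith⟩
end field

end

section
open NumberField

lemma cl_prim {A : Type*} [CommRing A] {P Q a : A} (h : ∃ u v : A, u * P + v * Q = 1)
    (ha : a ^ 2 = -(P * Q)) :
    (Ideal.span {P, a}) ^ 2 = Ideal.span {P} ∧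
      Ideal.span {P, a} * Ideal.span {Q, a} = Ideal.span {a} := by
  obtain ⟨u, v, h⟩ := h
  constructor
  · rw [sq, Ideal.span_pair_mul_span_pair]
    apply le_antisymm
    · rw [Ideal.span_le]
      rintro x (rfl | rfl | rfl | rfl) <;> simp only [SetLike.mem_coe, Ideal.mem_span_singleton]
      · exact dvd_mul_right _ _
      · exact dvd_mul_right _ _
      · exact dvd_mul_left _ _
      · exact ⟨-Q, by linear_combination ha⟩
    · rw [Ideal.span_singleton_le_iff_mem]
      have h1 : P * P ∈ Ideal.span {P * P, P * a, a * P, a * a} := Ideal.subset_span (by simp)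
      have h2 : a * a ∈ Ideal.span {P * P, P * a, a * P, a * a} := Ideal.subset_span (by simp)
      have := Ideal.sub_mem _ (Ideal.mul_mem_left _ u h1) (Ideal.mul_mem_left _ v h2)
      rwa [show u * (P * P) - v * (a * a) = P by linear_combination P * h - v * ha] at this
  · rw [Ideal.span_pair_mul_span_pair]
    apply le_antisymm
    · rw [Ideal.span_le]
      rintro x (rfl | rfl | rfl | rfl) <;> simp only [SetLike.mem_coe, Ideal.mem_span_singleton]
      · exact ⟨-a, by linear_combination ha⟩
      · exact dvd_mul_left _ _
      · exact dvd_mul_right _ _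
      · exact dvd_mul_right _ _
    · rw [Ideal.span_singleton_le_iff_mem]
      have h1 : P * a ∈ Ideal.span {P * Q, P * a, a * Q, a * a} := Ideal.subset_span (by simp)
      have h2 : a * Q ∈ Ideal.span {P * Q, P * a, a * Q, a * a} := Ideal.subset_span (by simp)
      have := Ideal.add_mem _ (Ideal.mul_mem_left _ u h1) (Ideal.mul_mem_left _ v h2)
      rwa [show u * (P * a) + v * (a * Q) = a by linear_combination a * h] at this

section field
variable {K : Type} [Field K] [NumberField K] {p q : ℕ} {α : K}

lemma cl_tor_aux (hp : p.Prime) (hq : q.Prime) (hd : (p * q) % 4 = 3) (hsq : Squarefree (p * q))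
    (hα : α ^ 2 = -((p * q : ℕ) : K)) (htop : IntermediateField.adjoin ℚ {α} = ⊤)
    (P Q : Ideal (𝓞 K)) (hP : P ^ 2 = Ideal.span {(p : 𝓞 K)}) (hQ : Q ^ 2 = Ideal.span {(q : 𝓞 K)})
    (hP0 : P ≠ 0) (hQ0 : Q ≠ 0) (hPQ : clc P * clc Q = 1) :
    ∀ t : ℕ, t ≠ 0 → ∀ J : Ideal (𝓞 K), J ^ 2 = Ideal.span {(t : 𝓞 K)} →
      clc J = 1 ∨ clc J = clc P := by
  have hd0 : 0 < p * q := by omega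
  have hP2 : clc P * clc P = 1 := by rw [← clc_mul hP0 hP0, ← sq, hP, clc_span]
  have hQP : clc Q = clc P := by
    rw [← mul_right_inj (clc P), hPQ, hP2]
  intro t
  induction t using Nat.strong_induction_on with
  | _ t ih =>
  intro ht J hJ
  have hJ0 : J ≠ 0 := by
    rintro rfl
    have : (t : 𝓞 K) = 0 := by
      rw [← Ideal.span_singleton_eq_bot, ← hJ]; simp
    exact ht (by exact_mod_cast this)
  by_cases h1 : t = 1
  · left
    have : J = 1 := by
      apply cl_pow_inj two_ne_zero (J := 1); rw [hJ, h1, one_pow]; simp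
    rw [this, Ideal.one_eq_top, ← Ideal.span_singleton_one, clc_span]
  obtain ⟨r, hr, t', rfl⟩ := Nat.exists_prime_and_dvd h1
  have ht' : t' ≠ 0 := by rintro rfl; simp at ht
  have hrK : (r : 𝓞 K) ≠ 0 := by exact_mod_cast hr.ne_zero
  have step : ∀ R : Ideal (𝓞 K), R ≠ 0 → R ^ 2 = Ideal.span {(r : 𝓞 K)} → clc R = clc P →
      clc J = 1 ∨ clc J = clc P := by
    intro R hR0 hR hRc
    have : R ∣ J := by
      rw [← UniqueFactorizationMonoid.pow_dvd_pow_iff_dvd two_ne_zero, hR, hJ]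
      exact ⟨Ideal.span {(t' : 𝓞 K)}, by rw [Ideal.span_singleton_mul_span_singleton]; simp⟩
    obtain ⟨J', rfl⟩ := this
    have hJ'0 : J' ≠ 0 := right_ne_zero_of_mul hJ0
    have hJ' : J' ^ 2 = Ideal.span {(t' : 𝓞 K)} := by
      rw [mul_pow, hR, Nat.cast_mul, ← Ideal.span_singleton_mul_span_singleton] at hJ
      exact mul_left_cancel₀ (by simpa using hrK) hJ
    have := ih t' (by
      have := hr.two_le; nlinarith [Nat.pos_of_ne_zero ht']) ht' J' hJ'
    rw [clc_mul hR0 hJ'0, hRc]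
    rcases this with h | h
    · right; rw [h, mul_one]
    · left; rw [h, hP2]
  by_cases hrd : r ∣ p * q
  · rcases (Nat.Prime.dvd_mul hr).1 hrd with h | h
    · rw [(Nat.prime_dvd_prime_iff_eq hr hp).1 h] at step
      exact step P hP0 hP rfl
    · rw [(Nat.prime_dvd_prime_iff_eq hr hq).1 h] at step
      exact step Q hQ0 hQ hQP
  · have : Ideal.span {(r : 𝓞 K)} ∣ J := by
      rw [Ideal.dvd_iff_le]
      intro x hx
      rw [Ideal.mem_span_singleton]
      apply cl_rad hd hsq hα htop hr hrd
      have : x ^ 2 ∈ J ^ 2 := Ideal.pow_mem_pow hx 2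
      rw [hJ, Ideal.mem_span_singleton] at this
      exact (dvd_trans ⟨(t' : 𝓞 K), by push_cast; rfl⟩ this)
    obtain ⟨J', rfl⟩ := this
    have hJ'0 : J' ≠ 0 := right_ne_zero_of_mul hJ0
    rw [mul_pow, Ideal.span_singleton_pow] at hJ
    have hdv : ((r ^ 2 : ℤ) : 𝓞 K) ∣ ((r * t' : ℕ) : ℤ) := by
      have : ((r * t' : ℕ) : 𝓞 K) ∈ Ideal.span {(r : 𝓞 K) ^ 2} := by
        refine (Ideal.mul_le_inf (J := J' ^ 2) ?_).1; rw [hJ]; exact Ideal.mem_span_singleton_self _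
      rw [Ideal.mem_span_singleton] at this
      push_cast; push_cast at this; exact this
    have hdv2 := cl_int_dvd hd0 hsq hα htop hdv
    have hdv3 : r ^ 2 ∣ r * t' := by exact_mod_cast hdv2
    rw [sq] at hdv3
    obtain ⟨t'', rfl⟩ := Nat.dvd_of_mul_dvd_mul_left hr.pos hdv3
    have ht'' : t'' ≠ 0 := right_ne_zero_of_mul ht'
    have := ih t'' (by
      have := hr.two_le
      have h3 := Nat.pos_of_ne_zero ht''
      nlinarith [Nat.mul_le_mul this this, Nat.mul_le_mul_right t'' (Nat.mul_le_mul this this)]) ht'' J' (by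
        rw [show ((r * (r * t'') : ℕ) : 𝓞 K) = (r : 𝓞 K) ^ 2 * t'' by push_cast; ring,
          ← Ideal.span_singleton_mul_span_singleton] at hJ
        exact mul_left_cancel₀ (by simpa using hrK) hJ)
    rwa [clc_mul (by simpa using hrK) hJ'0, clc_span, one_mul]

lemma cl_tor (hp : p.Prime) (hq : q.Prime) (hd : (p * q) % 4 = 3) (hsq : Squarefree (p * q))
    (hα : α ^ 2 = -((p * q : ℕ) : K)) (htop : IntermediateField.adjoin ℚ {α} = ⊤)
    (P Q : Ideal (𝓞 K)) (hP : P ^ 2 = Ideal.span {(p : 𝓞 K)}) (hQ : Q ^ 2 = Ideal.span {(q : 𝓞 K)})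
    (hP0 : P ≠ 0) (hQ0 : Q ≠ 0) (hPQ : clc P * clc Q = 1) (c : ClassGroup (𝓞 K)) (hc : c ^ 2 = 1) :
    c = 1 ∨ c = clc P := by
  have hd0 : 0 < p * q := by omega
  have hP2 : clc P * clc P = 1 := by rw [← clc_mul hP0 hP0, ← sq, hP, clc_span]
  have aux := cl_tor_aux hp hq hd hsq hα htop P Q hP hQ hP0 hQ0 hPQ
  have aux2 : ∀ t : ℤ, t ≠ 0 → ∀ J : Ideal (𝓞 K), J ^ 2 = Ideal.span {(t : 𝓞 K)} →
      clc J = 1 ∨ clc J = clc P := by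
    intro t ht J hJ
    apply aux t.natAbs (by simpa using ht) J
    rw [hJ]
    rcases Int.natAbs_eq t with h | h
    · conv_lhs => rw [h]
      simp
    · conv_lhs => rw [h]
      simp [Ideal.span_singleton_neg]
  obtain ⟨I, hI, rfl⟩ := clc_surj c
  rw [← clc_pow hI] at hc
  obtain ⟨x, hx⟩ := clc_one (pow_ne_zero 2 hI) hc
  obtain ⟨T, B, N, hxT, hN, hNn⟩ := cl_int_repr hd0 hsq hα htop x
  set m := Ideal.absNorm I
  have hm : ((m : ℤ)) ^ 2 = N := by
    have h1 : Ideal.absNorm (I ^ 2) = N.natAbs := by rw [hx, Ideal.absNorm_span_singleton, hNn]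
    rw [map_pow] at h1
    have h2 : 0 ≤ N := by nlinarith [sq_nonneg T, mul_nonneg (Int.natCast_nonneg (p * q)) (sq_nonneg B)]
    rw [← Int.natAbs_of_nonneg h2, ← h1]; push_cast; rfl
  have hm0 : m ≠ 0 := by
    intro h0
    exact hI (Ideal.absNorm_eq_zero_iff.1 h0)
  set t : ℤ := T + 2 * m
  have hxx : x ^ 2 - T * x + N = 0 := by
    apply RingOfIntegers.ext
    have h4 : (4 : K) * N = T ^ 2 + (p * q : ℕ) * B ^ 2 := by exact_mod_cast hN
    simp only [map_add, map_sub, map_mul, map_pow, map_intCast, map_zero]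
    have h5 : ((p * q : ℕ) : K) = p * q := by push_cast; rfl
    rw [h5] at h4 hα
    linear_combination (1 / 4 : K) * h4 + (B : K) ^ 2 / 4 * hα + (2 * x - T + B * α) / 4 * hxT
  have hy : (x + m) ^ 2 = x * t := by
    have : (N : 𝓞 K) = (m : 𝓞 K) ^ 2 := by rw [← hm]; push_cast; rfl
    simp only [t]; push_cast
    linear_combination hxx - this
  by_cases ht : t = 0
  · rw [ht, Int.cast_zero, mul_zero] at hy
    have hxm : x = -((m : ℤ) : 𝓞 K) := by
      have := pow_eq_zero_iff (two_ne_zero) |>.1 hy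
      push_cast
      linear_combination this
    rw [hxm, Ideal.span_singleton_neg] at hx
    exact aux2 m (by exact_mod_cast hm0) I hx
  · have hdvd : I ∣ Ideal.span {x + m} := by
      rw [← UniqueFactorizationMonoid.pow_dvd_pow_iff_dvd two_ne_zero, hx, Ideal.span_singleton_pow, hy,
        ← Ideal.span_singleton_mul_span_singleton]
      exact dvd_mul_right _ _
    obtain ⟨J, hJ⟩ := hdvd
    have hJ2 : J ^ 2 = Ideal.span {(t : 𝓞 K)} := by
      have h1 : (I * J) ^ 2 = I ^ 2 * Ideal.span {(t : 𝓞 K)} := by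
        rw [← hJ, Ideal.span_singleton_pow, hy, hx, Ideal.span_singleton_mul_span_singleton]
      rw [mul_pow] at h1
      exact mul_left_cancel₀ (pow_ne_zero 2 hI) h1
    have hJ0 : J ≠ 0 := by
      rintro rfl
      have : (t : 𝓞 K) = 0 := by
        rw [← Ideal.span_singleton_eq_bot, ← hJ2]; simp
      exact ht (by exact_mod_cast this)
    have h3 : clc I * clc J = 1 := by rw [← clc_mul hI hJ0, ← hJ, clc_span]
    rcases aux2 t ht J hJ2 with h | h
    · left; simpa [h] using h3
    · right; rw [h, ← hP2] at h3; exact mul_right_cancel h3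
end field

end

section
open NumberField

theorem cl_main {ℓ p q m : ℕ} (hℓ : 1 ≤ ℓ) (hp : p.Prime) (hq : q.Prime) (hp8 : p % 8 = 3)
    (hq8 : q % 8 = 5) (hpq : p + q = 4 * (2 * m ^ 2) ^ (2 ^ (ℓ - 1))) :
    Squarefree (p * q) ∧ twoClassGroupIso (p * q) (Multiplicative (ZMod (2 ^ ℓ))) := by
  have hne : p ≠ q := by rintro rfl; omega
  have hcop : Nat.Coprime p q := (Nat.coprime_primes hp hq).2 hne
  have hsq : Squarefree (p * q) :=
    (Nat.squarefree_mul hcop).2 ⟨hp.squarefree, hq.squarefree⟩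
  refine ⟨hsq, ?_⟩
  intro K _ _ α hα htop Sy
  have hd : (p * q) % 4 = 3 := by
    rw [Nat.mul_mod]; have : p % 4 = 3 := by omega
    have : q % 4 = 1 := by omega
    simp [*]
  have hd0 : 0 < p * q := by omega
  set n := 2 * m ^ 2 with hn
  set k := 2 ^ (ℓ - 1) with hk
  have hk0 : k ≠ 0 := by positivity
  have hm : m ≠ 0 := by
    rintro rfl
    have := hp.pos
    simp [hn, hk0] at hpq; omega
  have hn0 : n ≠ 0 := by positivity
  have hpK : (p : 𝓞 K) ≠ 0 := by exact_mod_cast hp.ne_zero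
  have hqK : (q : 𝓞 K) ≠ 0 := by exact_mod_cast hq.ne_zero
  have hα' : α ^ 2 = -((p : K) * q) := by rw [hα]; push_cast; rfl
  -- elements
  obtain ⟨a, ha⟩ := cl_int_mk (K := K) hα (T := 0) (B := 2) (N := (p * q : ℕ)) (by push_cast; ring)
  have ha' : (a : K) = α := by
    have : (2 : K) * a = 2 * α := by rw [ha]; simp
    exact mul_left_cancel₀ two_ne_zero this
  have haa : a ^ 2 = -((p : 𝓞 K) * q) := by
    apply RingOfIntegers.ext
    simp only [map_pow, map_neg, map_mul, map_natCast, ha', hα']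
  obtain ⟨u, v, huv⟩ : ∃ u v : ℤ, u * p + v * q = 1 := Nat.isCoprime_iff_coprime.2 hcop
  have huv1 : (u : 𝓞 K) * p + v * q = 1 := by exact_mod_cast congrArg (Int.cast : ℤ → 𝓞 K) huv
  obtain ⟨hP, hPQ⟩ := cl_prim (P := (p : 𝓞 K)) (Q := q) (a := a) ⟨u, v, huv1⟩ haa
  obtain ⟨hQ, -⟩ := cl_prim (P := (q : 𝓞 K)) (Q := p) (a := a) ⟨v, u, by linear_combination huv1⟩
    (by rw [haa]; ring)
  set P : Ideal (𝓞 K) := Ideal.span {(p : 𝓞 K), a}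
  set Q : Ideal (𝓞 K) := Ideal.span {(q : 𝓞 K), a}
  have hP0 : P ≠ 0 := by
    intro h; rw [h] at hP
    exact hpK (Ideal.span_singleton_eq_bot.1 (by rw [← hP]; simp))
  have hQ0 : Q ≠ 0 := by
    intro h; rw [h] at hQ
    exact hqK (Ideal.span_singleton_eq_bot.1 (by rw [← hQ]; simp))
  have hPQc : clc P * clc Q = 1 := by rw [← clc_mul hP0 hQ0, hPQ, clc_span]
  have hP2 : clc P ^ 2 = 1 := by rw [← clc_pow hP0, hP, clc_span]
  have htor := cl_tor hp hq hd hsq hα htop P Q hP hQ hP0 hQ0 hPQc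
  -- P nonprincipal
  have hPn : clc P ≠ 1 := by
    intro h
    obtain ⟨x, hx⟩ := clc_one hP0 h
    obtain ⟨T, B, N, hxT, hN, hNn⟩ := cl_int_repr hd0 hsq hα htop x
    have h1 : Ideal.absNorm (P ^ 2) = p ^ 2 := by
      rw [hP, Ideal.absNorm_span_singleton]
      obtain ⟨T', B', N', h1, h2, h3⟩ := cl_int_repr hd0 hsq hα htop (p : 𝓞 K)
      obtain ⟨e1, e2⟩ := cl_int_uniq hd0 hα (T := 2 * p) (B := 0) (T' := T') (B' := B') (by
        rw [← h1]; push_cast; simp)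
      rw [h3]
      have : N' = (p : ℤ) ^ 2 := by rw [← e1, ← e2] at h2; linarith
      rw [this, Int.natAbs_pow, Int.natAbs_natCast]
    rw [map_pow] at h1
    have h2 : Ideal.absNorm P = p := Nat.pow_left_injective (n := 2) two_ne_zero h1
    rw [hx, Ideal.absNorm_span_singleton, hNn] at h2
    have h3 : 0 ≤ N := by nlinarith [sq_nonneg T, mul_nonneg (Int.natCast_nonneg (p * q)) (sq_nonneg B)]
    have h4 : N = p := by omega
    rw [h4] at hN
    push_cast at hN
    have hp0 : (0 : ℤ) < p := by exact_mod_cast hp.pos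
    have hq5 : (5 : ℤ) ≤ q := by exact_mod_cast (by omega : 5 ≤ q)
    by_cases hB : B = 0
    · subst hB
      have hpp : Prime (p : ℤ) := Nat.prime_iff_prime_int.1 hp
      have : (p : ℤ) ∣ T := hpp.dvd_of_dvd_pow (n := 2) ⟨4, by linarith⟩
      obtain ⟨w, rfl⟩ := this
      have h5 : 4 = p * w ^ 2 := by
        apply mul_left_cancel₀ hp0.ne'; linarith
      have : (p : ℤ) ∣ 4 := ⟨_, h5⟩
      have : p ∣ 4 := by exact_mod_cast this
      have := Nat.le_of_dvd (by norm_num) this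
      have h3 : p = 3 := by omega
      rw [h3] at h5; push_cast at h5; omega
    · have hB1 : 1 ≤ B ^ 2 := by
        have := sq_pos_of_ne_zero hB; omega
      nlinarith [sq_nonneg T, mul_le_mul_of_nonneg_left hB1 (mul_nonneg hp0.le (by linarith : (0:ℤ) ≤ q)),
        mul_le_mul_of_nonneg_left hq5 hp0.le]
  -- gamma, tau
  have hpqZ : (p : ℤ) + q = 4 * n ^ k := by exact_mod_cast hpq
  obtain ⟨T0, hT0⟩ : ∃ T0 : ℤ, (p : ℤ) - q = 2 * T0 := ⟨((p : ℤ) - q) / 2, by omega⟩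
  obtain ⟨γ, hγ⟩ := cl_int_mk (K := K) hα (T := p) (B := 1) (N := p * n ^ k) (by
    push_cast; linear_combination -(p : ℤ) * hpqZ)
  have hτN : 4 * ((n : ℤ) ^ k) ^ 2 = T0 ^ 2 + p * q := by
    have : (4 * (n : ℤ) ^ k) ^ 2 = (2 * T0) ^ 2 + 4 * p * q := by rw [← hpqZ, ← hT0]; ring
    linarith
  obtain ⟨τ, hτ⟩ := cl_int_mk (K := K) hα (T := T0) (B := 1) (N := ((n : ℤ) ^ k) ^ 2) (by
    push_cast; linear_combination hτN)
  obtain ⟨τ', hτ'⟩ := cl_int_mk (K := K) hα (T := T0) (B := -1) (N := ((n : ℤ) ^ k) ^ 2) (by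
    push_cast; linear_combination hτN)
  have hτNK : 4 * ((n : K) ^ k) ^ 2 = T0 ^ 2 + p * q := by exact_mod_cast hτN
  have hpqK : (p : K) + q = 4 * n ^ k := by exact_mod_cast hpq
  have hT0K : (p : K) - q = 2 * T0 := by exact_mod_cast hT0
  push_cast at hγ hτ hτ'
  have e1 : τ * τ' = (n : 𝓞 K) ^ (2 * k) := by
    apply RingOfIntegers.ext
    rw [mul_comm 2 k, pow_mul]
    simp only [map_pow, map_mul, map_natCast]
    linear_combination (1 / 2 : K) * hτ * τ' + (T0 + α) / 4 * hτ' - hα' / 4 - hτNK / 4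
  have e2 : τ + τ' = T0 := by
    apply RingOfIntegers.ext
    simp only [map_add, map_intCast]
    linear_combination (1 / 2 : K) * hτ + (1 / 2 : K) * hτ'
  have e3 : γ ^ 2 = p * τ := by
    apply RingOfIntegers.ext
    simp only [map_pow, map_mul, map_natCast]
    linear_combination (γ / 2 + (p + α) / 4 : K) * hγ - p / 2 * hτ + hα' / 4 + p / 4 * hT0K
  -- coprimality
  have hT0n : IsCoprime T0 ((n : ℤ) ^ (2 * k)) := by
    apply IsCoprime.pow_right
    rw [Int.isCoprime_iff_gcd_eq_one]
    by_contra hg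
    obtain ⟨r, hr, hrd⟩ := Nat.exists_prime_and_dvd hg
    have hr1 : (r : ℤ) ∣ T0 := (Int.natCast_dvd_natCast.2 hrd).trans (Int.gcd_dvd_left _ _)
    have hr2 : (r : ℤ) ∣ n := (Int.natCast_dvd_natCast.2 hrd).trans (Int.gcd_dvd_right _ _)
    have hr3 : (r : ℤ) ∣ (n : ℤ) ^ k := dvd_pow hr2 hk0
    rcases hr.eq_two_or_odd with h2 | h2
    · subst h2; omega
    · obtain ⟨s, hs⟩ := hr1
      obtain ⟨s', hs'⟩ := hr3
      have hc2 : IsCoprime (r : ℤ) 2 := by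
        rw [Int.isCoprime_iff_nat_coprime]
        exact (Nat.coprime_primes hr Nat.prime_two).2 (by omega)
      have h1 : (r : ℤ) ∣ p := hc2.dvd_of_dvd_mul_right ⟨2 * s + 4 * s', by
        linear_combination hT0 + hpqZ + 2 * hs + 4 * hs'⟩
      have h2 : (r : ℤ) ∣ q := hc2.dvd_of_dvd_mul_right ⟨-2 * s + 4 * s', by
        linear_combination -hT0 + hpqZ - 2 * hs + 4 * hs'⟩
      have h1' : r ∣ p := by exact_mod_cast h1
      have h2' : r ∣ q := by exact_mod_cast h2
      exact hne (((Nat.prime_dvd_prime_iff_eq hr hp).1 h1').symm.trans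
        ((Nat.prime_dvd_prime_iff_eq hr hq).1 h2'))
  have hcopI : IsCoprime (Ideal.span {τ}) (Ideal.span {τ'}) := by
    rw [Ideal.isCoprime_span_singleton_iff]
    obtain ⟨x, y, hxy⟩ := hT0n
    have hxy' : (x : 𝓞 K) * T0 + y * (n : 𝓞 K) ^ (2 * k) = 1 := by
      exact_mod_cast congrArg (Int.cast : ℤ → 𝓞 K) hxy
    exact ⟨x + y * τ', x, by linear_combination hxy' + (x : 𝓞 K) * e2 + (y : 𝓞 K) * e1⟩
  obtain ⟨C, hC⟩ := exists_eq_pow_of_mul_eq_pow_of_coprime (c := Ideal.span {(n : 𝓞 K)}) (n := 2 * k)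
    hcopI (by rw [Ideal.span_singleton_mul_span_singleton, e1, Ideal.span_singleton_pow])
  have hτ0 : τ ≠ 0 := by
    rintro rfl
    have : (n : 𝓞 K) ^ (2 * k) = 0 := by rw [← e1, zero_mul]
    exact hn0 (by exact_mod_cast pow_eq_zero_iff (by positivity) |>.1 this)
  have hC0 : C ≠ 0 := by
    rintro rfl
    rw [zero_pow (by positivity)] at hC
    exact hτ0 (Ideal.span_singleton_eq_bot.1 hC)
  have hγI : Ideal.span {γ} = P * C ^ k := by
    apply cl_pow_inj two_ne_zero
    rw [Ideal.span_singleton_pow, e3, mul_pow, hP, ← pow_mul, mul_comm k 2, ← hC,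
      Ideal.span_singleton_mul_span_singleton]
  have hcg : clc C ^ k = clc P := by
    have h1 : clc P * clc C ^ k = 1 := by
      rw [← clc_pow hC0, ← clc_mul hP0 (pow_ne_zero _ hC0), ← hγI, clc_span]
    rw [← hP2, sq] at h1
    exact mul_left_cancel h1
  have hNC : Ideal.absNorm C = n := by
    have h1 : Ideal.absNorm (C ^ (2 * k)) = n ^ (2 * k) := by
      rw [← hC, Ideal.absNorm_span_singleton]
      obtain ⟨T', B', N', h1, h2, h3⟩ := cl_int_repr hd0 hsq hα htop τ
      obtain ⟨f1, f2⟩ := cl_int_uniq hd0 hα (T := T0) (B := 1) (T' := T') (B' := B') (by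
        rw [← h1, hτ]; push_cast; ring)
      rw [h3]
      have : N' = (n : ℤ) ^ (2 * k) := by
        rw [← f1, ← f2] at h2; rw [mul_comm 2 k, pow_mul]; push_cast at h2; linarith
      rw [this, Int.natAbs_pow, Int.natAbs_natCast]
    rw [map_pow] at h1
    exact Nat.pow_left_injective (n := 2 * k) (by positivity) h1
  have hns : ∀ x : ClassGroup (𝓞 K), x ^ 2 ≠ clc C := by
    intro x hx
    obtain ⟨J, hJ0, rfl⟩ := clc_surj x
    rw [← clc_pow hJ0] at hx
    obtain ⟨u, v, hu, hv, huv⟩ := clc_eq hC0 (pow_ne_zero 2 hJ0) hx.symm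
    have h1 := congrArg Ideal.absNorm huv
    rw [map_mul, map_mul, map_pow, hNC, Ideal.absNorm_span_singleton, Ideal.absNorm_span_singleton] at h1
    set U := (Algebra.norm ℤ u).natAbs with hU
    set Vn := (Algebra.norm ℤ v).natAbs with hV
    set j := Ideal.absNorm J with hj
    have hV0 : Vn ≠ 0 := by
      rw [hV, ← Ideal.absNorm_span_singleton, Ne, Ideal.absNorm_eq_zero_iff]
      simpa using hv
    have hj0 : j ≠ 0 := by
      rw [hj, Ne, Ideal.absNorm_eq_zero_iff]; exact hJ0
    obtain ⟨T, B, N, hxT, hN, hNn⟩ := cl_int_repr hd0 hsq hα htop (u * v)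
    have h3 : 0 ≤ N := by nlinarith [sq_nonneg T, mul_nonneg (Int.natCast_nonneg (p * q)) (sq_nonneg B)]
    have hNUV : N = U * Vn := by
      rw [← Int.natAbs_of_nonneg h3, ← hNn, map_mul, Int.natAbs_mul, Nat.cast_mul]
    have h1Z : (U : ℤ) * (2 * m ^ 2) = Vn * j ^ 2 := by rw [hn] at h1; exact_mod_cast h1
    have := cl_descent p q hp hq hne hp8 (2 * Vn * j) (2 * m * T) (2 * m * B) (by
      rw [hNUV] at hN; push_cast at hN
      linear_combination 4 * (m : ℤ) ^ 2 * hN - 8 * (Vn : ℤ) * h1Z)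
    simp [hV0, hj0] at this
  have := cl_sylow_cyclic (ℓ - 1) (clc P) (clc C) hPn (fun x hx => htor x hx) hP2 hcg hns Sy
  rwa [Nat.sub_add_cancel hℓ] at this

end

section
open Finset

/-- additive character -/
noncomputable def ee (x : ℝ) : ℂ := Complex.exp ((2 * Real.pi * x : ℝ) * Complex.I)

lemma ee_add (x y : ℝ) : ee (x + y) = ee x * ee y := by
  rw [ee, ee, ee, ← Complex.exp_add]; congr 1; push_cast; ring
lemma ee_norm (x : ℝ) : ‖ee x‖ = 1 := Complex.norm_exp_ofReal_mul_I _
lemma ee_zero : ee 0 = 1 := by simp [ee]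
lemma ee_conj (x : ℝ) : (starRingEnd ℂ) (ee x) = ee (-x) := by
  rw [ee, ee, ← Complex.exp_conj]; congr 1
  rw [map_mul, Complex.conj_ofReal, Complex.conj_I]; push_cast; ring
lemma ee_int (z : ℤ) : ee z = 1 := by
  rw [ee, Complex.exp_eq_one_iff]; exact ⟨z, by push_cast; ring⟩
lemma ee_nat (z : ℕ) : ee z = 1 := by exact_mod_cast ee_int z
lemma ee_add_int (x : ℝ) (z : ℤ) : ee (x + z) = ee x := by rw [ee_add, ee_int, mul_one]
lemma ee_sub (x y : ℝ) : ee (x - y) = ee x * (starRingEnd ℂ) (ee y) := by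
  rw [ee_conj, ← ee_add, sub_eq_add_neg]
lemma ee_nat_mul (n : ℕ) (x : ℝ) : ee (n * x) = ee x ^ n := by
  rw [ee, ee, ← Complex.exp_nat_mul]; congr 1; push_cast; ring
lemma ee_mul_conj (x : ℝ) : ee x * (starRingEnd ℂ) (ee x) = 1 := by
  rw [← ee_sub, sub_self, ee_zero]

/-- distance to the nearest integer -/
noncomputable def nd (x : ℝ) : ℝ := |x - round x|
lemma nd_le (x : ℝ) (z : ℤ) : nd x ≤ |x - z| := round_le x z
lemma nd_nonneg (x : ℝ) : 0 ≤ nd x := abs_nonneg _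
lemma nd_le_half (x : ℝ) : nd x ≤ 1 / 2 := abs_sub_round x

lemma ee_sub_one_norm (x : ℝ) : ‖ee x - 1‖ = 2 * |Real.sin (Real.pi * x)| := by
  have := Complex.norm_exp_I_mul_ofReal_sub_one (2 * Real.pi * x)
  rw [ee, mul_comm, this, Real.norm_eq_abs, abs_mul, abs_two]
  congr 3; ring

lemma ee_sub_one_ge_abs {x : ℝ} (hx : |x| ≤ 1 / 2) : 4 * |x| ≤ ‖ee x - 1‖ := by
  rw [ee_sub_one_norm]
  have h0 : |Real.sin (Real.pi * x)| = |Real.sin (Real.pi * |x|)| := by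
    rcases abs_cases x with ⟨h, -⟩ | ⟨h, -⟩ <;> rw [h]
    rw [mul_neg, Real.sin_neg, abs_neg]
  rw [h0]
  have h1 := Real.mul_le_sin (x := Real.pi * |x|) (by positivity) (by nlinarith [Real.pi_pos])
  have h2 : 2 / Real.pi * (Real.pi * |x|) = 2 * |x| := by field_simp
  rw [h2] at h1
  linarith [le_abs_self (Real.sin (Real.pi * |x|))]

lemma ee_sub_one_ge (x : ℝ) : 4 * nd x ≤ ‖ee x - 1‖ := by
  have h := ee_sub_one_ge_abs (x := x - round x) (abs_sub_round x)
  have : ee (x - round x) = ee x := by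
    have := ee_add_int x (-round x)
    rw [← this]; congr 1; push_cast; ring
  rwa [this] at h

lemma ee_sub_one_le (x : ℝ) : ‖ee x - 1‖ ≤ 2 * Real.pi * |x| := by
  rw [ee_sub_one_norm]
  have := Real.abs_sin_le_abs (x := Real.pi * x)
  rw [abs_mul, abs_of_pos Real.pi_pos] at this
  linarith

lemma ee_sub_ee_le (x y : ℝ) : ‖ee x - ee y‖ ≤ 2 * Real.pi * |x - y| := by
  have : ee x - ee y = ee y * (ee (x - y) - 1) := by
    rw [mul_sub, ← ee_add, mul_one]; congr 2; ring
  rw [this, norm_mul, ee_norm, one_mul]; exact ee_sub_one_le _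

lemma ee_geom (N : ℕ) (β : ℝ) : ‖∑ n ∈ range N, ee (n * β)‖ * ‖ee β - 1‖ ≤ 2 := by
  simp_rw [ee_nat_mul]
  rw [← norm_mul, geom_sum_mul]
  refine (norm_sub_le _ _).trans ?_
  rw [← ee_nat_mul, ee_norm]; norm_num

/-- orthogonality mod `N`. -/
lemma ee_orth {N : ℕ} (hN : 0 < N) (z : ℤ) :
    ∑ j ∈ range N, ee (j * (z / N : ℝ)) = if (N : ℤ) ∣ z then (N : ℂ) else 0 := by
  have hN' : (N : ℝ) ≠ 0 := by positivity
  split_ifs with h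
  · obtain ⟨k, rfl⟩ := h
    have : ∀ j ∈ range N, ee (j * (((N * k : ℤ) : ℝ) / N)) = 1 := by
      intro j _
      rw [show (j : ℝ) * (((N * k : ℤ) : ℝ) / N) = ((j * k : ℤ) : ℝ) by push_cast; field_simp, ee_int]
    rw [sum_congr rfl this]; simp
  · simp_rw [ee_nat_mul]
    have h1 : ee (z / N) ≠ 1 := by
      intro h1
      rw [ee, Complex.exp_eq_one_iff] at h1
      obtain ⟨n, hn⟩ := h1
      apply h
      refine ⟨n, ?_⟩
      have h2 : ((2 * Real.pi * (z / N) : ℝ) : ℂ) = ((n * (2 * Real.pi) : ℝ) : ℂ) := by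
        have hI := Complex.I_ne_zero
        apply mul_right_cancel₀ hI
        rw [hn]; push_cast; ring
      have h3 : 2 * Real.pi * (z / N) = n * (2 * Real.pi) := by exact_mod_cast h2
      have h4 : (z : ℝ) / N = n := by
        have := Real.pi_pos
        have h5 : 2 * Real.pi ≠ 0 := by positivity
        apply mul_left_cancel₀ h5; linarith
      have h5 : (z : ℝ) = N * n := by field_simp at h4; linarith
      exact_mod_cast h5
    have h2 := geom_sum_mul (ee (z / N)) N
    rw [← ee_nat_mul, show (N : ℝ) * ((z : ℝ) / N) = z by field_simp, ee_int, sub_self] at h2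
    exact (mul_eq_zero.1 h2).resolve_right (sub_ne_zero.2 h1)

end

section
open Finset

lemma card_le_diam (T : Finset ℤ) (D : ℝ) (hD : 0 ≤ D) (h : ∀ x ∈ T, ∀ y ∈ T, (y : ℝ) - x ≤ D) :
    (#T : ℝ) ≤ D + 1 := by
  rcases T.eq_empty_or_nonempty with rfl | hT
  · simp; linarith
  have hsub : T ⊆ Icc (T.min' hT) (T.max' hT) := fun x hx =>
    mem_Icc.2 ⟨T.min'_le x hx, T.le_max' x hx⟩
  have h1 := card_le_card hsub
  rw [Int.card_Icc] at h1
  have h2 := h _ (T.min'_mem hT) _ (T.max'_mem hT)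
  have h3 : T.min' hT ≤ T.max' hT := T.min'_le_max' hT
  have h4 : (#T : ℤ) ≤ T.max' hT + 1 - T.min' hT := by omega
  have h5 : (#T : ℝ) ≤ T.max' hT + 1 - T.min' hT := by exact_mod_cast h4
  linarith

set_option maxHeartbeats 1000000 in
lemma vino {M : ℕ} {σ κ θ : ℝ} (hσ : 0 < σ) (hσ1 : σ ≤ 1) (hκ : 0 ≤ κ) (hκσ : κ ≤ σ / 16)
    {S : Finset ℕ} (hS : S ⊆ range M) (hc : σ * M ≤ #S) (hM : 24 / σ ^ 2 ≤ M)
    (h : ∀ n ∈ S, nd (n * θ) ≤ κ) :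
    ∃ q : ℕ, 1 ≤ q ∧ (q : ℝ) ≤ 3 / σ ∧ nd (q * θ) ≤ 18 * κ / (σ ^ 2 * M) := by
  have hM0 : (0 : ℝ) < M := lt_of_lt_of_le (by positivity) hM
  have hM24 : 24 ≤ σ ^ 2 * M := by
    rw [div_le_iff₀ (by positivity)] at hM; linarith
  have hσM : 24 ≤ σ * M := by nlinarith
  set B := ⌈2 / σ⌉₊ with hB
  have hB1 : 2 / σ ≤ B := Nat.le_ceil _
  have hB0 : (0 : ℝ) < B := lt_of_lt_of_le (by positivity) hB1
  have hB0' : 0 < B := by exact_mod_cast hB0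
  have hB2 : (B : ℝ) ≤ 3 / σ := by
    have h1 := (Nat.ceil_lt_add_one (by positivity : 0 ≤ 2 / σ)).le
    have h2 : 1 ≤ 1 / σ := by rw [le_div_iff₀ hσ]; linarith
    calc (B : ℝ) ≤ 2 / σ + 1 := h1
      _ ≤ 2 / σ + 1 / σ := by linarith
      _ = 3 / σ := by ring
  have hMB : (M : ℝ) / B ≤ σ * M / 2 := by
    rw [div_le_div_iff₀ hB0 two_pos]
    rw [div_le_iff₀ hσ] at hB1
    nlinarith
  obtain ⟨x, hx, y, hy, hxy, hxyB⟩ : ∃ x ∈ S, ∃ y ∈ S, x ≠ y ∧ x / B = y / B := by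
    apply exists_ne_map_eq_of_card_lt_of_maps_to (t := range (M / B + 1))
    · rw [card_range]
      have h1 : ((M / B + 1 : ℕ) : ℝ) ≤ M / B + 1 := by push_cast; gcongr; exact Nat.cast_div_le
      have : ((M / B + 1 : ℕ) : ℝ) < #S := by linarith
      exact_mod_cast this
    · intro n hn
      have := mem_range.1 (hS hn)
      simp only [coe_range, Set.mem_Iio]
      exact Nat.lt_succ_of_le (Nat.div_le_div_right this.le)
  obtain ⟨q, hq1, hqB, hqθ⟩ : ∃ q : ℕ, 1 ≤ q ∧ q ≤ B ∧ nd (q * θ) ≤ 2 * κ := by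
    wlog hlt : x < y generalizing x y
    · exact this y hy x hx hxy.symm hxyB.symm (by omega)
    refine ⟨y - x, by omega, ?_, ?_⟩
    · have h1 := Nat.div_add_mod x B
      have h2 := Nat.div_add_mod y B
      have h3 := Nat.mod_lt y hB0'
      rw [hxyB] at h1
      omega
    · refine (nd_le _ (round (y * θ) - round (x * θ))).trans ?_
      have h1 := h x hx
      have h2 := h y hy
      unfold nd at h1 h2
      rw [Nat.cast_sub hlt.le]; push_cast
      rw [abs_le] at *
      constructor <;> linarith
  refine ⟨q, hq1, le_trans (by exact_mod_cast hqB) hB2, ?_⟩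
  have hq0 : (0 : ℝ) < q := by exact_mod_cast hq1
  have hq3 : (q : ℝ) * σ ≤ 3 := by
    have : (q : ℝ) ≤ 3 / σ := le_trans (by exact_mod_cast hqB) hB2
    rwa [le_div_iff₀ hσ] at this
  set a := round (q * θ) with ha
  set ε := q * θ - a with hε
  have hndε : nd (q * θ) = |ε| := rfl
  rw [hndε] at hqθ ⊢
  rcases eq_or_ne ε 0 with h0 | h0
  · rw [h0, abs_zero]; positivity
  have hε0 : 0 < |ε| := abs_pos.2 h0
  obtain ⟨c, -, hcard⟩ := exists_le_card_fiber_of_nsmul_le_card_of_maps_to (s := S) (t := range q)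
    (f := fun n => n % q) (b := σ * M / q) (fun n _ => mem_range.2 (Nat.mod_lt _ hq1))
    ⟨0, mem_range.2 hq1⟩ (by
      rw [card_range, nsmul_eq_mul, mul_div_cancel₀ _ hq0.ne']; exact hc)
  set S' := S.filter (fun n => n % q = c) with hS'
  let z : ℕ → ℤ := fun n => round (n * θ) - (n / q : ℕ) * a
  have hz : ∀ n ∈ S', |c * θ + (n / q : ℕ) * ε - z n| ≤ κ := by
    intro n hn
    rw [hS', mem_filter] at hn
    have h1 := h n hn.1
    have h2 : (n : ℝ) = c + q * (n / q : ℕ) := by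
      have := Nat.mod_add_div n q; rw [hn.2] at this; exact_mod_cast this.symm
    unfold nd at h1
    have h3 : c * θ + (n / q : ℕ) * ε - z n = n * θ - round (n * θ) := by
      simp only [z, hε, Int.cast_sub, Int.cast_mul, Int.cast_natCast]
      linear_combination -θ * h2
    rw [h3]; exact h1
  have hl : ∀ n ∈ S', ((n / q : ℕ) : ℝ) ≤ M / q := by
    intro n hn
    have := mem_range.1 (hS (mem_filter.1 hn).1)
    refine Nat.cast_div_le.trans ?_
    gcongr
  set Λ := (M : ℝ) / q with hΛ
  have hΛ0 : 0 < Λ := by positivity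
  have himg : (#(S'.image z) : ℝ) ≤ Λ * |ε| + 2 * κ + 1 := by
    apply card_le_diam _ _ (by positivity)
    simp only [mem_image, forall_exists_index, and_imp, forall_apply_eq_imp_iff₂]
    intro n hn n' hn'
    have h1 := abs_le.1 (hz n hn)
    have h2 := abs_le.1 (hz n' hn')
    have h3 : ((n' / q : ℕ) : ℝ) * ε - (n / q : ℕ) * ε ≤ Λ * |ε| := by
      rw [← sub_mul]
      refine (le_abs_self _).trans ?_
      rw [abs_mul]
      gcongr
      rw [abs_le]
      constructor <;> linarith [hl n hn, hl n' hn', Nat.cast_nonneg (α := ℝ) (n / q),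
        Nat.cast_nonneg (α := ℝ) (n' / q)]
    linarith
  have hfib : ∀ y ∈ S'.image z, #(S'.filter (fun n => z n = y)) ≤ ⌊2 * κ / |ε| + 1⌋₊ := by
    intro y _
    rw [Nat.le_floor_iff (by positivity)]
    have hinj : #(S'.filter (fun n => z n = y)) =
        #((S'.filter (fun n => z n = y)).image (fun n => ((n / q : ℕ) : ℤ))) := by
      rw [card_image_of_injOn]
      intro n hn n' hn' hnn
      have hn1 := (mem_filter.1 (mem_filter.1 (mem_coe.1 hn)).1).2
      have hn2 := (mem_filter.1 (mem_filter.1 (mem_coe.1 hn')).1).2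
      have h1 := Nat.mod_add_div n q
      have h2 := Nat.mod_add_div n' q
      have h3 : n / q = n' / q := Nat.cast_injective (R := ℤ) hnn
      rw [← h1, ← h2, hn1, hn2, h3]
    rw [hinj]
    apply card_le_diam _ _ (by positivity)
    intro u hu v hv
    obtain ⟨n, hn, rfl⟩ := mem_image.1 hu
    obtain ⟨n', hn', rfl⟩ := mem_image.1 hv
    obtain ⟨hn, hny⟩ := mem_filter.1 hn
    obtain ⟨hn', hny'⟩ := mem_filter.1 hn'
    have h1 := abs_le.1 (hz n hn)
    have h2 := abs_le.1 (hz n' hn')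
    rw [hny] at h1; rw [hny'] at h2
    rw [le_div_iff₀ hε0]
    refine (le_abs_self _).trans ?_
    rw [abs_mul, abs_abs, ← abs_mul, abs_le]
    simp only [Int.cast_natCast]
    rw [sub_mul]
    constructor <;> linarith
  have hcard2 : (#S' : ℝ) ≤ (2 * κ / |ε| + 1) * (Λ * |ε| + 2 * κ + 1) := by
    have h1 : #S' ≤ ⌊2 * κ / |ε| + 1⌋₊ * #(S'.image z) := card_le_mul_card_image _ _ hfib
    have h2 : (#S' : ℝ) ≤ (⌊2 * κ / |ε| + 1⌋₊ : ℝ) * #(S'.image z) := by exact_mod_cast h1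
    refine h2.trans ?_
    gcongr
    exact Nat.floor_le (by positivity)
  have e1 : (2 * κ / |ε| + 1) * (Λ * |ε| + 2 * κ + 1) =
      2 * κ * Λ + (4 * κ * κ + 2 * κ) / |ε| + Λ * |ε| + 2 * κ + 1 := by field_simp; ring
  have hσΛ : σ * M / q = σ * Λ := by rw [hΛ]; ring
  rw [hσΛ] at hcard
  rw [e1] at hcard2
  have e2 : (4 * κ * κ + 2 * κ) / |ε| ≤ 3 * κ / |ε| := by gcongr; nlinarith only [hκ, hκσ, hσ1]
  have e3 : 2 * κ * Λ ≤ σ / 8 * Λ := by gcongr; linarith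
  have e4 : Λ * |ε| ≤ Λ * (σ / 8) := by gcongr; linarith
  have e5 : 8 ≤ σ * Λ := by
    rw [hΛ, ← mul_div_assoc, le_div_iff₀ hq0]
    have h1 : σ * (8 * q) ≤ σ * (σ * M) := by linarith
    exact le_of_mul_le_mul_left h1 hσ
  have e6 : σ * Λ / 2 ≤ 3 * κ / |ε| := by linarith
  rw [le_div_iff₀ hε0] at e6
  rw [le_div_iff₀ (by positivity)]
  have e7 : Λ * q = M := by rw [hΛ]; field_simp
  have e8 : σ * M * |ε| ≤ 6 * κ * q := by
    rw [← e7]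
    calc σ * (Λ * q) * |ε| = 2 * q * (σ * Λ / 2 * |ε|) := by ring
      _ ≤ 2 * q * (3 * κ) := by gcongr
      _ = _ := by ring
  calc |ε| * (σ ^ 2 * M) = σ * (σ * M * |ε|) := by ring
    _ ≤ σ * (6 * κ * q) := by gcongr
    _ = 6 * κ * (q * σ) := by ring
    _ ≤ 6 * κ * 3 := by gcongr
    _ = _ := by ring

end

section
open Finset

def IsP : ℕ → ℝ → (ℕ → ℝ) → Prop
  | 0, α, f => ∀ n, f n = α
  | D + 1, α, f => ∀ h : ℕ, IsP D ((D + 1 : ℕ) * h * α) (fun n => f (n + h) - f n)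

lemma vdc_aux (a : ℕ → ℂ) (N : ℕ) : ‖∑ n ∈ range N, a n‖ ^ 2 ≤
    2 * (∑ m ∈ range N, ∑ k ∈ range (m + 1), a m * (starRingEnd ℂ) (a k)).re := by
  induction N with
  | zero => simp
  | succ N ih =>
    rw [sum_range_succ, sum_range_succ (fun m => ∑ k ∈ range (m + 1), a m * (starRingEnd ℂ) (a k)),
      ← mul_sum, ← map_sum, sum_range_succ, Complex.add_re]
    set S := ∑ n ∈ range N, a n
    rw [← Complex.normSq_eq_norm_sq] at *
    simp only [Complex.normSq_apply, Complex.mul_re, Complex.conj_re, Complex.conj_im,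
      Complex.add_re, Complex.add_im] at *
    nlinarith [sq_nonneg (a N).re, sq_nonneg (a N).im]

/-- van der Corput differencing over the full range -/
lemma vdc (f : ℕ → ℝ) (N : ℕ) : ‖∑ n ∈ range N, ee (f n)‖ ^ 2 ≤
    2 * ∑ h ∈ range N, ‖∑ n ∈ range (N - h), ee (f (n + h) - f n)‖ := by
  refine (vdc_aux _ N).trans ?_
  gcongr
  refine (Complex.re_le_norm _).trans ?_
  refine le_trans (le_of_eq ?_) (norm_sum_le _ _)
  congr 1
  rw [← sum_range_diag_flip N (fun h n => ee (f (n + h) - f n))]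
  refine sum_congr rfl fun m _ => ?_
  rw [← sum_range_reflect]
  refine sum_congr rfl fun k hk => ?_
  have := mem_range.1 hk
  rw [ee_sub]
  congr 3; omega

set_option maxHeartbeats 1000000 in
theorem weyl (D : ℕ) (hD : 1 ≤ D) : ∃ C : ℕ, 1 ≤ C ∧ ∀ (α : ℝ) (f : ℕ → ℝ), IsP D α f →
    ∀ (N M : ℕ) (y : ℝ), 1 ≤ M → N ≤ M → 1 ≤ y → M / y ≤ ‖∑ n ∈ range N, ee (f n)‖ →
    ∃ r : ℕ, 1 ≤ r ∧ (r : ℝ) ≤ C * y ^ C ∧ nd (r * α) ≤ C * y ^ C / M ^ D := by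
  induction D, hD using Nat.le_induction with
  | base =>
    refine ⟨1, le_rfl, fun α f hf N M y hM hN hy h => ⟨1, le_rfl, by simpa using hy, ?_⟩⟩
    have hM0 : (0 : ℝ) < M := by exact_mod_cast hM
    have e : ∀ n, f n = n * α + f 0 := by
      intro n
      have := hf n 0
      simp at this; linarith
    have e' : ‖∑ n ∈ range N, ee (f n)‖ = ‖∑ n ∈ range N, ee (n * α)‖ := by
      rw [sum_congr rfl (fun n _ => by rw [e n, ee_add] : ∀ n ∈ range N, ee (f n) = ee (n * α) * ee (f 0)),
        ← sum_mul, norm_mul, ee_norm, mul_one]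
    rw [e'] at h
    have h1 := ee_geom N α
    have h2 := ee_sub_one_ge α
    have h3 := nd_nonneg α
    have h4 : M / y * (4 * nd α) ≤ 2 := le_trans (by gcongr) h1
    rw [Nat.cast_one, one_mul, one_mul, pow_one, pow_one, le_div_iff₀ hM0]
    rw [div_mul_eq_mul_div, div_le_iff₀ (by positivity)] at h4
    linarith
  | succ D hD ih =>
    obtain ⟨C, hC, ih⟩ := ih
    set A : ℕ := C * 4 ^ (C + 1) with hA
    set E : ℕ := 2 * C + 2 with hE
    have hA1 : 1 ≤ A := Nat.mul_pos hC (by positivity)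
    set C' : ℕ := (24 * (D + 1) * A) ^ (2 * D + 4) + E * (2 * D + 4) with hC'
    refine ⟨C', ?_, fun α f hf N M y hM hN hy h => ?_⟩
    · have : 1 ≤ (24 * (D + 1) * A) ^ (2 * D + 4) := Nat.pos_of_ne_zero (by positivity)
      omega
    have hM0 : (0 : ℝ) < M := by exact_mod_cast hM
    have hM1 : (1 : ℝ) ≤ M := by exact_mod_cast hM
    have hy0 : 0 < y := by linarith
    have hC1 : (1 : ℝ) ≤ C := by exact_mod_cast hC
    have hA1' : (1 : ℝ) ≤ A := by exact_mod_cast hA1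
    have hD1 : (1 : ℝ) ≤ D := by exact_mod_cast hD
    set K : ℝ := C * (4 * y ^ 2) ^ C with hK
    set Z : ℝ := A * y ^ E with hZ
    have hZK : Z = 4 * y ^ 2 * K := by
      rw [hZ, hK, hA, hE]; push_cast; ring
    have hy2 : 1 ≤ y ^ 2 := one_le_pow₀ hy
    have hK1 : 1 ≤ K := by
      have : (1 : ℝ) ≤ (4 * y ^ 2) ^ C := one_le_pow₀ (by linarith)
      rw [hK]; nlinarith
    have hZ1 : 1 ≤ Z := by rw [hZK]; nlinarith
    have hKZ : K ≤ Z := by rw [hZK]; nlinarith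
    have hbig : (24 * (D + 1) * Z) ^ (2 * D + 4) ≤ C' * y ^ C' := by
      have h1 : (24 * (D + 1) * Z) ^ (2 * D + 4) =
        ((24 * (D + 1) * A) ^ (2 * D + 4) : ℕ) * y ^ (E * (2 * D + 4)) := by
        rw [hZ]; push_cast; rw [pow_mul, ← mul_pow]; ring_nf
      rw [h1]
      have h2 : y ^ (E * (2 * D + 4)) ≤ y ^ C' := pow_le_pow_right₀ hy (by omega)
      have h3 : (((24 * (D + 1) * A) ^ (2 * D + 4) : ℕ) : ℝ) ≤ C' := by
        exact_mod_cast (by omega)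
      gcongr
    have hbase : 1 ≤ 24 * (D + 1) * Z := by nlinarith
    have hbig' : ∀ j ≤ 2 * D + 4, (24 * (D + 1) * Z) ^ j ≤ C' * y ^ C' := fun j hj =>
      (pow_le_pow_right₀ hbase hj).trans hbig
    -- trivial case
    by_cases htriv : (M : ℝ) ^ (D + 1) ≤ C' * y ^ C'
    · refine ⟨1, le_rfl, ?_, ?_⟩
      · simpa using hbig' 0 (by omega)
      · rw [le_div_iff₀ (by positivity)]
        have := nd_le_half ((1 : ℕ) * α)
        have h3 := nd_nonneg ((1 : ℕ) * α)
        have h4 : (0 : ℝ) < M ^ (D + 1) := by positivity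
        calc _ ≤ 1 * (M : ℝ) ^ (D + 1) := by
              gcongr; exact (nd_le_half _).trans (by norm_num)
          _ ≤ _ := by linarith
    push Not at htriv
    set σ : ℝ := 1 / Z with hσ
    have hσ0 : 0 < σ := by positivity
    have hσ1 : σ ≤ 1 := by rw [hσ, div_le_one (by positivity)]; exact hZ1
    set κ : ℝ := K / M ^ D with hκ
    have hκ0 : 0 ≤ κ := by positivity
    have hc1 : κ ≤ σ / 16 := by
      by_contra hcon
      push Not at hcon
      rw [hκ, hσ, div_div, div_lt_div_iff₀ (by positivity) (by positivity)] at hcon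
      have h1 : (M : ℝ) ≤ M ^ D := le_self_pow₀ hM1 (by omega)
      have h2 : (M : ℝ) ^ D ≤ 16 * Z * Z := by nlinarith
      have h3 : (M : ℝ) ^ (D + 1) ≤ (16 * Z * Z) * (16 * Z * Z) := by
        rw [pow_succ]; gcongr; linarith
      have h4 := hbig' 4 (by omega)
      have h5 : (16 * Z * Z) * (16 * Z * Z) ≤ (24 * (D + 1) * Z) ^ 4 := by
        calc (16 * Z * Z) * (16 * Z * Z) = (4 * 1 * Z) ^ 4 := by ring
          _ ≤ _ := by gcongr <;> linarith
      linarith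
    have hc2 : 24 / σ ^ 2 ≤ M := by
      by_contra hcon
      push Not at hcon
      have h1 : (M : ℝ) ≤ (24 * (D + 1) * Z) ^ 2 := by
        refine hcon.le.trans ?_
        rw [hσ, div_pow, one_pow, div_div_eq_mul_div, div_one]
        have : (1 : ℝ) ≤ (D + 1) ^ 2 := one_le_pow₀ (by linarith)
        have hZ2 : 0 < Z ^ 2 := by positivity
        calc 24 * Z ^ 2 = 24 * 1 * Z ^ 2 := by ring
          _ ≤ 24 ^ 2 * (D + 1) ^ 2 * Z ^ 2 := by gcongr; norm_num
          _ = _ := by ring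
      have h2 : (M : ℝ) ^ (D + 1) ≤ ((24 * (D + 1) * Z) ^ 2) ^ (D + 1) := by gcongr
      rw [← pow_mul] at h2
      linarith [hbig' (2 * (D + 1)) (by omega)]
    -- differencing
    set T : ℕ → ℝ := fun h => ‖∑ n ∈ range (N - h), ee (f (n + h) - f n)‖ with hT
    have hTM : ∀ h, T h ≤ M := fun h => by
      refine (norm_sum_le _ _).trans ?_
      simp only [ee_norm, sum_const, card_range, nsmul_eq_mul, mul_one]
      exact_mod_cast (by omega)
    have hv := vdc f N
    have hy' : 0 < 4 * y ^ 2 := by positivity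
    set H := (range N).filter (fun h => M / (4 * y ^ 2) ≤ T h) with hH
    have hsum : ∑ h ∈ range N, T h ≤ #H * M + M * (M / (4 * y ^ 2)) := by
      rw [← sum_filter_add_sum_filter_not (range N) (fun h => M / (4 * y ^ 2) ≤ T h)]
      gcongr
      · calc _ ≤ ∑ h ∈ H, (M : ℝ) := sum_le_sum fun h _ => hTM h
          _ = _ := by simp
      · calc _ ≤ ∑ h ∈ (range N).filter (fun h => ¬ M / (4 * y ^ 2) ≤ T h), (M / (4 * y ^ 2) : ℝ) :=
              sum_le_sum fun h hh => (not_le.1 (mem_filter.1 hh).2).le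
          _ ≤ ∑ h ∈ range N, (M / (4 * y ^ 2) : ℝ) :=
              sum_le_sum_of_subset_of_nonneg (filter_subset _ _) (fun _ _ _ => by positivity)
          _ = N * (M / (4 * y ^ 2)) := by simp
          _ ≤ _ := by gcongr
    have hHc : (M : ℝ) / (4 * y ^ 2) ≤ #H := by
      have h1 : (M / y) ^ 2 ≤ 2 * (#H * M + M * (M / (4 * y ^ 2))) :=
        (pow_le_pow_left₀ (by positivity) h 2).trans (hv.trans (by gcongr))
      have h2 : (M / y) ^ 2 = 4 * (M * (M / (4 * y ^ 2))) := by field_simp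
      rw [h2] at h1
      have h3 : M * (M / (4 * y ^ 2)) ≤ M * (#H : ℝ) := by linarith
      exact le_of_mul_le_mul_left h3 hM0
    have hr : ∀ h ∈ H, ∃ r : ℕ, 1 ≤ r ∧ (r : ℝ) ≤ K ∧
        nd (r * (((D + 1 : ℕ) : ℝ) * h * α)) ≤ κ := by
      intro j hj
      exact ih _ _ (hf j) (N - j) M (4 * y ^ 2) hM (by omega) (by linarith) (mem_filter.1 hj).2
    choose! r hr1 hr2 hr3 using hr
    have hKf : 0 < ⌊K⌋₊ := Nat.floor_pos.2 hK1
    obtain ⟨ρ, hρ, hcard⟩ := exists_le_card_fiber_of_nsmul_le_card_of_maps_to (s := H)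
      (t := Icc 1 ⌊K⌋₊) (f := r) (b := σ * M)
      (fun h hh => mem_Icc.2 ⟨hr1 h hh, Nat.le_floor (hr2 h hh)⟩) ⟨1, mem_Icc.2 ⟨le_rfl, hKf⟩⟩ (by
        rw [Nat.card_Icc, nsmul_eq_mul, Nat.add_sub_cancel]
        refine le_trans ?_ hHc
        calc (⌊K⌋₊ : ℝ) * (σ * M) ≤ K * (σ * M) := by
              gcongr; exact Nat.floor_le (by linarith)
          _ = _ := by rw [hσ, hZK]; field_simp)
    rw [mem_Icc] at hρ
    have hρK : (ρ : ℝ) ≤ K := (Nat.cast_le.2 hρ.2).trans (Nat.floor_le (by linarith))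
    obtain ⟨q, hq1, hq2, hq3⟩ := vino (M := M) (σ := σ) (κ := κ) (θ := ρ * ((D + 1 : ℕ) * α))
      hσ0 hσ1 hκ0 hc1 (S := H.filter (fun h => r h = ρ)) (fun j hj => by
        have := mem_range.1 (mem_filter.1 (mem_filter.1 hj).1).1
        exact mem_range.2 (by omega)) hcard hc2 (fun j hj => by
        rw [mem_filter] at hj
        have := hr3 j hj.1
        rw [hj.2] at this
        convert this using 2; ring)
    have hσi : 3 / σ = 3 * Z := by rw [hσ, div_div_eq_mul_div, div_one]
    rw [hσi] at hq2
    refine ⟨q * ρ * (D + 1), Nat.mul_pos (Nat.mul_pos hq1 hρ.1) (by omega), ?_, ?_⟩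
    · push_cast
      calc (q : ℝ) * ρ * (D + 1) ≤ (3 * Z) * Z * (D + 1) := by
            gcongr; linarith
        _ = 3 * (D + 1) * Z ^ 2 := by ring
        _ ≤ (24 * (D + 1)) ^ 2 * Z ^ 2 := by gcongr ?_ * _; nlinarith
        _ = (24 * (D + 1) * Z) ^ 2 := by ring
        _ ≤ _ := hbig' 2 (by omega)
    · have e : ((q * ρ * (D + 1) : ℕ) : ℝ) * α = q * (ρ * ((D + 1 : ℕ) * α)) := by push_cast; ring
      rw [e]
      refine hq3.trans ?_
      calc 18 * κ / (σ ^ 2 * M) = 18 * K * Z ^ 2 / M ^ (D + 1) := by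
            clear_value Z
            rw [hκ, hσ, pow_succ, div_eq_div_iff (by positivity) (by positivity)]
            field_simp
            exact pow_succ _ _
        _ ≤ _ := by
            refine div_le_div_of_nonneg_right ?_ (by positivity)
            calc 18 * K * Z ^ 2 ≤ 18 * Z * Z ^ 2 := by gcongr
              _ = 18 * Z ^ 3 := by ring
              _ ≤ (24 * (D + 1)) ^ 3 * Z ^ 3 := by
                gcongr ?_ * _
                nlinarith [pow_le_pow_left₀ (by norm_num : (0 : ℝ) ≤ 24) (by linarith : (24 : ℝ) ≤ 24 * (D + 1)) 3]
              _ = (24 * (D + 1) * Z) ^ 3 := by ring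
              _ ≤ _ := hbig' 3 (by omega)

end

section
open Finset

lemma isP_poly (D : ℕ) : ∀ (P : Polynomial ℝ), P.natDegree ≤ D →
    IsP D (P.coeff D) (fun n => P.eval (n : ℝ)) := by
  induction D with
  | zero =>
    intro P hP n
    rw [Polynomial.eq_C_of_natDegree_le_zero hP]; simp
  | succ D ih =>
    intro P hP h
    set T := Polynomial.taylor (h : ℝ) P - P with hT
    have hc : ∀ n, T.coeff n = (Polynomial.hasseDeriv n P).eval (h : ℝ) - P.coeff n := by
      intro n; rw [hT, Polynomial.coeff_sub, Polynomial.taylor_coeff]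
    have hdeg : T.natDegree ≤ D := by
      rw [Polynomial.natDegree_le_iff_coeff_eq_zero]
      intro n hn
      rw [hc]
      have h0 : Polynomial.hasseDeriv n P = Polynomial.C (P.coeff n) := by
        ext j
        rw [Polynomial.hasseDeriv_coeff, Polynomial.coeff_C]
        split_ifs with hj
        · subst hj; simp
        · rw [Polynomial.coeff_eq_zero_of_natDegree_lt (by omega), mul_zero]
      rw [h0, Polynomial.eval_C, sub_self]
    have hcD : T.coeff D = (D + 1 : ℕ) * h * P.coeff (D + 1) := by
      have h0 : Polynomial.hasseDeriv D P = Polynomial.C (P.coeff D) +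
          Polynomial.C ((D + 1 : ℕ) * P.coeff (D + 1)) * Polynomial.X := by
        ext j
        rw [Polynomial.hasseDeriv_coeff, Polynomial.coeff_add, Polynomial.coeff_C,
          Polynomial.coeff_C_mul, Polynomial.coeff_X]
        rcases j with _ | _ | j
        · simp
        · simp [add_comm 1 D]
        · rw [Polynomial.coeff_eq_zero_of_natDegree_lt (by omega)]; simp
      rw [hc, h0]; simp; ring
    have := ih T hdeg
    rw [hcD] at this
    convert this using 2 with n
    rw [hT, Polynomial.eval_sub, Polynomial.taylor_eval, add_comm]; push_cast; ring_nf

/-- Weyl bound for `α·P(n+i)`-type sums -/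
lemma isP_nat (P : Polynomial ℕ) (D : ℕ) (hP : P.natDegree ≤ D) (β : ℝ) :
    IsP D (P.coeff D * β) (fun n => β * (P.eval n : ℕ)) := by
  have := isP_poly D (Polynomial.C β * P.map (Nat.castRingHom ℝ))
    ((Polynomial.natDegree_C_mul_le _ _).trans (Polynomial.natDegree_map_le.trans hP))
  rw [Polynomial.coeff_C_mul, Polynomial.coeff_map] at this
  convert this using 1
  · simp [mul_comm]
  · ext n
    rw [Polynomial.eval_mul, Polynomial.eval_C, Polynomial.eval_natCast_map]; simp

/-- complete sums -/
noncomputable def GS (P : Polynomial ℕ) (b s : ℕ) : ℂ := ∑ x ∈ range s, ee ((b : ℝ) / s * (P.eval x : ℕ))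

lemma nd_ge_of_not_dvd {s : ℕ} (hs : 0 < s) (z : ℤ) (hz : ¬ (s : ℤ) ∣ z) :
    1 / (s : ℝ) ≤ nd ((z : ℝ) / s) := by
  unfold nd
  set m := round ((z : ℝ) / s)
  have hs0 : (0 : ℝ) < s := by exact_mod_cast hs
  have h1 : (z : ℝ) / s - m = ((z - s * m : ℤ) : ℝ) / s := by push_cast; field_simp
  rw [h1, abs_div, abs_of_pos hs0]
  gcongr
  have h2 : z - s * m ≠ 0 := fun h => hz ⟨m, by linarith⟩
  have := Int.one_le_abs h2
  exact_mod_cast this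

theorem GS_bound (D : ℕ) (hD : 2 ≤ D) :
    ∃ C : ℕ, 1 ≤ C ∧ (∀ (P : Polynomial ℕ), P.natDegree ≤ D → ∀ (b s : ℕ), 0 < s →
      b.Coprime s → s.Coprime (P.coeff D) → (‖GS P b s‖ / s) ^ C ≤ C / s) := by
  obtain ⟨C, hC, hw⟩ := weyl D (by omega)
  refine ⟨C, hC, fun P hP b s hs hb hc => ?_⟩
  have hs0 : (0 : ℝ) < s := by exact_mod_cast hs
  set x := ‖GS P b s‖ / s with hx
  have hx0 : 0 ≤ x := by positivity
  rcases hx0.eq_or_lt with h0 | h0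
  · rw [← h0, zero_pow (by omega)]; positivity
  have hx1 : x ≤ 1 := by
    rw [hx, div_le_one hs0]
    refine (norm_sum_le _ _).trans ?_
    simp [ee_norm]
  suffices hsuf : (s : ℝ) ≤ C * (1 / x) ^ C by
    rw [le_div_iff₀ hs0]
    calc x ^ C * s ≤ x ^ C * (C * (1 / x) ^ C) := by gcongr
      _ = C * (x * (1 / x)) ^ C := by rw [mul_pow]; ring
      _ = C := by rw [mul_one_div_cancel h0.ne']; simp
  have hy : 1 ≤ 1 / x := by rw [le_div_iff₀ h0]; linarith
  have h : s / (1 / x) ≤ ‖GS P b s‖ := by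
    rw [div_div_eq_mul_div, div_one, hx]; field_simp; rfl
  generalize 1 / x = y at hy h
  obtain ⟨r, hr1, hr2, hr3⟩ := hw _ _ (isP_nat P D hP (b / s)) s s y hs le_rfl hy h
  by_cases hd : s ∣ r
  · exact le_trans (by exact_mod_cast Nat.le_of_dvd hr1 hd) hr2
  have h1 : ¬ (s : ℤ) ∣ ((r * (P.coeff D * b) : ℕ) : ℤ) := by
    rw [Int.natCast_dvd_natCast]
    intro h
    exact hd ((Nat.Coprime.mul_right hc hb.symm).dvd_of_dvd_mul_right h)
  have h2 := nd_ge_of_not_dvd hs _ h1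
  have h3 : (((r * (P.coeff D * b) : ℕ) : ℤ) : ℝ) / s = r * (P.coeff D * (b / s)) := by
    push_cast; ring
  rw [h3] at h2
  have h4 := h2.trans hr3
  rw [div_le_div_iff₀ hs0 (by positivity), one_mul] at h4
  have h5 : (s : ℝ) * s ≤ s ^ D := by
    rw [← sq]; exact pow_le_pow_right₀ (by exact_mod_cast hs) hD
  have h6 := h5.trans h4
  exact le_of_mul_le_mul_right h6 hs0

end

section
open Finset

lemma nd_neg (x : ℝ) : nd (-x) = nd x := by
  have h : ∀ x, nd (-x) ≤ nd x := fun x => by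
    refine (nd_le _ (-round x)).trans ?_
    unfold nd; push_cast
    rw [← abs_neg]; ring_nf; rfl
  refine le_antisymm (h x) ?_
  simpa using h (-x)

lemma sum_inv_sq_nat (Z : Finset ℕ) (h : ∀ z ∈ Z, z ≠ 0) : ∑ z ∈ Z, 1 / (z : ℝ) ^ 2 ≤ 2 := by
  have h1 : Z ⊆ Ioc 0 (Z.sup id + 1) := fun z hz => by
    rw [mem_Ioc]; exact ⟨Nat.pos_of_ne_zero (h z hz), (le_sup (f := id) hz).trans (by omega)⟩
  refine (sum_le_sum_of_subset_of_nonneg h1 fun _ _ _ => by positivity).trans ?_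
  generalize Z.sup id = K
  have : ∀ K : ℕ, ∑ z ∈ Ioc 0 (K + 1), 1 / (z : ℝ) ^ 2 ≤ 2 - 1 / (K + 1 : ℝ) := by
    intro K
    induction K with
    | zero => norm_num
    | succ K ih =>
      rw [sum_Ioc_succ_top (by omega)]
      have : 1 / ((K + 1 + 1 : ℕ) : ℝ) ^ 2 ≤ 1 / (K + 1 : ℝ) - 1 / ((K + 1 : ℕ) + 1 : ℝ) := by
        push_cast
        rw [div_sub_div _ _ (by positivity) (by positivity), div_le_div_iff₀ (by positivity) (by positivity)]
        nlinarith [Nat.cast_nonneg (α := ℝ) K]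
      linarith
  exact (this K).trans (by have : (0:ℝ) ≤ 1 / (K + 1) := by positivity
                           linarith)

lemma sum_inv_sq_int (Z : Finset ℤ) (h : ∀ z ∈ Z, z ≠ 0) : ∑ z ∈ Z, 1 / (z : ℝ) ^ 2 ≤ 4 := by
  rw [← sum_filter_add_sum_filter_not Z (fun z => 0 < z)]
  have key : ∀ Y : Finset ℤ, (∀ z ∈ Y, z ≠ 0) → Set.InjOn Int.natAbs (Y : Set ℤ) →
      ∑ z ∈ Y, 1 / (z : ℝ) ^ 2 ≤ 2 := by
    intro Y h0 hi
    have h1 := sum_inv_sq_nat (Y.image Int.natAbs) (by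
      intro z hz
      obtain ⟨y, hy, rfl⟩ := mem_image.1 hz
      simpa using h0 y hy)
    rw [sum_image hi] at h1
    refine le_trans (le_of_eq (sum_congr rfl fun z _ => ?_)) h1
    rw [Nat.cast_natAbs]; push_cast; rw [sq_abs]
  have h1 := key (Z.filter (fun z => 0 < z)) (fun z hz => h z (mem_filter.1 hz).1) (by
    intro x hx y hy hxy
    have := (mem_filter.1 (mem_coe.1 hx)).2
    have := (mem_filter.1 (mem_coe.1 hy)).2
    omega)
  have h2 := key (Z.filter (fun z => ¬ 0 < z)) (fun z hz => h z (mem_filter.1 hz).1) (by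
    intro x hx y hy hxy
    have := (mem_filter.1 (mem_coe.1 hx)).2
    have := (mem_filter.1 (mem_coe.1 hy)).2
    omega)
  linarith

lemma spaced_sum {ι : Type*} [DecidableEq ι] (J : Finset ι) (α : ι → ℝ) (δ : ℝ) (hδ : 0 < δ)
    (hs : ∀ j ∈ J, ∀ k ∈ J, j ≠ k → δ ≤ nd (α j - α k)) (j : ι) (hj : j ∈ J) :
    ∑ k ∈ J.erase j, 1 / nd (α j - α k) ^ 2 ≤ 16 / δ ^ 2 := by
  set x : ι → ℝ := fun k => (α j - α k) - round (α j - α k) with hx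
  set z : ι → ℤ := fun k => ⌊x k / δ⌋ with hz
  have hxk : ∀ k ∈ J.erase j, δ ≤ |x k| := fun k hk => by
    rw [mem_erase] at hk; exact hs j hj k hk.2 hk.1.symm
  have hz1 : ∀ k, z k * δ ≤ x k := fun k => by
    have := Int.floor_le (x k / δ); rwa [le_div_iff₀ hδ] at this
  have hz2 : ∀ k, x k < (z k + 1) * δ := fun k => by
    have := Int.lt_floor_add_one (x k / δ); rwa [div_lt_iff₀ hδ] at this
  have hz0 : ∀ k ∈ J.erase j, z k ≠ 0 := by
    intro k hk h0
    have h1 := hz1 k; have h2 := hz2 k; have h3 := hxk k hk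
    rw [h0] at h1 h2
    rw [abs_of_nonneg (by simpa using h1)] at h3
    simp at h2; linarith
  have hinj : Set.InjOn z (J.erase j : Set ι) := by
    intro k hk l hl hkl
    by_contra hne
    have h1 := hs k (mem_erase.1 (mem_coe.1 hk)).2 l (mem_erase.1 (mem_coe.1 hl)).2 hne
    have h2 : nd (α k - α l) ≤ |x l - x k| := by
      refine (nd_le _ (-round (α j - α k) + round (α j - α l))).trans (le_of_eq ?_)
      congr 1; simp only [hx]; push_cast; ring
    have h3 : |x l - x k| < δ := by
      have a1 := hz1 k; have a2 := hz2 k; have a3 := hz1 l; have a4 := hz2 l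
      rw [hkl] at a1 a2
      rw [abs_lt]; constructor <;> nlinarith
    linarith
  have hb : ∀ k ∈ J.erase j, 1 / nd (α j - α k) ^ 2 ≤ 4 / δ ^ 2 * (1 / (z k : ℝ) ^ 2) := by
    intro k hk
    have h0 := hz0 k hk
    have h1 : δ * |(z k : ℝ)| ≤ 2 * |x k| := by
      have a1 := hz1 k; have a2 := hz2 k; have a3 := hxk k hk
      rcases lt_or_gt_of_ne h0 with h | h
      · have hzr : (z k : ℝ) ≤ -1 := by exact_mod_cast (by omega : z k ≤ -1)
        rw [abs_of_neg (by linarith : (z k : ℝ) < 0)]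
        have : -(x k) ≤ |x k| := neg_le_abs _
        nlinarith
      · have hzr : (1 : ℝ) ≤ z k := by exact_mod_cast (by omega : 1 ≤ z k)
        rw [abs_of_pos (by linarith : (0 : ℝ) < z k)]
        have : x k ≤ |x k| := le_abs_self _
        nlinarith
    have hz' : (z k : ℝ) ≠ 0 := by exact_mod_cast h0
    have hzp : 0 < |(z k : ℝ)| := abs_pos.2 hz'
    have hxp : 0 < |x k| := hδ.trans_le (hxk k hk)
    change 1 / |x k| ^ 2 ≤ _
    rw [← sq_abs (z k : ℝ), div_mul_div_comm, div_le_div_iff₀ (by positivity) (by positivity)]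
    have := pow_le_pow_left₀ (by positivity) h1 2
    nlinarith
  refine (sum_le_sum hb).trans ?_
  rw [← mul_sum]
  have h1 := sum_inv_sq_int ((J.erase j).image z) (by
    intro y hy
    obtain ⟨k, hk, rfl⟩ := mem_image.1 hy
    exact hz0 k hk)
  rw [sum_image hinj] at h1
  calc _ ≤ 4 / δ ^ 2 * 4 := by gcongr
    _ = _ := by ring

end

section
open Finset

noncomputable def ES (A : Finset ℕ) (α : ℝ) : ℂ := ∑ n ∈ A, ee (n * α)

lemma ee_geom_le (N : ℕ) (β : ℝ) : ‖∑ n ∈ range N, ee (n * β)‖ ≤ N := by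
  refine (norm_sum_le _ _).trans ?_
  simp [ee_norm]

lemma ee_geom_nd (N : ℕ) (β : ℝ) (h : 0 < nd β) : ‖∑ n ∈ range N, ee (n * β)‖ ≤ 1 / (2 * nd β) := by
  have h1 := ee_geom N β
  have h2 := ee_sub_one_ge β
  rw [le_div_iff₀ (by positivity)]
  have h3 : ‖∑ n ∈ range N, ee (n * β)‖ * (4 * nd β) ≤ 2 := le_trans (by gcongr) h1
  linarith

lemma ker_eq (X0 : ℝ) (h1 h2 : ℕ) (β : ℝ) :
    ∑ x ∈ range h1, ∑ y ∈ range h2, ee ((X0 + x - y) * β) =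
      ee (X0 * β) * ((∑ x ∈ range h1, ee (x * β)) * (∑ y ∈ range h2, ee (y * (-β)))) := by
  rw [sum_mul_sum, mul_sum]
  refine sum_congr rfl fun x _ => ?_
  rw [mul_sum]
  refine sum_congr rfl fun y _ => ?_
  rw [← ee_add, ← ee_add]; congr 1; ring

theorem large_sieve {ι : Type*} [DecidableEq ι] (J : Finset ι) (α : ι → ℝ) (δ : ℝ) (hδ : 0 < δ)
    (hs : ∀ j ∈ J, ∀ k ∈ J, j ≠ k → δ ≤ nd (α j - α k)) (h X0 : ℕ) (hh : 1 / δ ≤ h)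
    (A : Finset ℕ) (hA : A ⊆ Ico X0 (X0 + h)) :
    ∑ j ∈ J, ‖ES A (α j)‖ ^ 2 ≤ 6 * h * #A := by
  have hh0 : (0 : ℝ) < h := lt_of_lt_of_le (by positivity) hh
  set c : ι → ℂ := fun j => (starRingEnd ℂ) (ES A (α j)) with hc
  have hcn : ∀ j, ‖c j‖ = ‖ES A (α j)‖ := fun j => RCLike.norm_conj _
  set Cn : ℝ → ℂ := fun n => ∑ j ∈ J, c j * ee (n * α j) with hCn
  set Q := ∑ j ∈ J, ‖ES A (α j)‖ ^ 2 with hQ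
  have hQ0 : 0 ≤ Q := sum_nonneg fun _ _ => by positivity
  have q1 : Q ≤ ∑ n ∈ A, ‖Cn n‖ := by
    have e1 : (Q : ℂ) = ∑ n ∈ A, Cn n := by
      simp only [hCn]
      rw [sum_comm, hQ]; push_cast
      refine sum_congr rfl fun j _ => ?_
      rw [← mul_sum]
      change _ = c j * ES A (α j)
      rw [hc, Complex.conj_mul']
    have : Q = ‖(Q : ℂ)‖ := by rw [Complex.norm_real, Real.norm_of_nonneg hQ0]
    rw [this, e1]; exact norm_sum_le _ _
  have q2 : Q ^ 2 ≤ #A * ∑ n ∈ A, ‖Cn n‖ ^ 2 :=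
    (pow_le_pow_left₀ hQ0 q1 2).trans sq_sum_le_card_mul_sum_sq
  -- positivity
  have q3 : h * ∑ n ∈ A, ‖Cn n‖ ^ 2 ≤
      ∑ x ∈ range (2 * h), ∑ y ∈ range h, ‖Cn ((X0 : ℝ) + x - y)‖ ^ 2 := by
    rw [sum_comm]
    calc (h : ℝ) * ∑ n ∈ A, ‖Cn n‖ ^ 2 = ∑ y ∈ range h, ∑ n ∈ A, ‖Cn n‖ ^ 2 := by simp
      _ ≤ _ := sum_le_sum fun y hy => ?_
    have hy' := mem_range.1 hy
    have e : ∑ n ∈ A, ‖Cn n‖ ^ 2 =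
        ∑ x ∈ A.image (fun n => n - X0 + y), ‖Cn ((X0 : ℝ) + x - y)‖ ^ 2 := by
      rw [sum_image]
      · refine sum_congr rfl fun n hn => ?_
        have := mem_Ico.1 (hA hn)
        push_cast [Nat.cast_sub this.1]; ring_nf
      · intro a ha b hb hab
        have := mem_Ico.1 (hA (mem_coe.1 ha)); have := mem_Ico.1 (hA (mem_coe.1 hb))
        simp only at hab; omega
    rw [e]
    refine sum_le_sum_of_subset_of_nonneg (fun x hx => ?_) fun _ _ _ => by positivity
    obtain ⟨n, hn, rfl⟩ := mem_image.1 hx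
    have := mem_Ico.1 (hA hn)
    rw [mem_range]; omega
  -- kernel
  set B : ι → ι → ℝ := fun j k => if j = k then 2 * h ^ 2 else 1 / (4 * nd (α j - α k) ^ 2) with hB
  have hB0 : ∀ j k, 0 ≤ B j k := fun j k => by
    simp only [hB]; split_ifs <;> positivity
  have hBs : ∀ j k, B j k = B k j := fun j k => by
    simp only [hB]
    by_cases hjk : j = k
    · simp [hjk]
    · rw [if_neg hjk, if_neg (Ne.symm hjk), ← nd_neg, neg_sub]
  have hBsum : ∀ j ∈ J, ∑ k ∈ J, B j k ≤ 6 * h ^ 2 := by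
    intro j hj
    rw [← add_sum_erase _ _ hj]
    have h1 : ∑ k ∈ J.erase j, B j k = (1 / 4) * ∑ k ∈ J.erase j, 1 / nd (α j - α k) ^ 2 := by
      rw [mul_sum]
      refine sum_congr rfl fun k hk => ?_
      simp only [hB]
      rw [if_neg (mem_erase.1 hk).1.symm]; ring
    rw [h1]
    have h2 := spaced_sum J α δ hδ hs j hj
    have h3 : B j j = 2 * h ^ 2 := by simp [hB]
    have h4 : 16 / δ ^ 2 ≤ 16 * (h : ℝ) ^ 2 := by
      calc 16 / δ ^ 2 = 16 * (1 / δ) ^ 2 := by ring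
        _ ≤ _ := by gcongr
    linarith
  have hker : ∀ j ∈ J, ∀ k ∈ J,
      ‖∑ x ∈ range (2 * h), ∑ y ∈ range h, ee (((X0 : ℝ) + x - y) * (α j - α k))‖ ≤ B j k := by
    intro j hj k hk
    rw [ker_eq, norm_mul, ee_norm, one_mul, norm_mul]
    simp only [hB]
    split_ifs with hjk
    · refine (mul_le_mul (ee_geom_le _ _) (ee_geom_le _ _) (norm_nonneg _) (by positivity)).trans ?_
      push_cast; rw [sq]; linarith
    · have hp : 0 < nd (α j - α k) := hδ.trans_le (hs j hj k hk hjk)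
      refine (mul_le_mul (ee_geom_nd _ _ hp) (ee_geom_nd _ _ (by rwa [nd_neg])) (norm_nonneg _)
        (by positivity)).trans (le_of_eq ?_)
      rw [nd_neg]; field_simp; ring
  have q4 : ∑ x ∈ range (2 * h), ∑ y ∈ range h, ‖Cn ((X0 : ℝ) + x - y)‖ ^ 2 ≤ 6 * h ^ 2 * Q := by
    set T := ∑ x ∈ range (2 * h), ∑ y ∈ range h, ‖Cn ((X0 : ℝ) + x - y)‖ ^ 2 with hT
    have hT0 : 0 ≤ T := sum_nonneg fun _ _ => sum_nonneg fun _ _ => by positivity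
    have e0 : ∀ t : ℝ, ((‖Cn t‖ ^ 2 : ℝ) : ℂ) =
        ∑ j ∈ J, ∑ k ∈ J, c j * (starRingEnd ℂ) (c k) * ee (t * (α j - α k)) := by
      intro t
      push_cast
      rw [← Complex.mul_conj']
      simp only [hCn]
      rw [map_sum, sum_mul_sum]
      refine sum_congr rfl fun j _ => sum_congr rfl fun k _ => ?_
      rw [map_mul, mul_sub, ee_sub]; ring
    have e1 : (T : ℂ) = ∑ j ∈ J, ∑ k ∈ J, c j * (starRingEnd ℂ) (c k) *
        ∑ x ∈ range (2 * h), ∑ y ∈ range h, ee (((X0 : ℝ) + x - y) * (α j - α k)) := by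
      rw [hT, Complex.ofReal_sum]
      simp_rw [Complex.ofReal_sum, e0, mul_sum]
      rw [sum_congr rfl fun x _ => sum_comm, sum_comm]
      refine sum_congr rfl fun j _ => ?_
      rw [sum_congr rfl fun x _ => sum_comm, sum_comm]
    have e2 : T = ‖(T : ℂ)‖ := by rw [Complex.norm_real, Real.norm_of_nonneg hT0]
    rw [e2, e1]
    refine (norm_sum_le _ _).trans ((sum_le_sum fun j _ => norm_sum_le _ _).trans ?_)
    calc _ ≤ ∑ j ∈ J, ∑ k ∈ J, (‖c j‖ ^ 2 + ‖c k‖ ^ 2) / 2 * B j k := by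
          refine sum_le_sum fun j hj => sum_le_sum fun k hk => ?_
          rw [norm_mul, norm_mul, RCLike.norm_conj (c k)]
          refine mul_le_mul ?_ (hker j hj k hk) (norm_nonneg _) (by positivity)
          nlinarith [sq_nonneg (‖c j‖ - ‖c k‖)]
      _ = (∑ j ∈ J, ‖c j‖ ^ 2 * ∑ k ∈ J, B j k) / 2 + (∑ k ∈ J, ‖c k‖ ^ 2 * ∑ j ∈ J, B k j) / 2 := by
          simp_rw [add_div, add_mul, sum_add_distrib, sum_div, mul_sum]
          congr 1
          · simp_rw [sum_div]
            refine sum_congr rfl fun j _ => sum_congr rfl fun k _ => ?_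
            ring
          · rw [sum_comm]
            simp_rw [sum_div]
            refine sum_congr rfl fun j _ => sum_congr rfl fun k _ => ?_
            rw [hBs k j]; ring
      _ ≤ (∑ j ∈ J, ‖c j‖ ^ 2 * (6 * h ^ 2)) / 2 + (∑ j ∈ J, ‖c j‖ ^ 2 * (6 * h ^ 2)) / 2 := by
          gcongr with j hj j hj <;> exact hBsum j hj
      _ = 6 * h ^ 2 * Q := by
          rw [add_halves, ← sum_mul, hQ, mul_comm]
          simp_rw [hcn]
  rcases hQ0.eq_or_lt with h0 | h0
  · rw [← h0]; positivity
  have q5 : h * Q ^ 2 ≤ #A * (6 * h ^ 2 * Q) := by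
    calc (h : ℝ) * Q ^ 2 ≤ h * (#A * ∑ n ∈ A, ‖Cn n‖ ^ 2) := by gcongr
      _ = #A * (h * ∑ n ∈ A, ‖Cn n‖ ^ 2) := by ring
      _ ≤ _ := mul_le_mul_of_nonneg_left (q3.trans q4) (by positivity)
  have q6 : (h * Q) * Q ≤ (h * Q) * (6 * h * #A) := by linarith
  exact le_of_mul_le_mul_left q6 (by positivity)

end

section
open Finset

noncomputable def VV (u : ℕ) : Finset ℕ := (range u).filter (fun v => u.Coprime v)

lemma moebius_ind (n : ℕ) :
    ∑ d ∈ n.divisors, (ArithmeticFunction.moebius d : ℂ) = if n = 1 then 1 else 0 := by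
  have h := congrArg (fun f => f n) ArithmeticFunction.coe_zeta_mul_moebius
  simp only [ArithmeticFunction.coe_zeta_mul_apply, ArithmeticFunction.one_apply] at h
  have h2 := congrArg (Int.cast (R := ℂ)) h
  push_cast at h2
  exact h2

lemma ramanujan {u m : ℕ} (hu : 0 < u) (h : m.Coprime u) :
    ∑ v ∈ VV u, ee (v * (m / u : ℝ)) = (ArithmeticFunction.moebius u : ℂ) := by
  have e1 : ∀ v ∈ range u, (if u.Coprime v then ee (v * (m / u : ℝ)) else 0) =
      ∑ d ∈ u.divisors, if d ∣ v then (ArithmeticFunction.moebius d : ℂ) * ee (v * (m / u : ℝ)) else 0 := by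
    intro v _
    rw [← sum_filter, ← sum_mul]
    have : u.divisors.filter (fun d => d ∣ v) = (u.gcd v).divisors := by
      ext d
      simp only [mem_filter, Nat.mem_divisors, Nat.dvd_gcd_iff]
      have : u.gcd v ≠ 0 := (Nat.gcd_pos_of_pos_left _ hu).ne'
      have := hu.ne'
      tauto
    rw [this, moebius_ind]
    unfold Nat.Coprime
    split_ifs <;> simp
  unfold VV
  rw [sum_filter, sum_congr rfl e1, sum_comm]
  have e2 : ∀ d ∈ u.divisors, (∑ v ∈ range u, if d ∣ v then (ArithmeticFunction.moebius d : ℂ) *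
      ee (v * (m / u : ℝ)) else 0) = if d = u then (ArithmeticFunction.moebius u : ℂ) else 0 := by
    intro d hd
    obtain ⟨k, hk⟩ := Nat.dvd_of_mem_divisors hd
    have hk0 : 0 < k := Nat.pos_of_ne_zero (by rintro rfl; omega)
    have hd0 : 0 < d := Nat.pos_of_ne_zero (by rintro rfl; omega)
    rw [← sum_filter]
    have : (range u).filter (fun v => d ∣ v) = (range k).image (fun j => d * j) := by
      ext v
      simp only [mem_filter, mem_range, mem_image]
      constructor
      · rintro ⟨hv, j, rfl⟩
        exact ⟨j, by rw [hk] at hv; exact lt_of_mul_lt_mul_left hv (Nat.zero_le d), rfl⟩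
      · rintro ⟨j, hj, rfl⟩
        exact ⟨by rw [hk]; exact Nat.mul_lt_mul_of_pos_left hj hd0, j, rfl⟩
    rw [this, sum_image (fun a _ b _ hab => Nat.eq_of_mul_eq_mul_left hd0 hab), ← mul_sum]
    have e3 : ∀ j ∈ range k, ee ((d * j : ℕ) * (m / u : ℝ)) = ee (j * ((m : ℤ) / k : ℝ)) := by
      intro j _
      congr 1; rw [hk]; push_cast
      have : (d : ℝ) ≠ 0 := by positivity
      have : (k : ℝ) ≠ 0 := by positivity
      field_simp
    rw [sum_congr rfl e3, ee_orth hk0]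
    by_cases hk1 : k = 1
    · subst hk1
      have : d = u := by omega
      simp [this]
    · have h1 : ¬ (k : ℤ) ∣ m := by
        rw [Int.natCast_dvd_natCast]
        intro hkm
        exact hk1 (Nat.dvd_one.1 (h ▸ Nat.dvd_gcd hkm ⟨d, by rw [hk, mul_comm]⟩))
      have h2 : d ≠ u := by
        intro hdu
        apply hk1
        have : d * k = d * 1 := by rw [← hk, hdu, mul_one]
        exact Nat.eq_of_mul_eq_mul_left hd0 this
      rw [if_neg h1, if_neg h2, mul_zero]
  rw [sum_congr rfl e2, sum_ite_eq' , if_pos (Nat.mem_divisors_self u hu.ne')]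

lemma es_lift {u t : ℕ} (hu : Squarefree u) (A : Finset ℕ) (h : ∀ n ∈ A, (n + t).Coprime u) (α : ℝ) :
    ‖ES A α‖ ^ 2 ≤ u.totient * ∑ v ∈ VV u, ‖ES A (α + v / u)‖ ^ 2 := by
  have hu0 : 0 < u := Nat.pos_of_ne_zero hu.ne_zero
  have e : (ArithmeticFunction.moebius u : ℂ) * ES A α =
      ∑ v ∈ VV u, ee (v * t / u) * ES A (α + v / u) := by
    unfold ES
    simp_rw [mul_sum]
    rw [sum_comm]
    refine sum_congr rfl fun n hn => ?_
    rw [← ramanujan hu0 (h n hn), sum_mul]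
    refine sum_congr rfl fun v _ => ?_
    rw [← ee_add, ← ee_add]
    congr 1; push_cast; ring
  have h1 : ‖ES A α‖ = ‖(ArithmeticFunction.moebius u : ℂ) * ES A α‖ := by
    rw [norm_mul]
    have : ‖(ArithmeticFunction.moebius u : ℂ)‖ = 1 := by
      rw [Complex.norm_intCast]
      have := ArithmeticFunction.abs_moebius_eq_one_of_squarefree hu
      exact_mod_cast this
    rw [this, one_mul]
  have h2 : ‖ES A α‖ ≤ ∑ v ∈ VV u, ‖ES A (α + v / u)‖ := by
    rw [h1, e]
    refine (norm_sum_le _ _).trans (le_of_eq (sum_congr rfl fun v _ => ?_))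
    rw [norm_mul, ee_norm, one_mul]
  have h3 : (u.totient : ℝ) = #(VV u) := rfl
  rw [h3]
  exact (pow_le_pow_left₀ (norm_nonneg _) h2 2).trans sq_sum_le_card_mul_sum_sq

end

section
open Finset

lemma frac_sep {s s' u u' b b' v v' : ℕ} (hs : 0 < s) (hs' : 0 < s') (hu : 0 < u) (hu' : 0 < u')
    (c1 : s.Coprime u) (c2 : s.Coprime u') (c3 : s'.Coprime u) (c4 : s'.Coprime u')
    (hb : s.Coprime b) (hb' : s'.Coprime b') (hv : u.Coprime v) (hv' : u'.Coprime v')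
    (hbs : b < s) (hbs' : b' < s') (hvu : v < u) (hvu' : v' < u')
    (hne : ¬ (s = s' ∧ b = b' ∧ u = u' ∧ v = v')) :
    1 / ((s * u * (s' * u') : ℕ) : ℝ) ≤ nd ((b / s + v / u : ℝ) - (b' / s' + v' / u')) := by
  have key := nd_ge_of_not_dvd (s := s * u * (s' * u')) (by positivity)
    (((b * u + v * s : ℕ) : ℤ) * ((s' * u' : ℕ) : ℤ) - ((b' * u' + v' * s' : ℕ) : ℤ) * ((s * u : ℕ) : ℤ)) ?_
  · refine key.trans (le_of_eq ?_)
    congr 1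
    have : (s : ℝ) ≠ 0 := by positivity
    have : (s' : ℝ) ≠ 0 := by positivity
    have : (u : ℝ) ≠ 0 := by positivity
    have : (u' : ℝ) ≠ 0 := by positivity
    push_cast; field_simp
  · intro hd
    apply hne
    have cop : ∀ {s u b v : ℕ}, s.Coprime u → s.Coprime b → u.Coprime v →
        (s * u).Coprime (b * u + v * s) := by
      intro s u b v h1 h2 h3
      apply Nat.Coprime.mul_left
      · rw [Nat.coprime_add_mul_right_right]; exact h2.mul_right h1
      · rw [Nat.coprime_mul_right_add_right]
        exact h3.mul_right h1.symm
    have d1 : s * u ∣ s' * u' := by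
      have h1 : ((s * u : ℕ) : ℤ) ∣ ((b * u + v * s : ℕ) : ℤ) * ((s' * u' : ℕ) : ℤ) := by
        have h2 : ((s * u : ℕ) : ℤ) ∣ ((s * u * (s' * u') : ℕ) : ℤ) := by
          rw [Int.natCast_dvd_natCast]; exact dvd_mul_right _ _
        have h3 := (h2.trans hd)
        exact (Int.dvd_iff_dvd_of_dvd_sub h3).2 (dvd_mul_left _ _)
      have h4 : s * u ∣ (b * u + v * s) * (s' * u') := by exact_mod_cast h1
      exact (cop c1 hb hv).dvd_of_dvd_mul_left h4
    have d2 : s' * u' ∣ s * u := by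
      have h1 : ((s' * u' : ℕ) : ℤ) ∣ ((b' * u' + v' * s' : ℕ) : ℤ) * ((s * u : ℕ) : ℤ) := by
        have h2 : ((s' * u' : ℕ) : ℤ) ∣ ((s * u * (s' * u') : ℕ) : ℤ) := by
          rw [Int.natCast_dvd_natCast]; exact dvd_mul_left _ _
        have h3 := (h2.trans hd)
        exact (Int.dvd_iff_dvd_of_dvd_sub h3).1 (dvd_mul_left _ _)
      have h4 : s' * u' ∣ (b' * u' + v' * s') * (s * u) := by exact_mod_cast h1
      exact (cop c4 hb' hv').dvd_of_dvd_mul_left h4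
    have es : s = s' := Nat.dvd_antisymm
      (c2.dvd_of_dvd_mul_right ((dvd_mul_right _ _).trans d1))
      (c3.dvd_of_dvd_mul_right ((dvd_mul_right _ _).trans d2))
    have eu : u = u' := Nat.dvd_antisymm
      (c3.symm.dvd_of_dvd_mul_left ((dvd_mul_left _ _).trans d1))
      (c2.symm.dvd_of_dvd_mul_left ((dvd_mul_left _ _).trans d2))
    subst es eu
    have h1 : ((s * u : ℕ) : ℤ) ∣ ((b : ℤ) - b') * u + ((v : ℤ) - v') * s := by
      have h0 : ((s * u : ℕ) : ℤ) ≠ 0 := by positivity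
      apply Int.dvd_of_mul_dvd_mul_left h0
      convert hd using 1 <;> push_cast <;> ring
    have hi1 : (s : ℤ) ∣ (b : ℤ) - b' := by
      have h2 : (s : ℤ) ∣ ((b : ℤ) - b') * u + ((v : ℤ) - v') * s :=
        dvd_trans (by push_cast; exact dvd_mul_right _ _) h1
      rw [dvd_add_left (dvd_mul_left _ _)] at h2
      exact (Nat.isCoprime_iff_coprime.2 c1).dvd_of_dvd_mul_right h2
    have hi2 : (u : ℤ) ∣ (v : ℤ) - v' := by
      have h2 : (u : ℤ) ∣ ((b : ℤ) - b') * u + ((v : ℤ) - v') * s :=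
        dvd_trans (by push_cast; exact dvd_mul_left _ _) h1
      rw [dvd_add_right (dvd_mul_left _ _)] at h2
      exact (Nat.isCoprime_iff_coprime.2 c1).symm.dvd_of_dvd_mul_right h2
    have fin : ∀ {s b b' : ℕ}, b < s → b' < s → (s : ℤ) ∣ (b : ℤ) - b' → b = b' := by
      intro s b b' h1 h2 h3
      have := Int.eq_zero_of_abs_lt_dvd h3 (by rw [abs_lt]; constructor <;> omega)
      omega
    exact ⟨rfl, fin hbs hbs' hi1, rfl, fin hvu hvu' hi2⟩

theorem ls_prime (h X0 g R : ℕ) (hR : 1 ≤ R) (hh : (2 * R * g) ^ 2 ≤ h)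
    (A : Finset ℕ) (hA : A ⊆ Ico X0 (X0 + h)) (U : Finset ℕ)
    (hU : ∀ u ∈ U, Squarefree u ∧ u ≤ g ∧ (∀ p, p.Prime → p ∣ u → 2 * R ≤ p) ∧
      ∃ t, ∀ n ∈ A, (n + t).Coprime u) (β : ℝ) :
    (∑ u ∈ U, 1 / (u.totient : ℝ)) *
      ∑ s ∈ Ico R (2 * R), ∑ b ∈ VV s, ‖ES A (β + b / s)‖ ^ 2 ≤ 6 * h * #A := by
  classical
  rcases U.eq_empty_or_nonempty with rfl | ⟨u0, hu0⟩
  · simp; positivity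
  have hg : 0 < g := lt_of_lt_of_le (Nat.pos_of_ne_zero (hU u0 hu0).1.ne_zero) (hU u0 hu0).2.1
  have hRg : 0 < 2 * R * g := by positivity
  have hRg' : (0 : ℝ) < ((2 * R * g : ℕ) : ℝ) := by exact_mod_cast hRg
  have main := large_sieve (((Ico R (2 * R)).sigma VV) ×ˢ (U.sigma VV))
    (fun x => β + ((x.1.2 : ℝ) / x.1.1 + (x.2.2 : ℝ) / x.2.1)) (1 / ((2 * R * g : ℕ) : ℝ) ^ 2)
    (by positivity) (by
      rintro ⟨⟨s, b⟩, ⟨u, v⟩⟩ hx ⟨⟨s', b'⟩, ⟨u', v'⟩⟩ hy hne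
      simp only [mem_product, mem_sigma, mem_Ico, VV, mem_filter, mem_range] at hx hy
      obtain ⟨⟨⟨hs1, hs2⟩, hb1, hb2⟩, hu, hv1, hv2⟩ := hx
      obtain ⟨⟨⟨hs1', hs2'⟩, hb1', hb2'⟩, hu', hv1', hv2'⟩ := hy
      have cop : ∀ s u, R ≤ s → s < 2 * R → u ∈ U → s.Coprime u := by
        intro s u h1 h2 h3
        refine Nat.coprime_of_dvd fun p hp hps hpu => ?_
        have := (hU u h3).2.2.1 p hp hpu
        have := Nat.le_of_dvd (by omega) hps
        omega
      have := frac_sep (by omega) (by omega) (by omega) (by omega) (cop s u hs1 hs2 hu)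
        (cop s u' hs1 hs2 hu') (cop s' u hs1' hs2' hu) (cop s' u' hs1' hs2' hu') hb2 hb2' hv2 hv2'
        hb1 hb1' hv1 hv1' (by
          rintro ⟨rfl, rfl, rfl, rfl⟩; exact hne rfl)
      simp only [add_sub_add_left_eq_sub]
      refine le_trans ?_ this
      apply one_div_le_one_div_of_le
      · exact_mod_cast Nat.mul_pos (Nat.mul_pos (by omega) (by omega)) (Nat.mul_pos (by omega) (by omega))
      · have h1 : s * u ≤ 2 * R * g := Nat.mul_le_mul hs2.le (hU u hu).2.1
        have h2 : s' * u' ≤ 2 * R * g := Nat.mul_le_mul hs2'.le (hU u' hu').2.1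
        have h3 : s * u * (s' * u') ≤ (2 * R * g) ^ 2 := by rw [sq]; exact Nat.mul_le_mul h1 h2
        exact_mod_cast h3) h X0 (by
      rw [one_div_one_div]; exact_mod_cast hh) A hA
  refine le_trans ?_ main
  rw [sum_product, sum_sigma, mul_sum]
  refine sum_le_sum fun s _ => ?_
  rw [mul_sum]
  refine sum_le_sum fun b _ => ?_
  rw [sum_sigma, sum_mul]
  refine sum_le_sum fun u hu => ?_
  obtain ⟨h1, h2, h3, t, ht⟩ := hU u hu
  have hφ : (0 : ℝ) < u.totient := by
    exact_mod_cast Nat.totient_pos.2 (Nat.pos_of_ne_zero h1.ne_zero)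
  have := es_lift h1 A ht (β + b / s)
  rw [one_div, inv_mul_le_iff₀ hφ]
  simpa only [add_assoc] using this

end

section
open Finset

open Classical in
noncomputable def UU (R g : ℕ) : Finset ℕ :=
  {u ∈ Icc 1 g | Squarefree u ∧ ∀ p, p.Prime → p ∣ u → 2 * R ≤ p}

noncomputable def PP (R : ℕ) : Finset ℕ := {p ∈ range (2 * R) | p.Prime}

lemma log_le_UU (R g : ℕ) : Real.log g ≤
    2 * (∏ p ∈ PP R, (1 + 1 / (p : ℝ))) * ∑ u ∈ UU R g, 1 / (u.totient : ℝ) := by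
  classical
  have h1 : Real.log g ≤ ∑ n ∈ Icc 1 g, 1 / (n : ℝ) := by
    rcases Nat.eq_zero_or_pos g with rfl | hg
    · simp
    have := log_add_one_le_harmonic g
    rw [harmonic_eq_sum_Icc] at this
    push_cast at this
    simp_rw [one_div]
    refine le_trans (Real.log_le_log (by exact_mod_cast hg) (by linarith)) this
  set Tt := Icc 1 g ×ˢ ((PP R).powerset ×ˢ UU R g) with hT
  set F : ℕ × Finset ℕ × ℕ → ℕ := fun x => x.1 ^ 2 * (∏ p ∈ x.2.1, p) * x.2.2 with hF
  have hsurj : ∀ n ∈ Icc 1 g, ∃ x ∈ Tt, F x = n := by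
    intro n hn
    rw [mem_Icc] at hn
    obtain ⟨a, b, hab, ha⟩ := Nat.sq_mul_squarefree n
    have ha0 : a ≠ 0 := ha.ne_zero
    have hb0 : 0 < b := Nat.pos_of_ne_zero (by rintro rfl; simp at hab; omega)
    have hp := Nat.prod_primeFactors_of_squarefree ha
    rw [← prod_filter_mul_prod_filter_not a.primeFactors (fun p => p < 2 * R)] at hp
    set s2 := ∏ p ∈ a.primeFactors with ¬ p < 2 * R, p with hs2
    have hs2a : s2 ∣ a := ⟨_, by rw [mul_comm]; exact hp.symm⟩
    have han : a ≤ n := by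
      rw [← hab]; exact Nat.le_mul_of_pos_left _ (by positivity)
    refine ⟨(b, a.primeFactors.filter (fun p => p < 2 * R), s2), ?_, ?_⟩
    · simp only [hT, mem_product, mem_Icc, mem_powerset, UU, mem_filter]
      refine ⟨⟨hb0, ?_⟩, ?_, ⟨Nat.pos_of_dvd_of_pos hs2a (by omega), ?_⟩, ha.squarefree_of_dvd hs2a, ?_⟩
      · refine le_trans ?_ hn.2
        rw [← hab]
        calc b ≤ b ^ 2 := Nat.le_self_pow (by norm_num) b
          _ ≤ _ := Nat.le_mul_of_pos_right _ (by omega)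
      · intro p hp
        rw [mem_filter] at hp
        rw [PP, mem_filter, mem_range]
        exact ⟨hp.2, Nat.prime_of_mem_primeFactors hp.1⟩
      · exact (Nat.le_of_dvd (by omega) hs2a).trans (han.trans hn.2)
      · intro p hp hps
        rw [hs2, Prime.dvd_finset_prod_iff hp.prime] at hps
        obtain ⟨q, hq, hpq⟩ := hps
        rw [mem_filter] at hq
        rw [(Nat.prime_dvd_prime_iff_eq hp (Nat.prime_of_mem_primeFactors hq.1)).1 hpq]
        omega
    · simp only [hF]
      rw [mul_assoc, hp, hab]
  choose! ψ hψ1 hψ2 using hsurj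
  have hinj : Set.InjOn ψ (Icc 1 g : Finset ℕ) := by
    intro a ha b hb hab
    rw [← hψ2 a ha, ← hψ2 b hb, hab]
  have h2 : ∑ n ∈ Icc 1 g, 1 / (n : ℝ) ≤ ∑ x ∈ Tt, 1 / (F x : ℝ) := by
    calc _ = ∑ n ∈ Icc 1 g, 1 / (F (ψ n) : ℝ) := sum_congr rfl fun n hn => by rw [hψ2 n hn]
      _ = ∑ x ∈ (Icc 1 g).image ψ, 1 / (F x : ℝ) := by rw [sum_image hinj]
      _ ≤ _ := sum_le_sum_of_subset_of_nonneg (image_subset_iff.2 hψ1) fun _ _ _ => by positivity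
  have h3 : ∑ x ∈ Tt, 1 / (F x : ℝ) =
      (∑ k ∈ Icc 1 g, 1 / (k : ℝ) ^ 2) * ((∏ p ∈ PP R, (1 + 1 / (p : ℝ))) * ∑ u ∈ UU R g, 1 / (u : ℝ)) := by
    rw [prod_one_add, sum_mul_sum, ← sum_product', sum_mul_sum, ← sum_product']
    refine sum_congr rfl fun x _ => ?_
    simp only [hF, prod_div_distrib, prod_const_one]
    push_cast
    field_simp
  have h4 := sum_inv_sq_nat (Icc 1 g) (fun z hz => by rw [mem_Icc] at hz; omega)
  have h5 : ∑ u ∈ UU R g, 1 / (u : ℝ) ≤ ∑ u ∈ UU R g, 1 / (u.totient : ℝ) := by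
    refine sum_le_sum fun u hu => ?_
    rw [UU, mem_filter, mem_Icc] at hu
    apply one_div_le_one_div_of_le
    · exact_mod_cast Nat.totient_pos.2 (by omega)
    · exact_mod_cast Nat.totient_le u
  have h6 : 0 ≤ ∏ p ∈ PP R, (1 + 1 / (p : ℝ)) := prod_nonneg fun _ _ => by positivity
  have h7 : 0 ≤ ∑ u ∈ UU R g, 1 / (u : ℝ) := sum_nonneg fun _ _ => by positivity
  calc _ ≤ _ := h1.trans (h2.trans h3.le)
    _ ≤ 2 * ((∏ p ∈ PP R, (1 + 1 / (p : ℝ))) * ∑ u ∈ UU R g, 1 / (u.totient : ℝ)) := by gcongr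
    _ = _ := by ring

lemma sum_PP (i : ℕ) : ∑ p ∈ PP (2 ^ i), 1 / (p : ℝ) ≤ 4 * harmonic i := by
  induction i with
  | zero =>
    have : PP (2 ^ 0) = ∅ := by
      ext p; simp only [PP, mem_filter, mem_range, notMem_empty, iff_false]
      rintro ⟨h1, h2⟩; have := h2.two_le; omega
    rw [this]; simp
  | succ i ih =>
    set N := {p ∈ Ico (2 ^ (i + 1)) (2 ^ (i + 2)) | p.Prime} with hN
    have hsub : PP (2 ^ (i + 1)) = PP (2 ^ i) ∪ N := by
      ext p
      have e1 : 2 * 2 ^ (i + 1) = 2 ^ (i + 2) := by ring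
      have e2 : 2 * 2 ^ i = 2 ^ (i + 1) := by ring
      have e3 : 2 ^ (i + 2) = 2 * 2 ^ (i + 1) := by ring
      simp only [PP, mem_filter, mem_range, mem_union, hN, mem_Ico, e1, e2]
      have := Nat.pos_of_ne_zero (by positivity : 2 ^ (i + 1) ≠ 0)
      constructor
      · rintro ⟨h1, h2⟩
        by_cases h : p < 2 ^ (i + 1)
        · left; exact ⟨h, h2⟩
        · right; exact ⟨⟨by omega, h1⟩, h2⟩
      · rintro (⟨h1, h2⟩ | ⟨⟨h1, h2⟩, h3⟩)
        · exact ⟨by omega, h2⟩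
        · exact ⟨h2, h3⟩
    have hN4 : ∑ p ∈ N, 1 / (p : ℝ) ≤ 4 * (1 / (i + 1 : ℝ)) := by
      have hlog2 : 0 < Real.log 2 := Real.log_pos (by norm_num)
      have h1 : (#N : ℝ) * ((i + 1) * Real.log 2) ≤ Real.log 4 * 2 ^ (i + 2) := by
        have h0 := Chebyshev.theta_le_log4_mul_x (x := 2 ^ (i + 2)) (by positivity)
        refine le_trans ?_ h0
        have hfl : ⌊(2 ^ (i + 2) : ℝ)⌋₊ = 2 ^ (i + 2) := by
          have : (2 ^ (i + 2) : ℝ) = ((2 ^ (i + 2) : ℕ) : ℝ) := by push_cast; rfl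
          rw [this, Nat.floor_natCast]
        rw [Chebyshev.theta, hfl, ← nsmul_eq_mul, ← sum_const]
        calc _ ≤ ∑ p ∈ N, Real.log p := by
              refine sum_le_sum fun p hp => ?_
              rw [hN, mem_filter, mem_Ico] at hp
              have : (i + 1 : ℝ) * Real.log 2 = Real.log (2 ^ (i + 1)) := by
                rw [Real.log_pow]; push_cast; rfl
              rw [this]
              exact Real.log_le_log (by positivity) (by exact_mod_cast hp.1.1)
          _ ≤ _ := by
              refine sum_le_sum_of_subset_of_nonneg (fun p hp => ?_) fun p _ _ => Real.log_natCast_nonneg p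
              rw [hN, mem_filter, mem_Ico] at hp
              rw [mem_filter, mem_Ioc]
              exact ⟨⟨hp.2.pos, hp.1.2.le⟩, hp.2⟩
      have hlog4 : Real.log 4 = 2 * Real.log 2 := by
        rw [show (4 : ℝ) = 2 ^ 2 by norm_num, Real.log_pow]; push_cast; rfl
      rw [hlog4] at h1
      have h2 : (#N : ℝ) * (i + 1) ≤ 4 * 2 ^ (i + 1) := by
        have h3 : (#N * (i + 1)) * Real.log 2 ≤ (4 * 2 ^ (i + 1)) * Real.log 2 := by
          calc _ = (#N : ℝ) * ((i + 1) * Real.log 2) := by ring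
            _ ≤ _ := h1
            _ = _ := by ring
        exact le_of_mul_le_mul_right h3 hlog2
      calc ∑ p ∈ N, 1 / (p : ℝ) ≤ ∑ p ∈ N, 1 / (2 ^ (i + 1) : ℝ) := by
            refine sum_le_sum fun p hp => ?_
            rw [hN, mem_filter, mem_Ico] at hp
            exact one_div_le_one_div_of_le (by positivity) (by exact_mod_cast hp.1.1)
        _ = #N / 2 ^ (i + 1) := by rw [sum_const, nsmul_eq_mul]; ring
        _ ≤ _ := by
            rw [mul_one_div, div_le_div_iff₀ (by positivity) (by positivity)]
            linarith
    rw [hsub]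
    have hd : Disjoint (PP (2 ^ i)) N := by
      rw [disjoint_left]
      intro p h1 h2
      rw [PP, mem_filter, mem_range] at h1
      rw [hN, mem_filter, mem_Ico, pow_succ] at h2
      omega
    rw [sum_union hd, harmonic_succ]
    push_cast
    rw [one_div] at hN4
    linarith

theorem log_le_UU' (i g : ℕ) : Real.log g ≤
    2 * Real.exp 4 * (i + 1) ^ 4 * ∑ u ∈ UU (2 ^ i) g, 1 / (u.totient : ℝ) := by
  refine (log_le_UU (2 ^ i) g).trans ?_
  have h7 : 0 ≤ ∑ u ∈ UU (2 ^ i) g, 1 / (u.totient : ℝ) := sum_nonneg fun _ _ => by positivity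
  rw [mul_assoc 2 (Real.exp 4)]
  gcongr
  calc ∏ p ∈ PP (2 ^ i), (1 + 1 / (p : ℝ)) ≤ ∏ p ∈ PP (2 ^ i), Real.exp (1 / (p : ℝ)) := by
        refine prod_le_prod (fun _ _ => by positivity) fun p _ => ?_
        rw [add_comm]; exact Real.add_one_le_exp _
    _ = Real.exp (∑ p ∈ PP (2 ^ i), 1 / (p : ℝ)) := by rw [Real.exp_sum]
    _ ≤ Real.exp (4 + 4 * Real.log (i + 1)) := by
        gcongr
        refine (sum_PP i).trans ?_
        rcases Nat.eq_zero_or_pos i with rfl | hi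
        · simp
        have h1 := harmonic_le_one_add_log i
        have h2 : Real.log i ≤ Real.log (i + 1) :=
          Real.log_le_log (by exact_mod_cast hi) (by linarith)
        linarith
    _ = _ := by
        rw [Real.exp_add, mul_comm 4 (Real.log _), Real.exp_mul, Real.exp_log (by positivity)]
        norm_cast

end

section
open Finset

lemma abel_var (f c : ℕ → ℂ) (B : ℝ) (hB : ∀ n, ‖∑ i ∈ range n, c i‖ ≤ B) (n : ℕ) :
    ‖∑ i ∈ range n, f i * c i‖ ≤ B * (‖f (n - 1)‖ + ∑ i ∈ range (n - 1), ‖f (i + 1) - f i‖) := by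
  have h := sum_range_by_parts f c n
  simp only [smul_eq_mul] at h
  rw [h]
  refine (norm_sub_le _ _).trans ?_
  rw [mul_add, norm_mul, mul_sum (s := range (n - 1)) (a := B)]
  gcongr ?_ + ?_
  · rw [mul_comm]; gcongr; exact hB _
  · refine (norm_sum_le _ _).trans (sum_le_sum fun i _ => ?_)
    rw [norm_mul, mul_comm]; gcongr; exact hB _

lemma abel_anti (f : ℕ → ℝ) (c : ℕ → ℂ) (hf : Antitone f) (hf0 : ∀ n, 0 ≤ f n)
    (B : ℝ) (hB : ∀ n, ‖∑ i ∈ range n, c i‖ ≤ B) (n : ℕ) :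
    ‖∑ i ∈ range n, (f i : ℂ) * c i‖ ≤ B * f 0 := by
  have hB0 : 0 ≤ B := (norm_nonneg _).trans (hB 0)
  refine (abel_var (fun i => (f i : ℂ)) c B hB n).trans ?_
  gcongr
  have : ∀ i ∈ range (n - 1), ‖(f (i + 1) : ℂ) - f i‖ = f i - f (i + 1) := by
    intro i _
    rw [← Complex.ofReal_sub, Complex.norm_real, Real.norm_eq_abs, abs_sub_comm, abs_of_nonneg]
    exact sub_nonneg.2 (hf (Nat.le_succ i))
  rw [sum_congr rfl this, sum_range_sub', Complex.norm_real, Real.norm_eq_abs, abs_of_nonneg (hf0 _)]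
  linarith

lemma per_sum (c : ℕ → ℂ) (q : ℕ) (hc : ∀ n, c (n + q) = c n) (m : ℕ) :
    ∑ k ∈ range q, c (m + k) = ∑ k ∈ range q, c k := by
  induction m with
  | zero => simp
  | succ m ih =>
    rw [← ih]
    have h1 := sum_range_succ (fun k => c (m + k)) q
    have h2 := sum_range_succ' (fun k => c (m + k)) q
    simp only [hc, add_zero] at h1 h2
    rw [h1] at h2
    have h3 := add_right_cancel h2
    rw [h3]
    exact sum_congr rfl fun k _ => by congr 1; ring

lemma per_bd (c : ℕ → ℂ) (q : ℕ) (hq : 0 < q) (hc : ∀ n, c (n + q) = c n) (h1 : ∀ n, ‖c n‖ ≤ 1)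
    (h0 : ∑ k ∈ range q, c k = 0) (n m : ℕ) : ‖∑ k ∈ range n, c (m + k)‖ ≤ q := by
  induction n using Nat.strong_induction_on generalizing m with
  | _ n ih =>
    by_cases h : n < q
    · refine (norm_sum_le _ _).trans ((sum_le_sum fun i _ => h1 _).trans ?_)
      simp; exact_mod_cast h.le
    · obtain ⟨r, rfl⟩ := Nat.exists_eq_add_of_le (not_lt.1 h)
      rw [sum_range_add, per_sum c q hc, h0, zero_add]
      have := ih r (by omega) (m + q)
      simpa only [add_assoc] using this

section
variable {q : ℕ} [NeZero q] (χ : DirichletCharacter ℂ q)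

lemma chi_bd (hχ : χ ≠ 1) (n m : ℕ) : ‖∑ k ∈ range n, χ ((m + k : ℕ) : ZMod q)‖ ≤ q := by
  refine per_bd (fun k => χ (k : ZMod q)) q (Nat.pos_of_ne_zero (NeZero.ne q)) (fun n => by simp)
    (fun n => χ.norm_le_one _) ?_ n m
  rw [← MulChar.sum_eq_zero_of_ne_one hχ]
  refine sum_nbij' (fun k => (k : ZMod q)) (fun a => a.val) (by simp) ?_ ?_ ?_ ?_
  · intro a _; simpa using ZMod.val_lt a
  · intro a ha; rw [mem_range] at ha; exact ZMod.val_cast_of_lt ha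
  · intro a _; simp
  · simp

noncomputable def TT (x : ℕ) : ℂ := ∑ k ∈ Ioc 0 x, χ (k : ZMod q) / k

lemma TT_sub (hχ : χ ≠ 1) (m n : ℕ) : ‖TT χ (m + n) - TT χ m‖ ≤ q / (m + 1 : ℝ) := by
  have h1 : TT χ (m + n) - TT χ m = ∑ i ∈ range n, (((1 / ((m + 1 : ℕ) + i : ℝ) : ℝ)) : ℂ) * χ (((m + 1) + i : ℕ) : ZMod q) := by
    have e := fun n => (sum_Ioc_consecutive (fun k : ℕ => χ (k : ZMod q) / (k : ℂ)) (Nat.zero_le m) (Nat.le_add_right m n))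
    rw [TT, TT, ← e n, add_sub_cancel_left, ← Ico_add_one_add_one_eq_Ioc, sum_Ico_eq_sum_range]
    have : m + n + 1 - (m + 1) = n := by omega
    rw [this]
    refine sum_congr rfl fun k _ => ?_
    push_cast; ring
  rw [h1]
  refine (abel_anti (fun i => 1 / ((m + 1 : ℕ) + i : ℝ)) _ ?_ (fun n => by positivity) q (fun n => chi_bd χ hχ n (m + 1)) n).trans ?_
  · intro i j hij
    have : (i : ℝ) ≤ j := by exact_mod_cast hij
    dsimp only
    gcongr
  · push_cast; simp; rw [div_eq_mul_inv]

lemma TT_lim (hχ : χ ≠ 1) : ∃ l : ℂ, ∀ m, ‖TT χ m - l‖ ≤ q / (m + 1 : ℝ) := by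
  have hc : CauchySeq (TT χ) := by
    refine cauchySeq_of_le_tendsto_0 (fun N : ℕ => 2 * (q * (1 / ((N : ℝ) + 1)))) ?_ ?_
    · intro n m N hn hm
      have key : ∀ n, N ≤ n → ‖TT χ n - TT χ N‖ ≤ q * (1 / ((N : ℝ) + 1)) := by
        intro n hn
        obtain ⟨r, rfl⟩ := Nat.exists_eq_add_of_le hn
        rw [mul_one_div]; exact TT_sub χ hχ N r
      calc _ ≤ dist (TT χ n) (TT χ N) + dist (TT χ m) (TT χ N) := dist_triangle_right _ _ _
        _ ≤ _ := by rw [dist_eq_norm, dist_eq_norm, two_mul]; exact add_le_add (key n hn) (key m hm)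
    · have := (tendsto_one_div_add_atTop_nhds_zero_nat (𝕜 := ℝ)).const_mul (q : ℝ)
      simpa using this.const_mul 2
  obtain ⟨l, hl⟩ := cauchySeq_tendsto_of_complete hc
  refine ⟨l, fun m => ?_⟩
  have h1 : Filter.Tendsto (fun n => ‖TT χ m - TT χ n‖) Filter.atTop (nhds ‖TT χ m - l‖) :=
    (tendsto_const_nhds.sub hl).norm
  refine le_of_tendsto h1 ?_
  filter_upwards [Filter.eventually_ge_atTop m] with n hn
  obtain ⟨r, rfl⟩ := Nat.exists_eq_add_of_le hn
  rw [norm_sub_rev]; exact TT_sub χ hχ m r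

lemma log_chi_bd (hχ : χ ≠ 1) : ∃ C : ℝ, ∀ x : ℕ, ‖∑ n ∈ Ioc 0 x, χ (n : ZMod q) * (Real.log n : ℂ) / n‖ ≤ C := by
  refine ⟨3 + q * 3, fun x => ?_⟩
  have hlt : ∀ n : ℕ, ‖χ (n : ZMod q) * (Real.log n : ℂ) / n‖ ≤ 1 := by
    intro n
    rw [norm_div, norm_mul]
    rcases Nat.eq_zero_or_pos n with rfl | hn
    · simp
    have hn' : (0 : ℝ) < n := by exact_mod_cast hn
    rw [Complex.norm_natCast, div_le_one hn', Complex.norm_real, Real.norm_eq_abs, abs_of_nonneg (Real.log_natCast_nonneg n)]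
    calc _ ≤ 1 * (n : ℝ) := by
          gcongr
          · exact χ.norm_le_one _
          · have := Real.log_le_sub_one_of_pos hn'; linarith
      _ = _ := one_mul _
  by_cases hx : x < 3
  · refine (norm_sum_le _ _).trans ((sum_le_sum fun i _ => hlt i).trans ?_)
    simp
    have : (x : ℝ) ≤ 3 := by exact_mod_cast hx.le
    nlinarith [Nat.cast_nonneg (α := ℝ) q]
  obtain ⟨r, rfl⟩ := Nat.exists_eq_add_of_le (not_lt.1 hx)
  rw [← sum_Ioc_consecutive _ (Nat.zero_le 3) (Nat.le_add_right 3 r)]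
  refine (norm_add_le _ _).trans (add_le_add ?_ ?_)
  · refine (norm_sum_le _ _).trans ((sum_le_sum fun i _ => hlt i).trans ?_)
    simp
  have h1 : ∑ n ∈ Ioc 3 (3 + r), χ (n : ZMod q) * (Real.log n : ℂ) / n =
    ∑ i ∈ range r, (((Real.log (4 + i) / (4 + i)  : ℝ)) : ℂ) * χ ((4 + i : ℕ) : ZMod q) := by
    rw [← Ico_add_one_add_one_eq_Ioc, sum_Ico_eq_sum_range]
    have : 3 + r + 1 - (3 + 1) = r := by omega
    rw [this]
    refine sum_congr rfl fun k _ => ?_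
    push_cast
    norm_num
    ring
  rw [h1]
  refine (abel_anti (fun i => Real.log (4 + i) / (4 + i)) _ ?_ ?_ q (fun n => chi_bd χ hχ n 4) r).trans ?_
  · intro i j hij
    have hij' : (i : ℝ) ≤ j := by exact_mod_cast hij
    have he := Real.exp_one_lt_d9
    have := Nat.cast_nonneg (α := ℝ) i
    exact Real.log_div_self_antitoneOn (by simp; linarith) (by simp; linarith) (by linarith)
  · intro n
    have := Real.log_natCast_nonneg (4 + n)
    push_cast at this
    positivity
  · gcongr
    simp
    have := Real.log_le_sub_one_of_pos (show (0 : ℝ) < 4 by norm_num)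
    linarith
end

end

section
open Finset

lemma TT_ne {q : ℕ} [NeZero q] (χ : DirichletCharacter ℂ q) (hχ : χ ≠ 1) (l : ℂ)
    (hl : ∀ m, ‖TT χ m - l‖ ≤ q / (m + 1 : ℝ)) : l ≠ 0 := by
  have key : ∀ ε : ℝ, 0 < ε → ‖DirichletCharacter.LFunction χ (1 + ε) - l‖ ≤ ε * q := by
    intro ε hε
    have hre : 1 < ((1 : ℂ) + ε).re := by simp [hε]
    set f : ℕ → ℂ := fun n => χ (n : ZMod q) / n with hf
    have h1 : DirichletCharacter.LFunction χ (1 + ε) = LSeries f ε := by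
      rw [DirichletCharacter.LFunction_eq_LSeries χ hre]
      refine tsum_congr fun n => ?_
      rcases Nat.eq_zero_or_pos n with rfl | hn
      · simp
      have hn' : (n : ℂ) ≠ 0 := by exact_mod_cast hn.ne'
      rw [LSeries.term_of_ne_zero hn.ne', LSeries.term_of_ne_zero hn.ne', Complex.cpow_add _ _ hn',
        Complex.cpow_one, hf, div_div]
    have hS : LSeriesSummable f ε := by
      have := ZMod.LSeriesSummable_of_one_lt_re χ hre
      refine this.congr fun n => ?_
      rcases Nat.eq_zero_or_pos n with rfl | hn
      · simp
      have hn' : (n : ℂ) ≠ 0 := by exact_mod_cast hn.ne'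
      rw [LSeries.term_of_ne_zero hn.ne', LSeries.term_of_ne_zero hn.ne', Complex.cpow_add _ _ hn',
        Complex.cpow_one, hf, div_div]
    have hT : ∀ n, ∑ k ∈ Icc 1 n, f k = TT χ n := fun n => by
      rw [TT, ← Icc_add_one_left_eq_Ioc]; simp [hf]
    have hO : (fun n ↦ ∑ k ∈ Icc 1 n, f k) =O[Filter.atTop] fun n ↦ (n : ℝ) ^ (0 : ℝ) := by
      simp_rw [hT, Real.rpow_zero]
      refine Asymptotics.IsBigO.of_bound (‖l‖ + q) (Filter.Eventually.of_forall fun n => ?_)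
      have h1 := hl n
      have h2 : (q : ℝ) / (n + 1 : ℝ) ≤ q := div_le_self (by positivity) (by linarith [Nat.cast_nonneg (α := ℝ) n])
      have h3 := norm_add_le (TT χ n - l) l
      rw [sub_add_cancel] at h3
      simp; linarith
    have h2 := LSeries_eq_mul_integral f (s := ε) le_rfl (by simpa using hε) hS hO
    rw [h1, h2]
    simp_rw [hT]
    have hlt : (-((ε : ℂ) + 1)).re < -1 := by simp [hε]
    have hi := integrableOn_Ioi_cpow_of_lt hlt (zero_lt_one' ℝ)
    have hi2 : ((ε : ℂ) * ∫ t in Set.Ioi (1 : ℝ), l * (t : ℂ) ^ (-((ε : ℂ) + 1))) = l := by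
      have hε' : (ε : ℂ) ≠ 0 := by exact_mod_cast hε.ne'
      rw [MeasureTheory.integral_const_mul, integral_Ioi_cpow_of_lt hlt zero_lt_one]
      simp
      field_simp
    have hbd : ∀ t ∈ Set.Ioi (1 : ℝ), ‖TT χ ⌊t⌋₊ - l‖ ≤ q * t ^ (-1 : ℝ) := by
      intro t ht
      have ht0 : (0 : ℝ) < t := lt_trans zero_lt_one ht
      refine (hl _).trans ?_
      rw [Real.rpow_neg_one, ← div_eq_mul_inv]
      gcongr
      exact (Nat.lt_floor_add_one t).le
    have hm : Measurable fun t : ℝ => TT χ ⌊t⌋₊ := (measurable_from_top (f := TT χ)).comp Nat.measurable_floor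
    have hi3 : MeasureTheory.IntegrableOn (fun t : ℝ => TT χ ⌊t⌋₊ * (t : ℂ) ^ (-((ε : ℂ) + 1))) (Set.Ioi 1) := by
      refine MeasureTheory.Integrable.bdd_mul (c := ‖l‖ + q) hi hm.aestronglyMeasurable ?_
      refine Filter.Eventually.of_forall fun t => ?_
      have h1 := hl ⌊t⌋₊
      have h2 : (q : ℝ) / (⌊t⌋₊ + 1 : ℝ) ≤ q := div_le_self (by positivity) (by linarith [Nat.cast_nonneg (α := ℝ) ⌊t⌋₊])
      have h3 := norm_add_le (TT χ ⌊t⌋₊ - l) l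
      rw [sub_add_cancel] at h3
      linarith
    conv_lhs => rw [← hi2]
    rw [← mul_sub, ← MeasureTheory.integral_sub hi3 (hi.const_mul l), norm_mul, Complex.norm_real,
      Real.norm_eq_abs, abs_of_pos hε]
    gcongr
    have h2lt : (-2 : ℝ) < -1 := by norm_num
    calc _ ≤ ∫ t in Set.Ioi (1 : ℝ), q * t ^ (-2 : ℝ) := by
          refine MeasureTheory.norm_integral_le_of_norm_le ((integrableOn_Ioi_rpow_of_lt h2lt zero_lt_one).const_mul _) ?_
          refine (MeasureTheory.ae_restrict_iff' measurableSet_Ioi).2 (Filter.Eventually.of_forall fun t ht => ?_)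
          have ht0 : (0 : ℝ) < t := lt_trans zero_lt_one ht
          rw [← sub_mul, norm_mul, Complex.norm_cpow_eq_rpow_re_of_pos ht0]
          have : t ^ (-2 : ℝ) = t ^ (-1 : ℝ) * t ^ (-1 : ℝ) := by
            rw [← Real.rpow_add ht0]; norm_num
          rw [this, ← mul_assoc]
          have h5 := hbd t ht
          gcongr
          · exact le_of_lt ht
      _ = _ := by
          rw [MeasureTheory.integral_const_mul, integral_Ioi_rpow_of_lt h2lt zero_lt_one]
          norm_num
  intro hl0
  have hcont : Filter.Tendsto (fun ε : ℝ => DirichletCharacter.LFunction χ (1 + ε)) (nhdsWithin 0 (Set.Ioi 0))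
      (nhds (DirichletCharacter.LFunction χ 1)) := by
    have h := (DirichletCharacter.differentiable_LFunction hχ).continuous
    have h2 : Continuous (fun ε : ℝ => DirichletCharacter.LFunction χ (1 + ε)) := by fun_prop
    have := h2.tendsto 0
    simp only [Complex.ofReal_zero, add_zero] at this
    exact this.mono_left nhdsWithin_le_nhds
  have hle : ‖DirichletCharacter.LFunction χ 1‖ ≤ 0 := by
    have hr : Filter.Tendsto (fun ε : ℝ => ε * q) (nhdsWithin 0 (Set.Ioi 0)) (nhds 0) := by
      have : Continuous (fun ε : ℝ => ε * q) := by fun_prop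
      have := this.tendsto 0
      rw [zero_mul] at this
      exact this.mono_left nhdsWithin_le_nhds
    refine le_of_tendsto_of_tendsto hcont.norm hr ?_
    filter_upwards [self_mem_nhdsWithin] with ε hε
    have := key ε hε
    rwa [hl0, sub_zero] at this
  exact DirichletCharacter.LFunction_apply_one_ne_zero hχ (norm_le_zero_iff.1 hle)

end

section
open Finset

section
variable {q : ℕ} [NeZero q] (χ : DirichletCharacter ℂ q)
open ArithmeticFunction

lemma chi_conv (N : ℕ) : ∑ n ∈ Ioc 0 N, χ (n : ZMod q) * (Real.log n : ℂ) / n =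
    ∑ d ∈ Ioc 0 N, (χ (d : ZMod q) * (vonMangoldt d : ℂ) / d) * TT χ (N / d) := by
  obtain ⟨F, hF⟩ : ∃ F : ArithmeticFunction ℂ, ∀ n, F n = χ (n : ZMod q) * (vonMangoldt n : ℂ) / n :=
    ⟨⟨fun n => χ (n : ZMod q) * (vonMangoldt n : ℂ) / n, by simp⟩, fun _ => rfl⟩
  obtain ⟨G, hG⟩ : ∃ G : ArithmeticFunction ℂ, ∀ n, G n = χ (n : ZMod q) / n :=
    ⟨⟨fun n => χ (n : ZMod q) / n, by simp⟩, fun _ => rfl⟩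
  have h := sum_Ioc_mul_eq_sum_sum F G N
  simp only [hF, hG] at h
  unfold TT
  rw [← h]
  refine sum_congr rfl fun n hn => ?_
  rw [mul_apply]
  simp only [hF, hG]
  rw [← vonMangoldt_sum, ← Nat.sum_divisorsAntidiagonal (fun i _ => (vonMangoldt i : ℝ))]
  push_cast
  rw [mul_sum, sum_div]
  refine sum_congr rfl fun x hx => ?_
  rw [Nat.mem_divisorsAntidiagonal] at hx
  rw [← hx.1]
  push_cast
  rw [map_mul]
  ring

lemma psi_Ioc (N : ℕ) : ∑ d ∈ Ioc 0 N, vonMangoldt d ≤ 6 * N := by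
  have h := Chebyshev.psi_le_const_mul_self (x := N) (by positivity)
  rw [Chebyshev.psi, Nat.floor_natCast] at h
  have h4 : Real.log 4 ≤ 2 := by
    have : Real.log 4 = 2 * Real.log 2 := by
      rw [show (4 : ℝ) = 2 ^ 2 by norm_num, Real.log_pow]; push_cast; rfl
    have := Real.log_two_lt_d9
    linarith
  refine h.trans ?_
  gcongr
  linarith

lemma mertens_chi (hχ : χ ≠ 1) : ∃ C : ℝ, ∀ N : ℕ,
    ‖∑ d ∈ Ioc 0 N, χ (d : ZMod q) * (vonMangoldt d : ℂ) / d‖ ≤ C := by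
  obtain ⟨l, hl⟩ := TT_lim χ hχ
  have hl0 := TT_ne χ hχ l hl
  obtain ⟨C, hC⟩ := log_chi_bd χ hχ
  refine ⟨(C + q * 6) / ‖l‖, fun N => ?_⟩
  rw [le_div_iff₀ (norm_pos_iff.2 hl0), ← norm_mul, sum_mul]
  have h1 : ∑ d ∈ Ioc 0 N, χ (d : ZMod q) * (vonMangoldt d : ℂ) / d * l =
    ∑ n ∈ Ioc 0 N, χ (n : ZMod q) * (Real.log n : ℂ) / n -
    ∑ d ∈ Ioc 0 N, (χ (d : ZMod q) * (vonMangoldt d : ℂ) / d) * (TT χ (N / d) - l) := by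
    rw [chi_conv, ← sum_sub_distrib]
    exact sum_congr rfl fun d _ => by ring
  rw [h1]
  refine (norm_sub_le _ _).trans (add_le_add (hC N) ?_)
  rcases Nat.eq_zero_or_pos N with rfl | hN
  · simp
  have hN' : (0 : ℝ) < N := by exact_mod_cast hN
  calc _ ≤ ∑ d ∈ Ioc 0 N, (q : ℝ) / N * vonMangoldt d := by
        refine (norm_sum_le _ _).trans (sum_le_sum fun d hd => ?_)
        rw [mem_Ioc] at hd
        have hd' : (0 : ℝ) < d := by exact_mod_cast hd.1
        rw [norm_mul, norm_div, norm_mul, Complex.norm_natCast, Complex.norm_real, Real.norm_eq_abs,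
          abs_of_nonneg vonMangoldt_nonneg]
        have e1 : ‖TT χ (N / d) - l‖ ≤ q * d / N := by
          refine (hl _).trans ?_
          rw [div_le_div_iff₀ (by positivity) hN']
          have : N < d * (N / d + 1) := Nat.lt_mul_div_succ N hd.1
          have : (N : ℝ) ≤ d * ((N / d : ℕ) + 1) := by exact_mod_cast this.le
          nlinarith [Nat.cast_nonneg (α := ℝ) q]
        calc _ ≤ 1 * vonMangoldt d / d * (q * d / N) := by
              gcongr
              · exact χ.norm_le_one _
          _ = _ := by field_simp
    _ ≤ (q : ℝ) / N * (6 * N) := by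
        rw [← mul_sum]; gcongr; exact psi_Ioc N
    _ = _ := by field_simp

lemma mertens_zero : ∃ C : ℝ, ∀ N : ℕ, 1 ≤ N →
    |∑ d ∈ Ioc 0 N, vonMangoldt d / d - Real.log N| ≤ C := by
  refine ⟨6, fun N hN => ?_⟩
  have hN' : (0 : ℝ) < N := by exact_mod_cast hN
  have h := sum_Ioc_mul_zeta_eq_sum vonMangoldt N
  rw [vonMangoldt_mul_zeta] at h
  simp only [log_apply] at h
  have hup : ∑ n ∈ Ioc 0 N, Real.log n ≤ N * Real.log N := by
    calc _ ≤ ∑ n ∈ Ioc 0 N, Real.log N := by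
          refine sum_le_sum fun n hn => ?_
          rw [mem_Ioc] at hn
          exact Real.log_le_log (by exact_mod_cast hn.1) (by exact_mod_cast hn.2)
      _ = _ := by simp
  have hlo : ∀ N : ℕ, N * Real.log N - N ≤ ∑ n ∈ Ioc 0 N, Real.log n := by
    intro N
    induction N with
    | zero => simp
    | succ n ih =>
      rw [sum_Ioc_succ_top (Nat.zero_le n)]
      rcases Nat.eq_zero_or_pos n with rfl | hn
      · simp
      have hn' : (0 : ℝ) < n := by exact_mod_cast hn
      push_cast
      have : Real.log (n + 1) - Real.log n ≤ 1 / n := by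
        rw [← Real.log_div (by positivity) (by positivity)]
        refine (Real.log_le_sub_one_of_pos (by positivity)).trans_eq ?_
        field_simp; ring
      have h2 : n * (Real.log (n + 1) - Real.log n) ≤ 1 := by
        calc _ ≤ n * (1 / (n : ℝ)) := by gcongr
          _ = 1 := by field_simp
      nlinarith
  have hlo := hlo N
  have hA : ∑ n ∈ Ioc 0 N, vonMangoldt n * ((N / n : ℕ) : ℝ) ≤ N * ∑ d ∈ Ioc 0 N, vonMangoldt d / d := by
    rw [mul_sum]
    refine sum_le_sum fun n hn => ?_
    have := Nat.cast_div_le (α := ℝ) (m := N) (n := n)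
    calc _ ≤ vonMangoldt n * ((N : ℝ) / n) := by gcongr
      _ = _ := by ring
  have hB : N * ∑ d ∈ Ioc 0 N, vonMangoldt d / d ≤ ∑ n ∈ Ioc 0 N, vonMangoldt n * ((N / n : ℕ) : ℝ) + 6 * N := by
    refine le_trans ?_ (add_le_add_right (psi_Ioc N) _)
    rw [mul_sum, ← sum_add_distrib]
    refine sum_le_sum fun n hn => ?_
    rw [mem_Ioc] at hn
    have hn' : (0 : ℝ) < n := by exact_mod_cast hn.1
    have h5 : (N : ℝ) / n ≤ (N / n : ℕ) + 1 := by
      rw [div_le_iff₀ hn', mul_comm]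
      exact_mod_cast (Nat.lt_mul_div_succ N hn.1).le
    calc _ = vonMangoldt n * ((N : ℝ) / n) := by ring
      _ ≤ vonMangoldt n * ((N / n : ℕ) + 1) := by gcongr
      _ = _ := by ring
  rw [abs_le]
  constructor
  · have : N * Real.log N - N ≤ N * ∑ d ∈ Ioc 0 N, vonMangoldt d / d := by
      refine hlo.trans (le_trans (le_of_eq ?_) hA)
      rw [h]
    nlinarith
  · have : N * ∑ d ∈ Ioc 0 N, vonMangoldt d / d ≤ N * Real.log N + 6 * N := by
      refine hB.trans (le_trans (le_of_eq ?_) (add_le_add_left hup _))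
      rw [h]
    nlinarith
end

end

section
open Finset

open ArithmeticFunction ArithmeticFunction.vonMangoldt

lemma nonprime_bd : ∃ C : ℝ, ∀ N : ℕ, ∑ n ∈ Ioc 0 N, (if n.Prime then 0 else (vonMangoldt n : ℝ)) / n ≤ C := by
  have h := summable_residueClass_non_primes_div (q := 1) 0
  refine ⟨_, fun N => le_trans (le_of_eq ?_) (h.sum_le_tsum (Ioc 0 N) ?_)⟩
  · refine sum_congr rfl fun n _ => ?_
    have : residueClass (0 : ZMod 1) n = vonMangoldt n := by
      rw [residueClass, Set.indicator_of_mem]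
      exact Subsingleton.elim _ _
    rw [this]
  · intro n _
    have := residueClass_nonneg (0 : ZMod 1) n
    split_ifs <;> positivity

lemma trivial_bd (q : ℕ) [NeZero q] : ∃ C : ℝ, ∀ N : ℕ, 1 ≤ N →
    ‖∑ d ∈ Ioc 0 N, (1 : DirichletCharacter ℂ q) (d : ZMod q) * (vonMangoldt d : ℂ) / d - Real.log N‖ ≤ C := by
  classical
  obtain ⟨C1, h1⟩ := mertens_zero
  obtain ⟨C2, h2⟩ := nonprime_bd
  refine ⟨C1 + (q + C2), fun N hN => ?_⟩
  set g : ℕ → ℝ := fun d => if IsUnit (d : ZMod q) then 0 else vonMangoldt d / d with hg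
  have e : ∑ d ∈ Ioc 0 N, (1 : DirichletCharacter ℂ q) (d : ZMod q) * (vonMangoldt d : ℂ) / d - Real.log N
     = (((∑ d ∈ Ioc 0 N, vonMangoldt d / d - Real.log N) - ∑ d ∈ Ioc 0 N, g d : ℝ) : ℂ) := by
    push_cast
    have : ∀ d ∈ Ioc 0 N, (1 : DirichletCharacter ℂ q) (d : ZMod q) * (vonMangoldt d : ℂ) / d =
      (vonMangoldt d : ℂ) / d - (g d : ℂ) := by
      intro d _
      simp only [hg]
      split_ifs with h
      · rw [MulChar.one_apply h]; simp
      · rw [MulChar.map_nonunit _ h]; simp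
    rw [sum_congr rfl this, sum_sub_distrib]
    ring
  rw [e, Complex.norm_real]
  refine (norm_sub_le _ _).trans (add_le_add (h1 N hN) ?_)
  have hg0 : ∀ d, 0 ≤ g d := fun d => by
    simp only [hg]; split_ifs
    · rfl
    · exact div_nonneg vonMangoldt_nonneg (by positivity)
  rw [Real.norm_eq_abs, abs_of_nonneg (sum_nonneg fun d _ => hg0 d)]
  have : ∀ d ∈ Ioc 0 N, g d ≤ (if d ∈ Ioc 0 q then 1 else 0) + (if d.Prime then 0 else (vonMangoldt d : ℝ)) / d := by
    intro d hd
    rw [mem_Ioc] at hd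
    have hd' : (0 : ℝ) < d := by exact_mod_cast hd.1
    simp only [hg]
    have hΛ := vonMangoldt_nonneg (n := d)
    by_cases hu : IsUnit (d : ZMod q)
    · rw [if_pos hu]
      have : 0 ≤ (if d.Prime then 0 else (vonMangoldt d : ℝ)) / d := by split_ifs <;> positivity
      split_ifs at this ⊢ <;> linarith
    rw [if_neg hu]
    by_cases hp : d.Prime
    · have hdq : d ∣ q := by
        by_contra hc
        exact hu ((ZMod.isUnit_iff_coprime d q).2 ((Nat.Prime.coprime_iff_not_dvd hp).2 hc))
      have : d ∈ Ioc 0 q := mem_Ioc.2 ⟨hd.1, Nat.le_of_dvd (Nat.pos_of_ne_zero (NeZero.ne q)) hdq⟩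
      rw [if_pos this, if_pos hp, vonMangoldt_apply_prime hp, zero_div, add_zero, div_le_one hd']
      have := Real.log_le_sub_one_of_pos hd'
      linarith
    · rw [if_neg hp]
      split_ifs <;> linarith
  refine (sum_le_sum this).trans ?_
  rw [sum_add_distrib]
  refine add_le_add ?_ (h2 N)
  rw [sum_ite_mem, sum_const, nsmul_eq_mul, mul_one]
  have : #(Ioc 0 N ∩ Ioc 0 q) ≤ q := (card_le_card inter_subset_right).trans (by simp)
  exact_mod_cast this

lemma mertens_class (q : ℕ) [NeZero q] (a : ZMod q) (ha : IsUnit a) : ∃ C : ℝ, ∀ N : ℕ, 1 ≤ N →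
    |∑ d ∈ Ioc 0 N, residueClass a d / d - Real.log N / q.totient| ≤ C := by
  classical
  obtain ⟨C1, h1⟩ := trivial_bd q
  have hχ : ∀ χ : DirichletCharacter ℂ q, ∃ C : ℝ, 0 ≤ C ∧ ∀ N : ℕ, 1 ≤ N →
    ‖∑ d ∈ Ioc 0 N, χ (d : ZMod q) * (vonMangoldt d : ℂ) / d - (if χ = 1 then (Real.log N : ℂ) else 0)‖ ≤ C := by
    intro χ
    by_cases h : χ = 1
    · subst h
      simp only [if_true]
      exact ⟨C1, (norm_nonneg _).trans (h1 1 le_rfl), h1⟩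
    · obtain ⟨C, hC⟩ := mertens_chi χ h
      simp only [if_neg h, sub_zero]
      exact ⟨C, (norm_nonneg _).trans (hC 1), fun N _ => hC N⟩
  choose C hC0 hC using hχ
  refine ⟨‖(q.totient : ℂ)⁻¹‖ * ∑ χ, C χ, fun N hN => ?_⟩
  have e : ((∑ d ∈ Ioc 0 N, residueClass a d / d - Real.log N / q.totient : ℝ) : ℂ) =
    (q.totient : ℂ)⁻¹ * ∑ χ : DirichletCharacter ℂ q, χ a⁻¹ *
     (∑ d ∈ Ioc 0 N, χ (d : ZMod q) * (vonMangoldt d : ℂ) / d - (if χ = 1 then (Real.log N : ℂ) else 0)) := by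
    have e2 : ∑ χ : DirichletCharacter ℂ q, χ a⁻¹ * (if χ = 1 then (Real.log N : ℂ) else 0) = Real.log N := by
      simp only [mul_ite, mul_zero]
      rw [sum_ite_eq' univ, if_pos (mem_univ _), MulChar.one_apply, one_mul]
      obtain ⟨u, rfl⟩ := ha
      rw [ZMod.inv_coe_unit]
      exact Units.isUnit _
    simp only [mul_sub, sum_sub_distrib, e2]
    push_cast
    rw [inv_mul_eq_div (q.totient : ℂ) (Complex.log N)]
    congr 1
    have e3 : ∀ x ∈ Ioc 0 N, ((residueClass a x : ℝ) : ℂ) / x =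
        ∑ χ : DirichletCharacter ℂ q, (q.totient : ℂ)⁻¹ * (χ a⁻¹ * (χ (x : ZMod q) * (vonMangoldt x : ℂ) / x)) := by
      intro x _
      rw [residueClass_apply ha, ← mul_sum, mul_div_assoc, sum_div]
      congr 1
      exact sum_congr rfl fun χ _ => by ring
    rw [sum_congr rfl e3, sum_comm, mul_sum]
    exact sum_congr rfl fun χ _ => by rw [mul_sum, mul_sum]
  rw [← Real.norm_eq_abs, ← Complex.norm_real, e, norm_mul]
  gcongr
  refine (norm_sum_le _ _).trans (sum_le_sum fun χ _ => ?_)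
  rw [norm_mul]
  calc _ ≤ 1 * C χ := by
        gcongr
        · exact χ.norm_le_one _
        · exact hC χ N hN
    _ = _ := one_mul _

lemma mertens_primes (q : ℕ) [NeZero q] (a : ZMod q) (ha : IsUnit a) : ∃ C : ℝ, ∀ N : ℕ, 1 ≤ N →
    |∑ p ∈ (Ioc 0 N).filter (fun p : ℕ => p.Prime ∧ (p : ZMod q) = a), Real.log (p : ℝ) / (p : ℝ) - Real.log N / q.totient| ≤ C := by
  classical
  obtain ⟨C1, h1⟩ := mertens_class q a ha
  obtain ⟨C2, h2⟩ := nonprime_bd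
  refine ⟨C1 + C2, fun N hN => ?_⟩
  have e : ∑ d ∈ Ioc 0 N, residueClass a d / d = ∑ p ∈ (Ioc 0 N).filter (fun p : ℕ => p.Prime ∧ (p : ZMod q) = a), Real.log (p : ℝ) / (p : ℝ)
     + ∑ d ∈ Ioc 0 N, (if d.Prime then 0 else residueClass a d) / d := by
    rw [sum_filter, ← sum_add_distrib]
    refine sum_congr rfl fun d _ => ?_
    by_cases hp : d.Prime
    · by_cases hd : (d : ZMod q) = a
      · rw [if_pos ⟨hp, hd⟩, if_pos hp, residueClass, Set.indicator_of_mem (by exact hd), vonMangoldt_apply_prime hp]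
        simp
      · rw [if_neg (by tauto), if_pos hp, residueClass, Set.indicator_of_notMem (by exact hd)]
        simp
    · rw [if_neg (by tauto), if_neg hp, zero_add]
  have h3 : ∑ d ∈ Ioc 0 N, (if d.Prime then 0 else residueClass a d) / d ≤ C2 := by
    refine le_trans (sum_le_sum fun d _ => ?_) (h2 N)
    gcongr
    split_ifs
    · rfl
    · exact residueClass_le a d
  have h4 : 0 ≤ ∑ d ∈ Ioc 0 N, (if d.Prime then 0 else residueClass a d) / d :=
    sum_nonneg fun d _ => by
      have := residueClass_nonneg a d
      split_ifs <;> positivity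
  have h5 := h1 N hN
  rw [e] at h5
  rw [abs_le] at h5 ⊢
  constructor <;> linarith

theorem prime_blocks (q a : ℕ) (hq : 1 ≤ q) (ha : a.Coprime q) : ∃ K h0 : ℕ, 1 ≤ K ∧ ∀ h, h0 ≤ h →
    ∃ i, 1 ≤ i ∧ i ≤ K ∧
      (h : ℝ) / (8 * Real.log h) ≤ #{n ∈ Ico (i * h) ((i + 1) * h) | (a + q * n).Prime} := by
  classical
  have : NeZero q := ⟨by omega⟩
  obtain ⟨C, hC⟩ := mertens_primes q (a : ZMod q) ((ZMod.isUnit_iff_coprime a q).2 ha)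
  obtain ⟨K, hK⟩ := exists_nat_ge (Real.exp (2 * (1 + 2 * C * q) + 4))
  have hC0 : 0 ≤ C := (abs_nonneg _).trans (hC 1 le_rfl)
  have hq' : (1 : ℝ) ≤ q := by exact_mod_cast hq
  have hlogK : 2 * (1 + 2 * C * q) + 4 ≤ Real.log K := by
    rw [Real.le_log_iff_exp_le]; exact hK
    exact lt_of_lt_of_le (Real.exp_pos _) hK
  have hKr : (0 : ℝ) < K := lt_of_lt_of_le (Real.exp_pos _) hK
  have hK1 : 1 ≤ K := by exact_mod_cast hKr
  refine ⟨K, a + (K + 2) * q + 2, hK1, fun h hh => ?_⟩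
  by_contra! hcon
  have hh2 : 2 ≤ h := by omega
  have hh1 : (1 : ℝ) < h := by exact_mod_cast hh2
  have hh0 : (0 : ℝ) < h := by linarith
  have hlogh : 0 < Real.log h := Real.log_pos hh1
  set cnt : ℕ → Finset ℕ := fun i => {n ∈ Ico (i * h) ((i + 1) * h) | (a + q * n).Prime} with hcnt
  set N1 := a + q * h - 1 with hN1
  set N2 := a + q * ((K + 1) * h) - 1 with hN2
  have hqh : 2 ≤ q * h := le_trans hh2 (Nat.le_mul_of_pos_left _ hq)
  have hqKh : q * h ≤ q * ((K + 1) * h) := Nat.mul_le_mul_left _ (Nat.le_mul_of_pos_left _ (by omega))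
  have hN12 : N1 ≤ N2 := by omega
  have hN1' : (N1 : ℝ) ≤ 2 * q * h := by
    have : N1 ≤ 2 * q * h := by
      have : a ≤ h := by nlinarith
      have : h ≤ q * h := Nat.le_mul_of_pos_left _ hq
      have : 2 * q * h = q * h + q * h := by ring
      omega
    exact_mod_cast this
  have hN2' : (K : ℝ) * (q * h) ≤ N2 := by
    have : K * (q * h) ≤ N2 := by
      have : q * ((K + 1) * h) = K * (q * h) + q * h := by ring
      omega
    exact_mod_cast this
  have hN2'' : (N2 : ℝ) ≤ h ^ 2 := by
    have : N2 ≤ h ^ 2 := by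
      have h1 : q * ((K + 1) * h) + h ≤ h * h := by
        calc _ ≤ ((K + 2) * q) * h := by nlinarith
          _ ≤ _ := Nat.mul_le_mul_right _ (by omega)
      have : a ≤ h := by nlinarith
      rw [pow_two]; omega
    exact_mod_cast this
  have hN1p : (0 : ℝ) < N1 := by
    have : 0 < N1 := by omega
    exact_mod_cast this
  have hN2p : (0 : ℝ) < N2 := lt_of_lt_of_le hN1p (by exact_mod_cast hN12)
  -- lower bound
  have hA := (abs_le.1 (hC N1 (by omega))).2
  have hB := (abs_le.1 (hC N2 (by omega))).1
  set P : ℕ → Finset ℕ := fun N => (Ioc 0 N).filter (fun p : ℕ => p.Prime ∧ (p : ZMod q) = (a : ZMod q)) with hP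
  have hPsub : P N1 ⊆ P N2 := by
    intro p; simp only [hP, mem_filter, mem_Ioc]; rintro ⟨⟨h1, h2⟩, h3⟩
    exact ⟨⟨h1, h2.trans hN12⟩, h3⟩
  have hsd := sum_sdiff hPsub (f := fun p : ℕ => Real.log p / p)
  have hlogs : Real.log K - 1 ≤ Real.log N2 - Real.log N1 := by
    have h1 : Real.log (K * (q * h)) ≤ Real.log N2 := Real.log_le_log (by positivity) hN2'
    have h2 : Real.log N1 ≤ Real.log (2 * (q * h)) := Real.log_le_log hN1p (by linarith)
    rw [Real.log_mul (by positivity) (by positivity)] at h1 h2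
    have := Real.log_two_lt_d9
    linarith
  have htot : (0 : ℝ) < q.totient := by exact_mod_cast Nat.totient_pos.2 hq
  have htot2 : (q.totient : ℝ) ≤ q := by exact_mod_cast Nat.totient_le q
  have hlow : (Real.log K - 1) / q - 2 * C ≤ ∑ p ∈ P N2 \ P N1, Real.log p / p := by
    have h1 : (Real.log K - 1) / q ≤ (Real.log N2 - Real.log N1) / q.totient := by
      have : 0 ≤ Real.log K - 1 := by nlinarith
      exact div_le_div₀ (by linarith) hlogs htot htot2
    rw [sub_div (Real.log N2)] at h1
    linarith
  -- upper bound
  have hup : ∑ p ∈ P N2 \ P N1, Real.log p / p ≤ ∑ i ∈ Icc 1 K, ∑ n ∈ cnt i, (2 * Real.log h) / (q * i * h) := by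
    have hmap : ∀ p ∈ P N2 \ P N1, ∃ i ∈ Icc 1 K, ∃ n ∈ cnt i, p = a + q * n := by
      intro p hp
      simp only [hP, mem_sdiff, mem_filter, mem_Ioc, not_and] at hp
      obtain ⟨⟨⟨hp0, hp2⟩, hpp, hpa⟩, hp3⟩ := hp
      have hp1 : N1 < p := by
        by_contra hc; exact hp3 ⟨hp0, by omega⟩ hpp hpa
      have hap : a ≤ p := by omega
      have hdv : q ∣ p - a := (Nat.modEq_iff_dvd' hap).1 ((ZMod.natCast_eq_natCast_iff _ _ _).1 hpa.symm)
      obtain ⟨n, hn⟩ := hdv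
      have hpn : p = a + q * n := by omega
      have hnh : h ≤ n := by
        by_contra hc
        have : q * n < q * h := Nat.mul_lt_mul_of_pos_left (by omega) hq
        omega
      have hnh2 : n < (K + 1) * h := by
        by_contra hc
        have : q * ((K + 1) * h) ≤ q * n := Nat.mul_le_mul_left _ (by omega)
        omega
      refine ⟨n / h, mem_Icc.2 ⟨(Nat.one_le_div_iff (by omega)).2 hnh, ?_⟩, n, ?_, hpn⟩
      · exact Nat.lt_succ_iff.1 ((Nat.div_lt_iff_lt_mul (by omega)).2 hnh2)
      · simp only [hcnt, mem_filter, mem_Ico]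
        refine ⟨⟨Nat.div_mul_le_self n h, ?_⟩, hpn ▸ hpp⟩
        rw [mul_comm]; exact Nat.lt_mul_div_succ n (by omega)
    choose! fi hfi fn hfn hpe using hmap
    rw [sum_sigma']
    have hinj : Set.InjOn (fun p => (⟨fi p, fn p⟩ : (_ : ℕ) × ℕ)) ((P N2 \ P N1 : Finset ℕ) : Set ℕ) := by
      intro x hx y hy hxy
      simp only [Sigma.mk.injEq, heq_eq_eq] at hxy
      rw [hpe x hx, hpe y hy, hxy.2]
    calc _ ≤ ∑ p ∈ P N2 \ P N1, (2 * Real.log h) / (q * (fi p) * h) := by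
          refine sum_le_sum fun p hp => ?_
          have h1 := hfi p hp
          have h2 := hfn p hp
          have h3 := hpe p hp
          simp only [hcnt, mem_filter, mem_Ico] at h2
          rw [mem_Icc] at h1
          have hp2 : p ∈ P N2 := (mem_sdiff.1 hp).1
          simp only [hP, mem_filter, mem_Ioc] at hp2
          have hpr : (0 : ℝ) < p := by exact_mod_cast hp2.1.1
          have hfr : (0 : ℝ) < fi p := by exact_mod_cast h1.1
          have e1 : Real.log p ≤ 2 * Real.log h := by
            have : Real.log p ≤ Real.log (h ^ 2) :=
              Real.log_le_log hpr (le_trans (by exact_mod_cast hp2.1.2) hN2'')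
            rwa [Real.log_pow] at this
          have e2 : (q * fi p * h : ℝ) ≤ p := by
            have : q * fi p * h ≤ p := by
              calc q * fi p * h = q * (fi p * h) := by ring
                _ ≤ q * fn p := Nat.mul_le_mul_left _ h2.1.1
                _ ≤ _ := by omega
            exact_mod_cast this
          exact div_le_div₀ (by positivity) e1 (by positivity) e2
      _ = ∑ x ∈ (P N2 \ P N1).image (fun p => (⟨fi p, fn p⟩ : (_ : ℕ) × ℕ)), (2 * Real.log h) / (q * x.1 * h) := by
          rw [sum_image hinj]
      _ ≤ _ := by
          refine sum_le_sum_of_subset_of_nonneg ?_ fun _ _ _ => by positivity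
          rw [image_subset_iff]
          intro p hp
          exact mem_sigma.2 ⟨hfi p hp, hfn p hp⟩
  have hup2 : ∑ i ∈ Icc 1 K, ∑ n ∈ cnt i, (2 * Real.log h) / (q * i * h) ≤ (1 + Real.log K) / (4 * q) := by
    have hharm := harmonic_le_one_add_log K
    rw [harmonic_eq_sum_Icc] at hharm
    push_cast at hharm
    calc _ ≤ ∑ i ∈ Icc 1 K, 1 / (4 * q : ℝ) * (i : ℝ)⁻¹ := by
          refine sum_le_sum fun i hi => ?_
          rw [mem_Icc] at hi
          have hir : (0 : ℝ) < i := by exact_mod_cast hi.1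
          rw [sum_const, nsmul_eq_mul]
          calc _ ≤ (h : ℝ) / (8 * Real.log h) * ((2 * Real.log h) / (q * i * h)) := by
                gcongr
                exact (hcon i hi.1 hi.2).le
            _ = _ := by field_simp; norm_num
      _ = 1 / (4 * q : ℝ) * ∑ i ∈ Icc 1 K, (i : ℝ)⁻¹ := by rw [mul_sum]
      _ ≤ 1 / (4 * q : ℝ) * (1 + Real.log K) := by gcongr
      _ = _ := by ring
  have hfin := hlow.trans (hup.trans hup2)
  have : (Real.log K - 1) - 2 * C * q ≤ (1 + Real.log K) / 4 := by
    have h1 : ((Real.log K - 1) / q - 2 * C) * q ≤ (1 + Real.log K) / (4 * q) * q := by gcongr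
    have h2 : ((Real.log K - 1) / q - 2 * C) * q = (Real.log K - 1) - 2 * C * q := by field_simp
    have h3 : (1 + Real.log K) / (4 * q) * q = (1 + Real.log K) / 4 := by field_simp
    linarith
  nlinarith [mul_nonneg hC0 (by linarith : (0 : ℝ) ≤ q)]

end

section
open Finset

lemma pe_mono (P : Polynomial ℕ) : Monotone fun x : ℕ => P.eval x := by
  intro a b hab
  simp only [Polynomial.eval_eq_sum_range]
  gcongr

lemma pe_conv (P : Polynomial ℕ) (m : ℕ) : 2 * P.eval (m + 1) ≤ P.eval m + P.eval (m + 2) := by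
  simp only [Polynomial.eval_eq_sum_range]
  rw [mul_sum, ← sum_add_distrib]
  refine sum_le_sum fun i _ => ?_
  have h : ∀ i, 2 * (m + 1) ^ i ≤ m ^ i + (m + 2) ^ i := by
    intro i
    induction i with
    | zero => simp
    | succ i ih =>
      have h1 : m ^ i ≤ (m + 2) ^ i := Nat.pow_le_pow_left (by omega) i
      rw [pow_succ, pow_succ, pow_succ]; nlinarith
  nlinarith [h i]

/-- forward difference -/
def dl (P : Polynomial ℕ) (m : ℕ) : ℕ := P.eval (m + 1) - P.eval m

lemma dl_add (P : Polynomial ℕ) (m : ℕ) : P.eval m + dl P m = P.eval (m + 1) := by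
  have := pe_mono P (Nat.le_succ m)
  simp only [Nat.succ_eq_add_one] at this
  rw [dl]; omega

lemma dl_mono (P : Polynomial ℕ) : Monotone (dl P) := by
  refine monotone_nat_of_le_succ fun m => ?_
  have h1 := pe_conv P m
  have h2 := dl_add P m
  have h3 := dl_add P (m + 1)
  rw [show m + 1 + 1 = m + 2 by ring] at h3
  omega

lemma dl_sum (P : Polynomial ℕ) (h0 : P.eval 0 = 0) (M : ℕ) : ∑ m ∈ range M, dl P m = P.eval M := by
  induction M with
  | zero => simp [h0]
  | succ M ih => rw [sum_range_succ, ih, dl_add]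

lemma dl_sum2 (P : Polynomial ℕ) (M K : ℕ) : P.eval M + K * dl P M ≤ P.eval (M + K) := by
  induction K with
  | zero => simp
  | succ K ih =>
    have h1 := dl_add P (M + K)
    have h2 := dl_mono P (Nat.le_add_right M K)
    rw [← add_assoc, ← h1]; nlinarith

lemma pe_le (P : Polynomial ℕ) (D : ℕ) (hP : P.natDegree ≤ D) (x : ℕ) (hx : 1 ≤ x) :
    P.eval x ≤ P.eval 1 * x ^ D := by
  rw [Polynomial.eval_eq_sum_range, Polynomial.eval_eq_sum_range, sum_mul]
  refine sum_le_sum fun i hi => ?_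
  have : x ^ i ≤ x ^ D := Nat.pow_le_pow_right hx (by have := mem_range.1 hi; omega)
  simp; gcongr

lemma poly_bds (P : Polynomial ℕ) (D : ℕ) (hP : P.natDegree ≤ D) (k : ℕ) (hk : 1 ≤ k) :
    ∃ la : ℕ, 1 ≤ la ∧ ∀ g, 1 ≤ g → P.eval (k * g) ≤ la * g ^ D ∧ g * dl P (k * g) ≤ la * g ^ D := by
  refine ⟨P.eval 1 * (2 * k) ^ D + 1, by omega, fun g hg => ?_⟩
  have h1 := pe_le P D hP (k * g + k * g) (by nlinarith)
  have h2 := dl_sum2 P (k * g) (k * g)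
  have h3 : k * g + k * g = 2 * k * g := by ring
  rw [h3] at h1
  rw [h3] at h2
  rw [mul_pow] at h1
  have h4 : g * dl P (k * g) ≤ k * g * dl P (k * g) := by gcongr; nlinarith
  constructor <;> nlinarith [Nat.zero_le (g ^ D)]

/-- triangular weight -/
def wt (L T0 t : ℕ) : ℕ := L - (t - T0) - (T0 - t)

lemma wt_le (L T0 t : ℕ) : wt L T0 t ≤ L := by unfold wt; omega
lemma wt_lip (L T0 t k : ℕ) : |(wt L T0 (t + k) : ℝ) - wt L T0 t| ≤ k := by
  have h1 : wt L T0 (t + k) ≤ wt L T0 t + k := by unfold wt; omega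
  have h2 : wt L T0 t ≤ wt L T0 (t + k) + k := by unfold wt; omega
  rw [abs_le]
  have h1' : (wt L T0 (t + k) : ℝ) ≤ wt L T0 t + k := by exact_mod_cast h1
  have h2' : (wt L T0 t : ℝ) ≤ wt L T0 (t + k) + k := by exact_mod_cast h2
  constructor <;> linarith
lemma wt_zero (L T0 t : ℕ) (h : T0 + L ≤ t) : wt L T0 t = 0 := by unfold wt; omega

noncomputable def wh (L T0 : ℕ) (β : ℝ) : ℂ :=
  ee (T0 * β) * ((∑ x ∈ range L, ee (x * β)) * (∑ y ∈ range L, ee (y * (-β))))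

lemma wh_eq (L T0 N : ℕ) (h1 : L ≤ T0) (h2 : T0 + L ≤ N) (β : ℝ) :
    ∑ t ∈ range N, (wt L T0 t : ℂ) * ee (t * β) = wh L T0 β := by
  rw [wh, ← ker_eq]
  have hc : ∀ t ∈ range N, (wt L T0 t : ℂ) =
      ∑ x ∈ range L, ∑ y ∈ range L, if t + y = T0 + x then 1 else 0 := by
    intro t _
    have e : ∀ x ∈ range L, (∑ y ∈ range L, if t + y = T0 + x then (1 : ℂ) else 0) =
        if x ∈ Ico (t - T0) (t + L - T0) then 1 else 0 := by
      intro x hx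
      have hx := mem_range.1 hx
      split_ifs with hh
      · rw [mem_Ico] at hh
        rw [sum_eq_single (T0 + x - t)]
        · rw [if_pos (by omega)]
        · intro y _ hy; rw [if_neg (by omega)]
        · intro hy; rw [mem_range] at hy; omega
      · rw [mem_Ico] at hh
        refine sum_eq_zero fun y hy => ?_
        have := mem_range.1 hy
        rw [if_neg (by omega)]
    rw [sum_congr rfl e, sum_ite, sum_const_zero, add_zero, sum_const, nsmul_eq_mul, mul_one]
    congr 1
    have : {x ∈ range L | x ∈ Ico (t - T0) (t + L - T0)} = Ico (t - T0) (min L (t + L - T0)) := by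
      ext x; simp only [mem_filter, mem_range, mem_Ico]; omega
    rw [this, Nat.card_Ico, wt]; omega
  rw [sum_congr rfl fun t ht => by rw [hc t ht]]
  simp_rw [sum_mul]
  rw [sum_comm]
  refine sum_congr rfl fun x hx => ?_
  rw [sum_comm]
  refine sum_congr rfl fun y hy => ?_
  have hx := mem_range.1 hx
  have hy := mem_range.1 hy
  rw [sum_eq_single (T0 + x - y)]
  · rw [if_pos (by omega), one_mul, Nat.cast_sub (by omega)]; push_cast; rfl
  · intro t _ ht; rw [if_neg (by omega), zero_mul]
  · intro ht; rw [mem_range] at ht; omega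

lemma ee_per (n : ℕ) (β : ℝ) (z : ℤ) : ee (n * (β + z)) = ee (n * β) := by
  have := ee_add_int (n * β) (n * z)
  rw [← this]; congr 1; push_cast; ring

lemma wh_per (L T0 : ℕ) (β : ℝ) (z : ℤ) : wh L T0 (β + z) = wh L T0 β := by
  unfold wh
  rw [ee_per]
  congr 2
  · exact sum_congr rfl fun x _ => ee_per _ _ _
  · refine sum_congr rfl fun x _ => ?_
    rw [← ee_per x (-β) (-z)]; congr 2; push_cast; ring

lemma wh_norm (L T0 : ℕ) (β : ℝ) : ‖wh L T0 β‖ = ‖ES (range L) β‖ ^ 2 := by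
  unfold wh ES
  rw [norm_mul, norm_mul, ee_norm, one_mul, sq]
  congr 1
  rw [← RCLike.norm_conj, map_sum]
  congr 1
  refine sum_congr rfl fun y _ => ?_
  rw [ee_conj]; congr 1; ring

lemma wh_nd (L T0 : ℕ) (β : ℝ) (h : 0 < nd β) : ‖wh L T0 β‖ ≤ 1 / (4 * nd β ^ 2) := by
  rw [wh_norm]
  have := ee_geom_nd L β h
  calc _ ≤ (1 / (2 * nd β)) ^ 2 := by gcongr; exact this
    _ = _ := by field_simp; norm_num

lemma parseval (N : ℕ) (hN : 0 < N) (A : Finset ℕ) (hA : A ⊆ range N) (γ : ℝ) :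
    ∑ j ∈ range N, ‖ES A (γ + j / N)‖ ^ 2 = N * #A := by
  have : ((∑ j ∈ range N, ‖ES A (γ + j / N)‖ ^ 2 : ℝ) : ℂ) = (N * #A : ℝ) := by
    push_cast
    have e : ∀ j ∈ range N, (‖ES A (γ + j / N)‖ : ℂ) ^ 2 = ∑ n ∈ A, ∑ n' ∈ A,
        ee ((n - n') * γ) * ee (j * (((n : ℤ) - n' : ℤ) / N : ℝ)) := by
      intro j _
      rw [← Complex.mul_conj', ES, map_sum, sum_mul_sum]
      refine sum_congr rfl fun n _ => sum_congr rfl fun n' _ => ?_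
      rw [ee_conj, ← ee_add, ← ee_add]; congr 1; push_cast; ring
    rw [sum_congr rfl e, sum_comm]
    have e2 : ∀ n ∈ A, ∑ j ∈ range N, ∑ n' ∈ A,
        ee ((n - n') * γ) * ee (j * (((n : ℤ) - n' : ℤ) / N : ℝ)) = N := by
      intro n hn
      rw [sum_comm, sum_eq_single n]
      · simp [ee_zero]
      · intro n' hn' hne
        rw [← mul_sum, ee_orth hN, if_neg, mul_zero]
        rintro ⟨k, hk⟩
        have h1 := mem_range.1 (hA hn)
        have h2 := mem_range.1 (hA hn')
        have h1' : (n : ℤ) < N := by exact_mod_cast h1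
        have h2' : (n' : ℤ) < N := by exact_mod_cast h2
        have hk0 : k ≠ 0 := by rintro rfl; omega
        have : (1 : ℤ) ≤ |k| := Int.one_le_abs hk0
        have h3 : |(n : ℤ) - n'| = N * |k| := by rw [hk, abs_mul, Nat.abs_cast]
        have h4 : |(n : ℤ) - n'| < N := by rw [abs_lt]; constructor <;> omega
        nlinarith
      · intro h; exact absurd hn h
    rw [sum_congr rfl e2, sum_const, nsmul_eq_mul, mul_comm]
  exact_mod_cast this

lemma wh_l1 (N L T0 : ℕ) (hN : 0 < N) (hL : L ≤ N) :
    ∑ j ∈ range N, ‖wh L T0 (j / N)‖ = N * L := by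
  have := parseval N hN (range L) (range_subset_range.2 hL) 0
  simp only [zero_add, card_range] at this
  rw [← this]
  exact sum_congr rfl fun j _ => wh_norm _ _ _

end

section
open Finset

noncomputable def fz (P : Polynomial ℕ) (L T0 : ℕ) (β : ℝ) (m : ℕ) : ℂ :=
  ((dl P m * wt L T0 (P.eval m) : ℝ) : ℂ) * ee (β * ((P.eval m : ℕ) : ℝ))

lemma ee_step (P : Polynomial ℕ) (β : ℝ) (m : ℕ) :
    ‖ee (β * ((P.eval (m + 1) : ℕ) : ℝ)) - ee (β * ((P.eval m : ℕ) : ℝ))‖ ≤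
      2 * Real.pi * (|β| * dl P m) := by
  refine (ee_sub_ee_le _ _).trans (le_of_eq ?_)
  rw [← dl_add P m]; push_cast
  rw [← mul_sub, add_sub_cancel_left, abs_mul, Nat.abs_cast]

lemma fz_var (P : Polynomial ℕ) (h0 : P.eval 0 = 0) (L T0 : ℕ) (β : ℝ) (M : ℕ) :
    ‖fz P L T0 β (M - 1)‖ + ∑ m ∈ range (M - 1), ‖fz P L T0 β (m + 1) - fz P L T0 β m‖ ≤
      dl P M * (2 * L + P.eval M * (1 + 2 * Real.pi * L * |β|)) := by
  have hpi := Real.pi_pos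
  have hw : ∀ t, (wt L T0 t : ℝ) ≤ L := fun t => by exact_mod_cast wt_le L T0 t
  have hd : ∀ m, m ≤ M → (dl P m : ℝ) ≤ dl P M := fun m hm => by exact_mod_cast dl_mono P hm
  have hn : ‖fz P L T0 β (M - 1)‖ ≤ dl P M * L := by
    rw [fz, norm_mul, ee_norm, mul_one, Complex.norm_real, Real.norm_of_nonneg (by positivity)]
    gcongr
    · exact dl_mono P (Nat.sub_le M 1)
    · exact wt_le _ _ _
  have hs : ∀ m ∈ range (M - 1), ‖fz P L T0 β (m + 1) - fz P L T0 β m‖ ≤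
      L * ((dl P (m + 1) : ℝ) - dl P m) + dl P M * (1 + 2 * Real.pi * L * |β|) * dl P m := by
    intro m hm
    have hm := mem_range.1 hm
    have e : fz P L T0 β (m + 1) - fz P L T0 β m =
      (((dl P (m + 1) - dl P m) * wt L T0 (P.eval (m + 1)) + dl P m *
        (wt L T0 (P.eval (m + 1)) - wt L T0 (P.eval m)) : ℝ) : ℂ) *
          ee (β * ((P.eval (m + 1) : ℕ) : ℝ)) +
      ((dl P m * wt L T0 (P.eval m) : ℝ) : ℂ) *
        (ee (β * ((P.eval (m + 1) : ℕ) : ℝ)) - ee (β * ((P.eval m : ℕ) : ℝ))) := by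
      unfold fz; push_cast; ring
    rw [e]
    refine (norm_add_le _ _).trans ?_
    rw [norm_mul, norm_mul, ee_norm, mul_one, Complex.norm_real, Complex.norm_real,
      Real.norm_of_nonneg (r := dl P m * wt L T0 (P.eval m)) (by positivity), Real.norm_eq_abs]
    have hm1 : (0 : ℝ) ≤ dl P (m + 1) - dl P m := by
      rw [sub_nonneg]; exact_mod_cast dl_mono P (Nat.le_succ m)
    have a1 : |((dl P (m + 1) : ℝ) - dl P m) * wt L T0 (P.eval (m + 1)) + dl P m *
        (wt L T0 (P.eval (m + 1)) - wt L T0 (P.eval m))| ≤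
        L * ((dl P (m + 1) : ℝ) - dl P m) + dl P M * dl P m := by
      refine (abs_add_le _ _).trans (add_le_add ?_ ?_)
      · rw [abs_of_nonneg (by positivity), mul_comm]; gcongr; exact wt_le _ _ _
      · rw [abs_mul, Nat.abs_cast, mul_comm]
        have := wt_lip L T0 (P.eval m) (dl P m)
        rw [dl_add] at this
        gcongr
        exact this.trans (hd m (by omega))
    have a2 : (dl P m * wt L T0 (P.eval m) : ℝ) *
        ‖ee (β * ((P.eval (m + 1) : ℕ) : ℝ)) - ee (β * ((P.eval m : ℕ) : ℝ))‖ ≤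
        (dl P m * L) * (2 * Real.pi * (|β| * dl P M)) := by
      gcongr
      · exact wt_le _ _ _
      · refine (ee_step P β m).trans ?_
        gcongr; exact dl_mono P (by omega)
    linarith
  have hsum := sum_le_sum hs
  rw [sum_add_distrib, ← mul_sum, ← mul_sum, sum_range_sub (fun m => (dl P m : ℝ)),
    ← Nat.cast_sum, dl_sum P h0] at hsum
  have h2 : ((P.eval (M - 1) : ℕ) : ℝ) ≤ P.eval M := by exact_mod_cast pe_mono P (Nat.sub_le M 1)
  have h3 := hd (M - 1) (by omega)
  have h4 : (L : ℝ) * ((dl P (M - 1) : ℝ) - dl P 0) ≤ L * dl P M := by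
    gcongr
    have : (0 : ℝ) ≤ dl P 0 := by positivity
    linarith
  have h5 : (dl P M : ℝ) * (1 + 2 * Real.pi * L * |β|) * ((P.eval (M - 1) : ℕ) : ℝ) ≤
      dl P M * (1 + 2 * Real.pi * L * |β|) * P.eval M := by gcongr
  nlinarith

lemma fz_block (P : Polynomial ℕ) (h0 : P.eval 0 = 0) (L T0 : ℕ) (β : ℝ) (M : ℕ) :
    ‖∑ m ∈ range M, fz P L T0 β m - ∑ t ∈ range (P.eval M), (wt L T0 t : ℂ) * ee (t * β)‖ ≤
      dl P M * P.eval M * (1 + 2 * Real.pi * L * |β|) := by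
  have hpi := Real.pi_pos
  have hw : ∀ t, (wt L T0 t : ℝ) ≤ L := fun t => by exact_mod_cast wt_le L T0 t
  have key : ∀ M, ‖∑ m ∈ range M, fz P L T0 β m -
      ∑ t ∈ range (P.eval M), (wt L T0 t : ℂ) * ee (t * β)‖ ≤
      ∑ m ∈ range M, (dl P m : ℝ) * (dl P m * (1 + 2 * Real.pi * L * |β|)) := by
    intro M
    induction M with
    | zero => simp [h0]
    | succ M ih =>
      rw [sum_range_succ, sum_range_succ, ← dl_add, sum_range_add, add_sub_add_comm]
      refine (norm_add_le _ _).trans (add_le_add ih ?_)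
      have e : fz P L T0 β M = ∑ k ∈ range (dl P M),
          (wt L T0 (P.eval M) : ℂ) * ee (β * ((P.eval M : ℕ) : ℝ)) := by
        rw [sum_const, card_range, nsmul_eq_mul, fz]; push_cast; ring
      rw [e, ← sum_sub_distrib]
      refine (norm_sum_le _ _).trans ?_
      have : ∀ k ∈ range (dl P M), ‖(wt L T0 (P.eval M) : ℂ) * ee (β * ((P.eval M : ℕ) : ℝ)) -
          (wt L T0 (P.eval M + k) : ℂ) * ee ((P.eval M + k : ℕ) * β)‖ ≤
          dl P M * (1 + 2 * Real.pi * L * |β|) := by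
        intro k hk
        have hk : (k : ℝ) ≤ dl P M := by exact_mod_cast (mem_range.1 hk).le
        have e2 : (wt L T0 (P.eval M) : ℂ) * ee (β * ((P.eval M : ℕ) : ℝ)) -
          (wt L T0 (P.eval M + k) : ℂ) * ee ((P.eval M + k : ℕ) * β) =
          -(((wt L T0 (P.eval M + k) - wt L T0 (P.eval M) : ℝ) : ℂ) * ee (β * ((P.eval M : ℕ) : ℝ)))
          + ((wt L T0 (P.eval M + k) : ℝ) : ℂ) *
            (ee (β * ((P.eval M : ℕ) : ℝ)) - ee ((P.eval M + k : ℕ) * β)) := by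
          push_cast; ring
        rw [e2]
        refine (norm_add_le _ _).trans ?_
        rw [norm_neg, norm_mul, norm_mul, ee_norm, mul_one, Complex.norm_real, Complex.norm_real,
          Real.norm_of_nonneg (r := (wt L T0 (P.eval M + k) : ℝ)) (by positivity), Real.norm_eq_abs]
        have b1 := wt_lip L T0 (P.eval M) k
        have b2 : ‖ee (β * ((P.eval M : ℕ) : ℝ)) - ee ((P.eval M + k : ℕ) * β)‖ ≤
            2 * Real.pi * (|β| * dl P M) := by
          refine (ee_sub_ee_le _ _).trans ?_
          have : β * ((P.eval M : ℕ) : ℝ) - (P.eval M + k : ℕ) * β = -(β * k) := by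
            push_cast; ring
          rw [this, abs_neg, abs_mul, Nat.abs_cast]; gcongr
        have b3 := mul_le_mul (hw (P.eval M + k)) b2 (norm_nonneg _) (by positivity)
        linarith
      refine (sum_le_sum this).trans ?_
      rw [sum_const, card_range, nsmul_eq_mul]
  refine (key M).trans ?_
  calc _ ≤ ∑ m ∈ range M, (dl P m : ℝ) * (dl P M * (1 + 2 * Real.pi * L * |β|)) := by
        refine sum_le_sum fun m hm => ?_
        gcongr
        exact dl_mono P (mem_range.1 hm).le
    _ = _ := by
      rw [← sum_mul, ← Nat.cast_sum, dl_sum P h0]; ring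

lemma fz_mul (P : Polynomial ℕ) (L T0 : ℕ) (β γ : ℝ) (m : ℕ) :
    fz P L T0 (β + γ) m = fz P L T0 β m * ee (γ * ((P.eval m : ℕ) : ℝ)) := by
  unfold fz; rw [mul_assoc, ← ee_add]; congr 2; ring

lemma fz_per (P : Polynomial ℕ) (L T0 : ℕ) (β : ℝ) (z : ℤ) (m : ℕ) :
    fz P L T0 (β + z) m = fz P L T0 β m := by
  unfold fz; rw [mul_comm (β + z), ee_per, mul_comm β]

end

section
open Finset

lemma pe_modEq (P : Polynomial ℕ) {a b s : ℕ} (h : a ≡ b [MOD s]) :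
    P.eval a ≡ P.eval b [MOD s] := by
  rw [← ZMod.natCast_eq_natCast_iff] at h ⊢
  have e : ∀ n : ℕ, ((P.eval n : ℕ) : ZMod s) = (P.map (Nat.castRingHom (ZMod s))).eval (n : ZMod s) := by
    intro n; rw [Polynomial.eval_natCast_map]; simp
  rw [e, e, h]

lemma ee_frac {x y s : ℕ} (hs : 0 < s) (b : ℕ) (h : x ≡ y [MOD s]) :
    ee ((b : ℝ) / s * x) = ee ((b : ℝ) / s * y) := by
  obtain ⟨z, hz⟩ := (Nat.modEq_iff_dvd.1 h)
  have hs' : (s : ℝ) ≠ 0 := by positivity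
  have hz' : (y : ℝ) = x + s * z := by
    have : (y : ℤ) = x + s * z := by linarith
    exact_mod_cast this
  rw [hz', ← ee_add_int _ (b * z)]; congr 1; push_cast; field_simp

lemma GS_le (P : Polynomial ℕ) (b s : ℕ) : ‖GS P b s‖ ≤ s := by
  refine (norm_sum_le _ _).trans ?_
  simp [ee_norm]

lemma GS_le' (P : Polynomial ℕ) (b s : ℕ) : ‖GS P b s / s‖ ≤ 1 := by
  rw [norm_div, Complex.norm_natCast]
  exact div_le_one_of_le₀ (GS_le P b s) (by positivity)

lemma major (P : Polynomial ℕ) (h0 : P.eval 0 = 0) (L T0 M b s : ℕ) (hs : 1 ≤ s) (hL : L ≤ T0)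
    (hM : T0 + L ≤ P.eval M) (β : ℝ) :
    ‖∑ m ∈ range M, fz P L T0 (β + b / s) m - GS P b s / s * wh L T0 β‖ ≤
      (2 * s + 1) * (dl P M * (2 * L + P.eval M * (1 + 2 * Real.pi * L * |β|))) := by
  have hpi := Real.pi_pos
  have hsC : (s : ℂ) ≠ 0 := by exact_mod_cast (by omega : s ≠ 0)
  set c : ℕ → ℂ := fun m => (ee ((b : ℝ) / s * ((P.eval m : ℕ) : ℝ)) - GS P b s / s) / 2 with hc
  have hb : ∀ n, ‖∑ i ∈ range n, c i‖ ≤ s := by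
    intro n
    have := per_bd c s hs ?_ ?_ ?_ n 0
    · simpa using this
    · intro m
      simp only [hc]
      rw [ee_frac hs b (pe_modEq P (show m + s ≡ m [MOD s] by simp [Nat.ModEq]))]
    · intro m
      simp only [hc]
      rw [norm_div, Complex.norm_two, div_le_one (by norm_num)]
      refine (norm_sub_le _ _).trans ?_
      rw [ee_norm]; linarith [GS_le' P b s]
    · simp only [hc]
      rw [← sum_div, sum_sub_distrib, sum_const, card_range, nsmul_eq_mul, mul_div_cancel₀ _ hsC]
      change (GS P b s - GS P b s) / 2 = 0
      simp
  have h1 := abel_var (fz P L T0 β) c s hb M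
  have h2 := fz_var P h0 L T0 β M
  have h3 := fz_block P h0 L T0 β M
  rw [wh_eq L T0 _ hL hM] at h3
  have e : ∑ m ∈ range M, fz P L T0 (β + b / s) m - GS P b s / s * wh L T0 β =
      2 * ∑ m ∈ range M, fz P L T0 β m * c m +
        GS P b s / s * (∑ m ∈ range M, fz P L T0 β m - wh L T0 β) := by
    have : ∀ m, fz P L T0 (β + b / s) m = 2 * (fz P L T0 β m * c m) +
        GS P b s / s * fz P L T0 β m := by
      intro m; rw [fz_mul]; simp only [hc]; ring
    simp_rw [this]
    rw [sum_add_distrib, ← mul_sum, ← mul_sum]; ring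
  rw [e]
  refine (norm_add_le _ _).trans ?_
  rw [norm_mul, norm_mul, Complex.norm_two]
  have h4 := mul_le_mul (GS_le' P b s) h3 (norm_nonneg _) zero_le_one
  have h5 : (s : ℝ) * (‖fz P L T0 β (M - 1)‖ + ∑ i ∈ range (M - 1),
      ‖fz P L T0 β (i + 1) - fz P L T0 β i‖) ≤
    s * (dl P M * (2 * L + P.eval M * (1 + 2 * Real.pi * L * |β|))) := by gcongr
  have h6 : (0 : ℝ) ≤ dl P M * (2 * L) := by positivity
  nlinarith

lemma nd_add (x y : ℝ) : nd (x + y) ≤ nd x + nd y := by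
  have := nd_le (x + y) (round x + round y)
  refine this.trans ?_
  have e : x + y - ((round x + round y : ℤ) : ℝ) = (x - round x) + (y - round y) := by
    push_cast; ring
  rw [e]; exact abs_add_le _ _

lemma sep2 {S0 s s' b b' : ℕ} (hs : s ∈ Icc 1 S0) (hs' : s' ∈ Icc 1 S0) (hb : b ∈ VV s)
    (hb' : b' ∈ VV s') (hne : ¬ (s = s' ∧ b = b')) :
    1 / (S0 : ℝ) ^ 2 ≤ nd ((b : ℝ) / s - b' / s') := by
  rw [mem_Icc] at hs hs'
  rw [VV, mem_filter, mem_range] at hb hb'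
  have := frac_sep (s := s) (s' := s') (u := 1) (u' := 1) (b := b) (b' := b') (v := 0) (v' := 0)
    hs.1 hs'.1 one_pos one_pos (by simp) (by simp) (by simp) (by simp) hb.2 hb'.2 (by simp)
    (by simp) hb.1 hb'.1 one_pos one_pos (fun h => hne ⟨h.1, h.2.1⟩)
  simp only [Nat.cast_zero, zero_div, add_zero, mul_one] at this
  refine le_trans ?_ this
  have h1 : 0 < s * s' := Nat.mul_pos hs.1 hs'.1
  have h2 : s * s' ≤ S0 ^ 2 := by rw [sq]; exact Nat.mul_le_mul hs.2 hs'.2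
  have h1' : (0 : ℝ) < (s * s' : ℕ) := by exact_mod_cast h1
  have h2' : ((s * s' : ℕ) : ℝ) ≤ (S0 : ℝ) ^ 2 := by exact_mod_cast h2
  exact one_div_le_one_div_of_le h1' h2'

lemma frac_red (s0 : ℕ) (hs : 1 ≤ s0) (z : ℤ) :
    ∃ s b : ℕ, ∃ z' : ℤ, 1 ≤ s ∧ s ≤ s0 ∧ b ∈ VV s ∧ (z : ℝ) / s0 = b / s + z' := by
  have hs0 : (0 : ℤ) < s0 := by exact_mod_cast hs
  obtain ⟨z0, hz0⟩ := Int.eq_ofNat_of_zero_le (Int.emod_nonneg z hs0.ne')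
  have hlt : z0 < s0 := by
    have := Int.emod_lt_of_pos z hs0
    rw [hz0] at this; exact_mod_cast this
  have hd : 0 < Nat.gcd s0 z0 := Nat.gcd_pos_of_pos_left _ hs
  obtain ⟨s, hs'⟩ := Nat.gcd_dvd_left s0 z0
  obtain ⟨b, hb'⟩ := Nat.gcd_dvd_right s0 z0
  have hcop := Nat.coprime_div_gcd_div_gcd (m := s0) (n := z0) hd
  set d := Nat.gcd s0 z0
  have e1 : s0 / d = s := by rw [hs']; exact Nat.mul_div_cancel_left _ hd
  have e2 : z0 / d = b := by rw [hb']; exact Nat.mul_div_cancel_left _ hd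
  rw [e1, e2] at hcop
  have hspos : 1 ≤ s := by
    rcases Nat.eq_zero_or_pos s with h | h
    · rw [h] at hs'; omega
    · exact h
  refine ⟨s, b, z / s0, hspos, ?_, ?_, ?_⟩
  · rw [hs']; exact Nat.le_mul_of_pos_left _ hd
  · rw [VV, mem_filter, mem_range]
    refine ⟨?_, hcop⟩
    rw [hs', hb'] at hlt
    exact lt_of_mul_lt_mul_left hlt (Nat.zero_le d)
  · have h1 := Int.emod_add_mul_ediv z s0
    rw [hz0] at h1
    have h2 : (z : ℝ) = z0 + s0 * ((z / s0 : ℤ) : ℝ) := by exact_mod_cast h1.symm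
    have h3 : (s0 : ℝ) = d * s := by exact_mod_cast hs'
    have h4 : (z0 : ℝ) = d * b := by exact_mod_cast hb'
    have hd' : (d : ℝ) ≠ 0 := by positivity
    have hs'' : (s : ℝ) ≠ 0 := by positivity
    rw [h2, add_div, mul_div_cancel_left₀ _ (by positivity), h3, h4, mul_div_mul_left _ _ hd']

end

section
open Finset

lemma minor (P : Polynomial ℕ) (D : ℕ) (hP : P.natDegree ≤ D) (h0 : P.eval 0 = 0)
    (hlc : 1 ≤ P.coeff D) (Cw : ℕ) (hw : ∀ (α : ℝ) (f : ℕ → ℝ), IsP D α f →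
    ∀ (N M : ℕ) (y : ℝ), 1 ≤ M → N ≤ M → 1 ≤ y → M / y ≤ ‖∑ n ∈ range N, ee (f n)‖ →
    ∃ r : ℕ, 1 ≤ r ∧ (r : ℝ) ≤ Cw * y ^ Cw ∧ nd (r * α) ≤ Cw * y ^ Cw / M ^ D)
    (L T0 M S0 : ℕ) (hM : 1 ≤ M) (y : ℝ) (hy : 1 ≤ y) (hS : P.coeff D * (Cw * y ^ Cw) ≤ S0)
    (α : ℝ) (hα : ∀ s ∈ Icc 1 S0, ∀ b ∈ VV s, (S0 : ℝ) / M ^ D < nd (α - b / s)) :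
    ‖∑ m ∈ range M, fz P L T0 α m‖ ≤ M / y * (dl P M * (2 * L + P.eval M)) := by
  have hMD : (0 : ℝ) < (M : ℝ) ^ D := by positivity
  have hlc' : (1 : ℝ) ≤ P.coeff D := by exact_mod_cast hlc
  have hpart : ∀ n ≤ M, ‖∑ m ∈ range n, ee (α * ((P.eval m : ℕ) : ℝ))‖ ≤ M / y := by
    intro n hn
    by_contra hcon
    push Not at hcon
    obtain ⟨r, hr1, hr2, hr3⟩ := hw _ _ (isP_nat P D hP α) n M y hM hn hy hcon.le
    set s0 := r * P.coeff D with hs0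
    have hs01 : 1 ≤ s0 := Nat.mul_pos hr1 hlc
    have hs0S : s0 ≤ S0 := by
      have : (s0 : ℝ) ≤ S0 := by
        rw [hs0]; push_cast
        refine le_trans ?_ hS
        rw [mul_comm]; gcongr
      exact_mod_cast this
    obtain ⟨s, b, z', h1, h2, hb, hz⟩ := frac_red s0 hs01 (round ((s0 : ℝ) * α))
    have h3 := hα s (mem_Icc.2 ⟨h1, h2.trans hs0S⟩) b hb
    have h4 := nd_le (α - b / s) z'
    have hs0' : (1 : ℝ) ≤ s0 := by exact_mod_cast hs01
    have h5 : α - b / s - z' = ((s0 : ℝ) * α - round ((s0 : ℝ) * α)) / s0 := by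
      rw [sub_div, hz, mul_div_cancel_left₀ _ (by positivity)]; ring
    have h6 : |(s0 : ℝ) * α - round ((s0 : ℝ) * α)| ≤ S0 / M ^ D := by
      have e : (s0 : ℝ) * α = r * (P.coeff D * α) := by rw [hs0]; push_cast; ring
      rw [e]
      refine hr3.trans ?_
      gcongr
      refine le_trans ?_ hS
      exact le_mul_of_one_le_left (by positivity) hlc'
    have h7 : |α - b / s - z'| ≤ S0 / M ^ D := by
      rw [h5, abs_div, abs_of_pos (a := (s0 : ℝ)) (by positivity)]
      exact (div_le_self (abs_nonneg _) hs0').trans h6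
    linarith
  set c : ℕ → ℂ := fun m => if m < M then ee (α * ((P.eval m : ℕ) : ℝ)) else 0 with hc
  have hcs : ∀ n, ‖∑ m ∈ range n, c m‖ ≤ M / y := by
    intro n
    rcases le_total n M with h | h
    · rw [sum_congr rfl (g := fun m => ee (α * ((P.eval m : ℕ) : ℝ)))]
      · exact hpart n h
      · intro m hm; simp only [hc]; rw [if_pos (lt_of_lt_of_le (mem_range.1 hm) h)]
    · have : ∑ m ∈ range n, c m = ∑ m ∈ range M, ee (α * ((P.eval m : ℕ) : ℝ)) := by
        rw [← sum_subset (range_subset_range.2 h)]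
        · refine sum_congr rfl fun m hm => ?_
          simp only [hc]; rw [if_pos (mem_range.1 hm)]
        · intro m _ hm; simp only [hc]; rw [if_neg (by simpa using hm)]
      rw [this]; exact hpart M le_rfl
  have h1 := abel_var (fz P L T0 0) c _ hcs M
  have h2 := fz_var P h0 L T0 0 M
  have e : ∑ m ∈ range M, fz P L T0 α m = ∑ m ∈ range M, fz P L T0 0 m * c m := by
    refine sum_congr rfl fun m hm => ?_
    simp only [hc]; rw [if_pos (mem_range.1 hm), ← fz_mul, zero_add]
  rw [e]
  refine h1.trans ?_
  gcongr
  simpa using h2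

lemma sum_VV_le (S0 : ℕ) (F : ℕ → ℕ → ℂ) (B : ℝ) (hB : 0 ≤ B)
    (h : ∀ s ∈ Icc 1 S0, ∀ b ∈ VV s, ‖F s b‖ ≤ B) :
    ‖∑ s ∈ Icc 1 S0, ∑ b ∈ VV s, F s b‖ ≤ (S0 : ℝ) ^ 2 * B := by
  have h1 : ∀ s ∈ Icc 1 S0, ‖∑ b ∈ VV s, F s b‖ ≤ S0 * B := by
    intro s hs
    refine (norm_sum_le _ _).trans ((sum_le_sum (h s hs)).trans ?_)
    rw [sum_const, nsmul_eq_mul]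
    gcongr
    refine (card_filter_le _ _).trans ?_
    rw [card_range]; exact (mem_Icc.1 hs).2
  refine (norm_sum_le _ _).trans ((sum_le_sum h1).trans ?_)
  rw [sum_const, nsmul_eq_mul, Nat.card_Icc, Nat.add_sub_cancel, sq, mul_assoc]

set_option maxHeartbeats 1000000 in
theorem keyM (P : Polynomial ℕ) (D : ℕ) (hD : 2 ≤ D) (hP : P.natDegree ≤ D)
    (hlc : 1 ≤ P.coeff D) (h0 : P.eval 0 = 0) (k : ℕ) (hk : 1 ≤ k) :
    ∃ C : ℕ, 1 ≤ C ∧ ∀ (g S0 T0 : ℕ) (y : ℝ), 1 ≤ y → C * y ^ C ≤ S0 → S0 ^ 6 * y ≤ g →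
      2 * g ^ D ≤ T0 → T0 + 2 * g ^ D ≤ P.eval (k * g) → ∀ α : ℝ,
      ‖∑ m ∈ range (k * g), fz P (2 * g ^ D) T0 α m - ∑ s ∈ Icc 1 S0, ∑ b ∈ VV s,
        GS P b s / s * wh (2 * g ^ D) T0 (α - b / s)‖ ≤ C * ((g : ℝ) ^ D) ^ 2 / y := by
  obtain ⟨Cw, hCw, hw⟩ := weyl D (by omega)
  obtain ⟨la, hla, hbd⟩ := poly_bds P D hP k hk
  set C1 := 54 * la ^ 2 + 1 with hC1
  set C2 := k * (la * (4 + la)) + 1 with hC2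
  refine ⟨Cw * P.coeff D + Cw + C1 + C2 + 2, by omega, ?_⟩
  intro g S0 T0 y hy hS0 hg hT hT2 α
  set C := Cw * P.coeff D + Cw + C1 + C2 + 2 with hC
  have hyC : (1 : ℝ) ≤ y ^ C := one_le_pow₀ hy
  have hyC1 : y ≤ y ^ C := le_self_pow₀ hy (by omega)
  have hC0 : (2 : ℝ) ≤ C := by exact_mod_cast (by omega : 2 ≤ C)
  have hS2 : (2 : ℝ) ≤ S0 := by
    have := mul_le_mul hC0 hyC zero_le_one (by linarith)
    linarith
  have hSy : y ≤ S0 := by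
    have := mul_le_mul (by linarith : (1 : ℝ) ≤ C) hyC1 (by linarith) (by linarith)
    linarith
  have hS1 : (1 : ℝ) ≤ S0 := by linarith
  have hSS : (S0 : ℝ) ≤ S0 ^ 2 := le_self_pow₀ hS1 two_ne_zero
  have hSS1 : (1 : ℝ) ≤ (S0 : ℝ) ^ 2 := hS1.trans hSS
  have hSl : P.coeff D * (Cw * y ^ Cw) ≤ S0 := by
    refine le_trans ?_ hS0
    rw [← mul_assoc]
    gcongr
    · have : P.coeff D * Cw ≤ C := by rw [mul_comm]; omega
      exact_mod_cast this
    · omega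
  have hg6 : (S0 : ℝ) ^ 6 ≤ g := le_trans (le_mul_of_one_le_right (by positivity) hy) hg
  have hg1 : (1 : ℝ) ≤ g := le_trans (one_le_pow₀ (by linarith)) hg6
  have hg1' : 1 ≤ g := by exact_mod_cast hg1
  obtain ⟨hb1, hb2⟩ := hbd g hg1'
  set h : ℝ := (g : ℝ) ^ D with hh
  have hh1 : (g : ℝ) ≤ h := le_self_pow₀ hg1 (by omega)
  have hb1' : ((P.eval (k * g) : ℕ) : ℝ) ≤ la * h := by rw [hh]; exact_mod_cast hb1
  have hb2' : (g : ℝ) * dl P (k * g) ≤ la * h := by rw [hh]; exact_mod_cast hb2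
  have hLc : ((2 * g ^ D : ℕ) : ℝ) = 2 * h := by push_cast; rfl
  have hla' : (1 : ℝ) ≤ la := by exact_mod_cast hla
  set dd : ℝ := (dl P (k * g) : ℝ) with hdd
  have hdd0 : 0 ≤ dd := by positivity
  have hh0 : 0 < h := by positivity
  by_cases hα : ∀ s ∈ Icc 1 S0, ∀ b ∈ VV s, (S0 : ℝ) ^ 2 / h < nd (α - b / s)
  · -- minor arcs
    have m1 := minor P D hP h0 hlc Cw hw (2 * g ^ D) T0 (k * g) S0 (Nat.mul_pos hk hg1') y hy hSl α ?_
    · have m2 := sum_VV_le S0 (fun s b => GS P b s / s * wh (2 * g ^ D) T0 (α - b / s))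
        (h ^ 2 / (4 * S0 ^ 4)) (by positivity) ?_
      · refine (norm_sub_le _ _).trans ((add_le_add m1 m2).trans ?_)
        rw [hLc, le_div_iff₀ (by linarith), add_mul]
        have a1 : ((k * g : ℕ) : ℝ) / y * (dd * (2 * (2 * h) + ((P.eval (k * g) : ℕ) : ℝ))) * y ≤
            k * (la * (4 + la)) * h ^ 2 := by
          have : ((k * g : ℕ) : ℝ) / y * (dd * (2 * (2 * h) + ((P.eval (k * g) : ℕ) : ℝ))) * y =
            k * ((g * dd) * (4 * h + ((P.eval (k * g) : ℕ) : ℝ))) := by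
            push_cast; field_simp; ring
          rw [this]
          calc _ ≤ (k : ℝ) * ((la * h) * (4 * h + la * h)) := by gcongr
            _ = _ := by ring
        have a2 : (S0 : ℝ) ^ 2 * (h ^ 2 / (4 * S0 ^ 4)) * y ≤ h ^ 2 := by
          have : (S0 : ℝ) ^ 2 * (h ^ 2 / (4 * S0 ^ 4)) * y = h ^ 2 * (y / (4 * S0 ^ 2)) := by
            field_simp
          rw [this]
          refine mul_le_of_le_one_right (by positivity) ?_
          rw [div_le_one (by positivity)]; linarith
        have a3 : ((k : ℝ) * (la * (4 + la)) + 1) ≤ C := by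
          have : k * (la * (4 + la)) + 1 ≤ C := by omega
          exact_mod_cast this
        have : ((k : ℝ) * (la * (4 + la)) + 1) * h ^ 2 ≤ C * h ^ 2 := by gcongr
        linarith
      · intro s hs b hb
        rw [norm_mul]
        have b1 := hα s hs b hb
        have b0 : 0 < (S0 : ℝ) ^ 2 / h := by positivity
        have b2 := wh_nd (2 * g ^ D) T0 (α - b / s) (b0.trans b1)
        calc _ ≤ 1 * (1 / (4 * nd (α - b / s) ^ 2)) := by
              gcongr
              exact GS_le' P b s
          _ ≤ 1 * (1 / (4 * ((S0 : ℝ) ^ 2 / h) ^ 2)) := by gcongr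
          _ = _ := by field_simp
    · intro s hs b hb
      refine lt_of_le_of_lt ?_ (hα s hs b hb)
      have : h ≤ ((k * g : ℕ) : ℝ) ^ D := by
        rw [hh]; gcongr; exact Nat.le_mul_of_pos_left _ hk
      gcongr
  · -- major arcs
    push Not at hα
    obtain ⟨s, hs, b, hb, hnd⟩ := hα
    have hs' := mem_Icc.1 hs
    set z := round (α - (b : ℝ) / s) with hz
    set β : ℝ := α - b / s - z with hβ
    have hβ' : |β| ≤ (S0 : ℝ) ^ 2 / h := hnd
    have hsplit : ∑ s ∈ Icc 1 S0, ∑ b ∈ VV s, GS P b s / s * wh (2 * g ^ D) T0 (α - b / s) =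
        GS P b s / s * wh (2 * g ^ D) T0 β + ∑ s' ∈ Icc 1 S0, ∑ b' ∈ VV s',
          if s' = s ∧ b' = b then 0 else GS P b' s' / s' * wh (2 * g ^ D) T0 (α - b' / s') := by
      have e1 : GS P b s / s * wh (2 * g ^ D) T0 β = ∑ s' ∈ Icc 1 S0, ∑ b' ∈ VV s',
          if s' = s ∧ b' = b then GS P b' s' / s' * wh (2 * g ^ D) T0 (α - b' / s') else 0 := by
        rw [sum_eq_single s, sum_eq_single b]
        · rw [if_pos ⟨rfl, rfl⟩, ← wh_per _ _ β z]; congr 2; rw [hβ]; ring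
        · intro b' _ hne; rw [if_neg (fun hh => hne hh.2)]
        · intro hh; exact absurd hb hh
        · intro s' _ hne
          exact sum_eq_zero fun b' _ => by rw [if_neg (fun hh => hne hh.1)]
        · intro hh; exact absurd hs hh
      rw [e1, ← sum_add_distrib]
      refine sum_congr rfl fun s' _ => ?_
      rw [← sum_add_distrib]
      refine sum_congr rfl fun b' _ => ?_
      split_ifs <;> simp
    have m1 := major P h0 (2 * g ^ D) T0 (k * g) b s hs'.1 hT hT2 β
    have e2 : ∑ m ∈ range (k * g), fz P (2 * g ^ D) T0 (β + b / s) m =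
        ∑ m ∈ range (k * g), fz P (2 * g ^ D) T0 α m := by
      refine sum_congr rfl fun m _ => ?_
      rw [← fz_per _ _ _ (β + b / s) z]; congr 1; rw [hβ]; ring
    rw [e2] at m1
    have m2 := sum_VV_le S0 (fun s' b' => if s' = s ∧ b' = b then 0 else
      GS P b' s' / s' * wh (2 * g ^ D) T0 (α - b' / s')) (S0 ^ 4) (by positivity) ?_
    · rw [hsplit, ← sub_sub]
      refine (norm_sub_le _ _).trans ((add_le_add m1 m2).trans ?_)
      rw [hLc, le_div_iff₀ (by linarith), add_mul]
      have hpi := Real.pi_le_four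
      have hpi2 := Real.pi_lt_d2
      have hpi0 := Real.pi_pos
      have c1 : 2 * (2 * h) + ((P.eval (k * g) : ℕ) : ℝ) * (1 + 2 * Real.pi * (2 * h) * |β|) ≤
          18 * la * h * S0 ^ 2 := by
        have d1 : h * |β| ≤ S0 ^ 2 := by rwa [le_div_iff₀ hh0, mul_comm] at hβ'
        have d2 : 2 * Real.pi * (2 * h) * |β| ≤ 13 * S0 ^ 2 := by
          have : 2 * Real.pi * (2 * h) * |β| = 4 * Real.pi * (h * |β|) := by ring
          rw [this]; gcongr; linarith
        have d3 := hSS1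
        calc _ ≤ 2 * (2 * h) + la * h * (S0 ^ 2 + 13 * S0 ^ 2) := by gcongr
          _ ≤ 4 * la * h * S0 ^ 2 + la * h * (S0 ^ 2 + 13 * S0 ^ 2) := by
            have : h ≤ la * h * S0 ^ 2 := by
              have : 1 ≤ (la : ℝ) * S0 ^ 2 := one_le_mul_of_one_le_of_one_le hla' hSS1
              have := mul_le_mul_of_nonneg_left this hh0.le
              linarith
            linarith
          _ ≤ _ := by
            have : 0 ≤ la * h * (S0 : ℝ) ^ 2 := by positivity
            linarith
      have c2 : (2 * (s : ℝ) + 1) ≤ 3 * S0 := by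
        have : (s : ℝ) ≤ S0 := by exact_mod_cast hs'.2
        linarith
      have c3 : (2 * (s : ℝ) + 1) * (dd * (2 * (2 * h) + ((P.eval (k * g) : ℕ) : ℝ) *
          (1 + 2 * Real.pi * (2 * h) * |β|))) * y ≤ 54 * la ^ 2 * h ^ 2 := by
        calc _ ≤ 3 * S0 * (dd * (18 * la * h * S0 ^ 2)) * y := by gcongr
          _ = 54 * la * h * (dd * (S0 ^ 3 * y)) := by ring
          _ ≤ 54 * la * h * (dd * g) := by
            have : (S0 : ℝ) ^ 3 * y ≤ g := by
              refine le_trans ?_ hg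
              gcongr
              · linarith
            gcongr
          _ ≤ 54 * la * h * (la * h) := by rw [mul_comm dd]; gcongr
          _ = _ := by ring
      have c4 : (S0 : ℝ) ^ 2 * S0 ^ 4 * y ≤ h ^ 2 := by
        calc _ = (S0 : ℝ) ^ 6 * y := by ring
          _ ≤ g := hg
          _ ≤ h := hh1
          _ ≤ _ := le_self_pow₀ (hg1.trans hh1) two_ne_zero
      have a3 : ((54 : ℝ) * la ^ 2 + 1) ≤ C := by
        have : 54 * la ^ 2 + 1 ≤ C := by omega
        exact_mod_cast this
      have : ((54 : ℝ) * la ^ 2 + 1) * h ^ 2 ≤ C * h ^ 2 := by gcongr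
      linarith
    · intro s' hs'' b' hb'
      split_ifs with hif
      · simp
      have s1 := sep2 hs'' hs hb' hb hif
      have s2 : nd ((b' : ℝ) / s' - b / s) ≤ nd (α - b / s) + nd (α - b' / s') := by
        have := nd_add (α - b / s) (-(α - b' / s'))
        rw [nd_neg] at this
        convert this using 2; ring
      have s3 : (S0 : ℝ) ^ 2 / h ≤ 1 / (4 * S0 ^ 2) := by
        rw [div_le_div_iff₀ hh0 (by positivity)]
        have : (4 : ℝ) * S0 ^ 4 ≤ S0 ^ 6 := by
          have : (4 : ℝ) ≤ S0 ^ 2 := by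
            have := pow_le_pow_left₀ zero_le_two hS2 2
            linarith
          calc _ ≤ (S0 : ℝ) ^ 2 * S0 ^ 4 := by gcongr
            _ = _ := by ring
        have e : (S0 : ℝ) ^ 2 * (4 * S0 ^ 2) = 4 * S0 ^ 4 := by ring
        rw [e]; linarith
      have s4 : 1 / (2 * (S0 : ℝ) ^ 2) ≤ nd (α - b' / s') := by
        have t1 : 1 / (4 * (S0 : ℝ) ^ 2) = 1 / (S0 : ℝ) ^ 2 / 4 := by field_simp
        have t2 : 1 / (2 * (S0 : ℝ) ^ 2) = 1 / (S0 : ℝ) ^ 2 / 2 := by field_simp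
        have t3 : 0 ≤ 1 / (S0 : ℝ) ^ 2 := by positivity
        have t4 : nd (α - b / s) ≤ (S0 : ℝ) ^ 2 / h := hnd
        rw [t2]; rw [t1] at s3
        linarith
      have s5 : 0 < 1 / (2 * (S0 : ℝ) ^ 2) := by positivity
      rw [norm_mul]
      calc _ ≤ 1 * (1 / (4 * nd (α - b' / s') ^ 2)) := by
            gcongr
            · exact GS_le' P b' s'
            · exact wh_nd _ _ _ (s5.trans_le s4)
        _ ≤ 1 * (1 / (4 * (1 / (2 * (S0 : ℝ) ^ 2)) ^ 2)) := by gcongr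
        _ = _ := by field_simp; norm_num

end

section
open Finset

def rr (A B : Finset ℕ) (t : ℕ) : ℕ := #{p ∈ A ×ˢ B | p.1 + p.2 = t}

lemma four {ι : Type*} (N : ℕ) (hN : 0 < N) (I : Finset ι) (c : ι → ℂ) (v : ι → ℕ)
    (hv : ∀ i ∈ I, v i < N) (A B : Finset ℕ) (hAB : ∀ a ∈ A, ∀ b ∈ B, a + b < N) (γ : ℝ) :
    ∑ j ∈ range N, (∑ i ∈ I, c i * ee (v i * (j / N : ℝ))) *
      (ES A (-(γ + j / N)) * ES B (-(γ + j / N))) =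
    N * ∑ i ∈ I, c i * ee (-(γ * v i)) * rr A B (v i) := by
  have hN' : (N : ℝ) ≠ 0 := by positivity
  simp_rw [sum_mul]
  rw [sum_comm, mul_sum]
  refine sum_congr rfl fun i hi => ?_
  have e : ∀ j ∈ range N, c i * ee (v i * (j / N : ℝ)) *
      (ES A (-(γ + j / N)) * ES B (-(γ + j / N))) = ∑ p ∈ A ×ˢ B, c i * (ee (-(γ * (p.1 + p.2 : ℕ))) *
        ee (j * (((v i : ℤ) - (p.1 + p.2 : ℕ) : ℤ) / N : ℝ))) := by
    intro j _
    unfold ES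
    rw [sum_mul_sum, ← sum_product', mul_sum]
    refine sum_congr rfl fun p _ => ?_
    rw [mul_assoc]; congr 1
    rw [← ee_add, ← ee_add, ← ee_add]; congr 1; push_cast; field_simp; ring
  rw [sum_congr rfl e, sum_comm, rr, card_filter]
  push_cast
  rw [mul_sum, mul_sum]
  refine sum_congr rfl fun p hp => ?_
  rw [← mul_sum, ← mul_sum]
  have := ee_orth hN ((v i : ℤ) - (p.1 + p.2 : ℕ))
  push_cast at this ⊢
  rw [this]
  have hp' := mem_product.1 hp
  have h1 := hAB _ hp'.1 _ hp'.2
  have h2 := hv i hi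
  by_cases h : p.1 + p.2 = v i
  · rw [if_pos, if_pos h]
    · rw [← h]; push_cast; ring
    · rw [← h]; push_cast; simp
  · rw [if_neg, if_neg h]
    · ring
    · rintro ⟨z, hz⟩
      have hz0 : z ≠ 0 := by rintro rfl; omega
      have : (1 : ℤ) ≤ |z| := Int.one_le_abs hz0
      have h3 : |(v i : ℤ) - (p.1 + p.2)| = N * |z| := by rw [hz, abs_mul, Nat.abs_cast]
      have h4 : |(v i : ℤ) - (p.1 + p.2)| < N := by rw [abs_lt]; constructor <;> omega
      nlinarith

lemma ES_neg (A : Finset ℕ) (x : ℝ) : ‖ES A (-x)‖ = ‖ES A x‖ := by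
  rw [← RCLike.norm_conj, ES, map_sum, ES]
  congr 1
  refine sum_congr rfl fun n _ => ?_
  rw [ee_conj]; congr 1; ring

lemma cauchy_AB (N : ℕ) (hN : 0 < N) (A B : Finset ℕ) (hA : A ⊆ range N) (hB : B ⊆ range N)
    (F : ℝ → ℂ) (Y : ℝ) (hF : ∀ β, ‖F β‖ ≤ Y) :
    ‖∑ j ∈ range N, F (j / N) * (ES A (-(0 + j / N)) * ES B (-(0 + j / N)))‖ ≤
      N * (Y * √(#A * #B)) := by
  have hY : 0 ≤ Y := (norm_nonneg _).trans (hF 0)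
  have h1 : ∀ j ∈ range N, ‖F (j / N) * (ES A (-(0 + j / N)) * ES B (-(0 + j / N)))‖ ≤
      Y * (‖ES A (0 + j / N)‖ * ‖ES B (0 + j / N)‖) := by
    intro j _
    rw [norm_mul, norm_mul, ES_neg, ES_neg]
    gcongr; exact hF _
  refine (norm_sum_le _ _).trans ((sum_le_sum h1).trans ?_)
  rw [← mul_sum]
  have h2 := Real.sum_mul_le_sqrt_mul_sqrt (range N) (fun j : ℕ => ‖ES A (0 + j / N)‖)
    (fun j : ℕ => ‖ES B (0 + j / N)‖)
  rw [parseval N hN A hA, parseval N hN B hB, ← Real.sqrt_mul (by positivity)] at h2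
  have h3 : √((N : ℝ) * #A * (N * #B)) = N * √(#A * #B) := by
    rw [show (N : ℝ) * #A * (N * #B) = N ^ 2 * (#A * #B) by ring, Real.sqrt_mul (by positivity),
      Real.sqrt_sq (by positivity)]
  rw [h3] at h2
  nlinarith

lemma sqrt_aux (U x : ℝ) (hU : 0 ≤ U) : √(U ^ 2 * x) = U * √x := by
  rw [Real.sqrt_mul (by positivity), Real.sqrt_sq hU]

/-- one dyadic block -/
lemma block (h XA XB g i : ℕ) (hh : (2 * 2 ^ i * g) ^ 2 ≤ h)
    (A B : Finset ℕ) (hA : A ⊆ Ico XA (XA + h)) (hB : B ⊆ Ico XB (XB + h))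
    (cA : ∀ u ∈ UU (2 ^ i) g, ∃ t, ∀ n ∈ A, (n + t).Coprime u)
    (cB : ∀ u ∈ UU (2 ^ i) g, ∃ t, ∀ n ∈ B, (n + t).Coprime u) (β : ℝ) :
    Real.log g * ∑ s ∈ Ico (2 ^ i) (2 * 2 ^ i), ∑ b ∈ VV s, ‖ES A (β + b / s)‖ * ‖ES B (β + b / s)‖ ≤
      12 * Real.exp 4 * (i + 1) ^ 4 * (h * √(#A * #B)) := by
  have hU : ∀ u ∈ UU (2 ^ i) g, Squarefree u ∧ u ≤ g ∧ (∀ p, p.Prime → p ∣ u → 2 * 2 ^ i ≤ p) := by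
    intro u hu
    simp only [UU, mem_filter, mem_Icc] at hu
    exact ⟨hu.2.1, hu.1.2, hu.2.2⟩
  have hLA := ls_prime h XA g (2 ^ i) Nat.one_le_two_pow hh A hA (UU (2 ^ i) g)
    (fun u hu => ⟨(hU u hu).1, (hU u hu).2.1, (hU u hu).2.2, cA u hu⟩) β
  have hLB := ls_prime h XB g (2 ^ i) Nat.one_le_two_pow hh B hB (UU (2 ^ i) g)
    (fun u hu => ⟨(hU u hu).1, (hU u hu).2.1, (hU u hu).2.2, cB u hu⟩) β
  have hlog := log_le_UU' i g
  set U := ∑ u ∈ UU (2 ^ i) g, 1 / (u.totient : ℝ) with hUd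
  have hU0 : 0 ≤ U := sum_nonneg fun _ _ => by positivity
  set J := (Ico (2 ^ i) (2 * 2 ^ i)).sigma VV with hJ
  have e : ∀ F : ℕ → ℕ → ℝ, ∑ s ∈ Ico (2 ^ i) (2 * 2 ^ i), ∑ b ∈ VV s, F s b =
      ∑ x ∈ J, F x.1 x.2 := fun F => by rw [hJ, sum_sigma]
  rw [e] at hLA hLB ⊢
  have h2 := Real.sum_mul_le_sqrt_mul_sqrt J (fun x => ‖ES A (β + x.2 / x.1)‖)
    (fun x => ‖ES B (β + x.2 / x.1)‖)
  set SA := ∑ x ∈ J, ‖ES A (β + x.2 / x.1)‖ ^ 2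
  set SB := ∑ x ∈ J, ‖ES B (β + x.2 / x.1)‖ ^ 2
  have hSA : 0 ≤ SA := sum_nonneg fun _ _ => by positivity
  have hSB : 0 ≤ SB := sum_nonneg fun _ _ => by positivity
  have h3 : U * (√SA * √SB) ≤ 6 * h * √(#A * #B) := by
    rw [← Real.sqrt_mul hSA]
    have e1 : U * √(SA * SB) = √((U * SA) * (U * SB)) := by
      rw [show (U * SA) * (U * SB) = U ^ 2 * (SA * SB) by ring, sqrt_aux _ _ hU0]
    have e2 : 6 * h * √(#A * #B) = √((6 * h * #A : ℝ) * (6 * h * #B)) := by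
      rw [show (6 * h * #A : ℝ) * (6 * h * #B) = (6 * h) ^ 2 * (#A * #B) by ring,
        sqrt_aux _ _ (by positivity)]
    rw [e1, e2]
    apply Real.sqrt_le_sqrt
    gcongr
  have hs0 : 0 ≤ ∑ x ∈ J, ‖ES A (β + x.2 / x.1)‖ * ‖ES B (β + x.2 / x.1)‖ :=
    sum_nonneg fun _ _ => by positivity
  calc _ ≤ (2 * Real.exp 4 * (i + 1) ^ 4 * U) *
        ∑ x ∈ J, ‖ES A (β + x.2 / x.1)‖ * ‖ES B (β + x.2 / x.1)‖ := by gcongr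
    _ ≤ (2 * Real.exp 4 * (i + 1) ^ 4 * U) * (√SA * √SB) := by gcongr
    _ = 2 * Real.exp 4 * (i + 1) ^ 4 * (U * (√SA * √SB)) := by ring
    _ ≤ 2 * Real.exp 4 * (i + 1) ^ 4 * (6 * h * √(#A * #B)) := by gcongr
    _ = _ := by ring

lemma tail_small (C : ℕ) (hC : 1 ≤ C) (η : ℝ) (hη : 0 < η) : ∃ i0 : ℕ, 1 ≤ i0 ∧ ∀ I,
    ∑ i ∈ Ico i0 I, ((C : ℝ) / 2 ^ i) ^ (1 / C : ℝ) * (i + 1) ^ 4 ≤ η := by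
  set ρ : ℝ := (1 / 2 : ℝ) ^ (1 / C : ℝ) with hρ
  have hC' : (0 : ℝ) < C := by positivity
  have hρ0 : 0 < ρ := by positivity
  have hρ1 : ρ < 1 := Real.rpow_lt_one (by norm_num) (by norm_num) (by positivity)
  have hs : Summable fun i : ℕ => ((C : ℝ) / 2 ^ i) ^ (1 / C : ℝ) * (i + 1) ^ 4 := by
    have h1 : Summable fun i : ℕ => ((i : ℝ)) ^ 4 * ρ ^ i :=
      summable_pow_mul_geometric_of_norm_lt_one 4 (by rwa [Real.norm_of_nonneg hρ0.le])
    have h2 := (summable_nat_add_iff 1).2 h1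
    refine (h2.mul_left ((C : ℝ) ^ (1 / C : ℝ) / ρ)).congr fun i => ?_
    have : ((C : ℝ) / 2 ^ i) ^ (1 / C : ℝ) = (C : ℝ) ^ (1 / C : ℝ) * ρ ^ i := by
      rw [div_eq_mul_inv, Real.mul_rpow (by positivity) (by positivity), hρ,
        Real.rpow_pow_comm (by norm_num), ← inv_pow, one_div 2]
    rw [this]; push_cast; field_simp; ring
  obtain ⟨s, hs⟩ := summable_iff_vanishing_norm.1 hs η hη
  refine ⟨s.sup id + 1, by omega, fun I => ?_⟩
  refine (le_abs_self _).trans (hs _ ?_).le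
  rw [disjoint_left]
  intro i hi his
  have := le_sup (f := id) his
  rw [mem_Ico] at hi
  simp only [id] at this; omega

lemma Zbd (D : ℕ) (P : Polynomial ℕ) (hP : P.natDegree ≤ D) (C : ℕ) (hC : 1 ≤ C)
    (hGB : ∀ P : Polynomial ℕ, P.natDegree ≤ D → ∀ b s : ℕ, 0 < s → b.Coprime s →
      s.Coprime (P.coeff D) → (‖GS P b s‖ / s) ^ C ≤ C / s) (i0 : ℕ) (η : ℝ)
    (hη : ∀ I, ∑ i ∈ Ico i0 I, ((C : ℝ) / 2 ^ i) ^ (1 / C : ℝ) * (i + 1) ^ 4 ≤ η)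
    (hlc : ∀ s : ℕ, (∀ r, r.Prime → r ∣ s → 2 ^ i0 ≤ r) → s.Coprime (P.coeff D))
    (hGS : ∀ s b r : ℕ, r.Prime → r ∣ s → r < 2 ^ i0 → 0 < s → b ∈ VV s → GS P b s = 0)
    (h XA XB g S0 : ℕ) (hS0 : 1 ≤ S0) (hh : (2 * S0 * g) ^ 2 ≤ h)
    (A B : Finset ℕ) (hA : A ⊆ Ico XA (XA + h)) (hB : B ⊆ Ico XB (XB + h))
    (cA : ∀ i u, i0 ≤ i → u ∈ UU (2 ^ i) g → ∃ t, ∀ n ∈ A, (n + t).Coprime u)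
    (cB : ∀ i u, i0 ≤ i → u ∈ UU (2 ^ i) g → ∃ t, ∀ n ∈ B, (n + t).Coprime u) (β : ℝ) :
    Real.log g * ∑ s ∈ Icc 2 S0, ∑ b ∈ VV s,
      ‖GS P b s / s‖ * (‖ES A (β + b / s)‖ * ‖ES B (β + b / s)‖) ≤
      12 * Real.exp 4 * η * (h * √(#A * #B)) := by
  classical
  have hlog : 0 ≤ Real.log g := Real.log_natCast_nonneg g
  set F : ℕ → ℕ → ℝ := fun s b => ‖ES A (β + b / s)‖ * ‖ES B (β + b / s)‖ with hF
  have hF0 : ∀ s b, 0 ≤ F s b := fun s b => by simp only [hF]; positivity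
  have hCR : (0 : ℝ) < C := by positivity
  set I := Nat.log 2 S0 + 1 with hI
  have h1 : ∀ s ∈ Icc 2 S0, ∑ b ∈ VV s, ‖GS P b s / s‖ * F s b ≤
      ∑ i ∈ Ico i0 I, if s ∈ Ico (2 ^ i) (2 * 2 ^ i) then
        ((C : ℝ) / 2 ^ i) ^ (1 / C : ℝ) * ∑ b ∈ VV s, F s b else 0 := by
    intro s hs
    have hs := mem_Icc.1 hs
    have hnn : ∀ i ∈ Ico i0 I, 0 ≤ (if s ∈ Ico (2 ^ i) (2 * 2 ^ i) then
        ((C : ℝ) / 2 ^ i) ^ (1 / C : ℝ) * ∑ b ∈ VV s, F s b else 0) := by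
      intro i _
      split_ifs
      · exact mul_nonneg (by positivity) (sum_nonneg fun _ _ => hF0 _ _)
      · exact le_rfl
    by_cases hr : ∃ r, r.Prime ∧ r ∣ s ∧ r < 2 ^ i0
    · obtain ⟨r, hr1, hr2, hr3⟩ := hr
      rw [sum_eq_zero]
      · exact sum_nonneg hnn
      · intro b hb
        rw [hGS s b r hr1 hr2 hr3 (by omega) hb]; simp
    · push Not at hr
      obtain ⟨r, hr1, hr2⟩ := Nat.exists_prime_and_dvd (by omega : s ≠ 1)
      have hsi : 2 ^ i0 ≤ s := (hr r hr1 hr2).trans (Nat.le_of_dvd (by omega) hr2)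
      have hi1 : i0 ≤ Nat.log 2 s := Nat.le_log_of_pow_le (by norm_num) hsi
      have hi2 : Nat.log 2 s < I := Nat.lt_succ_of_le (Nat.log_mono_right hs.2)
      have hi3 : 2 ^ Nat.log 2 s ≤ s := Nat.pow_log_le_self 2 (by omega)
      have hi4 : s < 2 * 2 ^ Nat.log 2 s := by
        have := Nat.lt_pow_succ_log_self (b := 2) (by norm_num) s
        rw [pow_succ] at this; omega
      refine le_trans ?_ (single_le_sum hnn (mem_Ico.2 ⟨hi1, hi2⟩))
      rw [if_pos (mem_Ico.2 ⟨hi3, hi4⟩), mul_sum]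
      refine sum_le_sum fun b hb => ?_
      refine mul_le_mul_of_nonneg_right ?_ (hF0 _ _)
      have hb' := (mem_filter.1 hb).2
      have g1 := hGB P hP b s (by omega) hb'.symm (hlc s hr)
      have g2 : ‖GS P b s / s‖ = ‖GS P b s‖ / s := by rw [norm_div, Complex.norm_natCast]
      rw [g2]
      have g3 : ‖GS P b s‖ / s = ((‖GS P b s‖ / s) ^ C) ^ (1 / C : ℝ) := by
        rw [one_div, Real.pow_rpow_inv_natCast (by positivity) (by omega)]
      rw [g3]
      gcongr
      refine g1.trans ?_
      gcongr
      exact_mod_cast hi3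
  have h2 : ∑ s ∈ Icc 2 S0, ∑ b ∈ VV s, ‖GS P b s / s‖ * F s b ≤
      ∑ i ∈ Ico i0 I, ((C : ℝ) / 2 ^ i) ^ (1 / C : ℝ) *
        ∑ s ∈ Ico (2 ^ i) (2 * 2 ^ i), ∑ b ∈ VV s, F s b := by
    refine (sum_le_sum h1).trans ?_
    rw [sum_comm]
    refine sum_le_sum fun i _ => ?_
    rw [← sum_filter, ← mul_sum]
    gcongr
    exact fun s hs => (mem_filter.1 hs).2
  refine (mul_le_mul_of_nonneg_left h2 hlog).trans ?_
  rw [mul_sum]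
  have h3 : ∀ i ∈ Ico i0 I, Real.log g * (((C : ℝ) / 2 ^ i) ^ (1 / C : ℝ) *
        ∑ s ∈ Ico (2 ^ i) (2 * 2 ^ i), ∑ b ∈ VV s, F s b) ≤
      (12 * Real.exp 4 * (h * √(#A * #B))) * (((C : ℝ) / 2 ^ i) ^ (1 / C : ℝ) * (i + 1) ^ 4) := by
    intro i hi
    have hi := mem_Ico.1 hi
    have hb := block h XA XB g i ?_ A B hA hB (fun u => cA i u hi.1) (fun u => cB i u hi.1) β
    · have := mul_le_mul_of_nonneg_left hb (by positivity : 0 ≤ ((C : ℝ) / 2 ^ i) ^ (1 / C : ℝ))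
      simp only [hF]
      linarith
    · refine le_trans ?_ hh
      have : 2 ^ i ≤ S0 := by
        exact (Nat.pow_le_pow_right (by norm_num) (by omega : i ≤ Nat.log 2 S0)).trans
            (Nat.pow_log_le_self 2 (by omega))
      gcongr
  refine (sum_le_sum h3).trans ?_
  rw [← mul_sum]
  have := mul_le_mul_of_nonneg_left (hη I) (by positivity : 0 ≤ 12 * Real.exp 4 * (h * √(#A * #B)))
  linarith

end

section
open Finset

lemma GS_one (P : Polynomial ℕ) : GS P 0 1 = 1 := by simp [GS, ee_zero]

lemma VV_one : VV 1 = {0} := by ext; simp [VV]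

lemma circ (P : Polynomial ℕ) (M h XA XB S0 : ℕ) (hS0 : 1 ≤ S0)
    (A B : Finset ℕ) (hA : A ⊆ Ico XA (XA + h)) (hB : B ⊆ Ico XB (XB + h))
    (hX : h ≤ XA + XB) (hX2 : XA + XB + 3 * h ≤ P.eval M) (Y Z : ℝ)
    (hY : ∀ α, ‖∑ m ∈ range M, fz P (2 * h) (XA + XB + h) α m - ∑ s ∈ Icc 1 S0, ∑ b ∈ VV s,
        GS P b s / s * wh (2 * h) (XA + XB + h) (α - b / s)‖ ≤ Y)
    (hZ : ∀ β : ℝ, ∑ s ∈ Icc 2 S0, ∑ b ∈ VV s,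
      ‖GS P b s / s‖ * (‖ES A (β + b / s)‖ * ‖ES B (β + b / s)‖) ≤ Z) :
    (h : ℝ) * (#A * #B) ≤ dl P M * (2 * h) * ∑ m ∈ range M, (rr A B (P.eval m) : ℝ) +
      Y * √(#A * #B) + 2 * h * Z := by
  set T0 := XA + XB + h with hT0
  set L := 2 * h with hL
  set N := P.eval M + 1 with hN
  have hN0 : 0 < N := Nat.succ_pos _
  have hNR : (0 : ℝ) < N := by exact_mod_cast hN0
  have hAB : ∀ a ∈ A, ∀ b ∈ B, a + b < N := by
    intro a ha b hb
    have := mem_Ico.1 (hA ha); have := mem_Ico.1 (hB hb); omega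
  have hA' : A ⊆ range N := fun a ha => by
    have := mem_Ico.1 (hA ha); rw [mem_range]; omega
  have hB' : B ⊆ range N := fun a ha => by
    have := mem_Ico.1 (hB ha); rw [mem_range]; omega
  set E : ℕ → ℂ := fun j => ES A (-(0 + j / N)) * ES B (-(0 + j / N)) with hE
  set Φ : ℝ := ∑ m ∈ range M, (dl P m * wt L T0 (P.eval m) : ℝ) * rr A B (P.eval m) with hΦ
  set W : ℝ := ∑ t ∈ range N, (wt L T0 t : ℝ) * rr A B t with hW
  have e1 : ∑ j ∈ range N, (∑ m ∈ range M, fz P L T0 (j / N) m) * E j = ((N * Φ : ℝ) : ℂ) := by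
    have := four N hN0 (range M) (fun m => ((dl P m * wt L T0 (P.eval m) : ℝ) : ℂ))
      (fun m => P.eval m) (fun m hm => Nat.lt_succ_of_le (pe_mono P (mem_range.1 hm).le)) A B hAB 0
    rw [hΦ]; push_cast at this ⊢
    simp only [zero_mul, neg_zero, ee_zero, mul_one] at this
    rw [← this]
    refine sum_congr rfl fun j _ => ?_
    congr 1
    refine sum_congr rfl fun m _ => ?_
    unfold fz
    rw [mul_comm (j / N : ℝ)]; push_cast; rfl
  have hwh : ∀ β, wh L T0 β = ∑ t ∈ range N, (wt L T0 t : ℂ) * ee (t * β) := fun β =>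
    (wh_eq L T0 N (by omega) (by omega) β).symm
  have e2 : ∀ γ : ℝ, ∑ j ∈ range N, wh L T0 (j / N - γ) * E j =
      N * ∑ t ∈ range N, (wt L T0 t : ℂ) * ee (-(γ * t)) * rr A B t := by
    intro γ
    have := four N hN0 (range N) (fun t => (wt L T0 t : ℂ) * ee (-(γ * t))) id
      (fun m hm => mem_range.1 hm) A B hAB 0
    simp only [zero_mul, neg_zero, ee_zero, mul_one, id] at this
    rw [← this]
    refine sum_congr rfl fun j _ => ?_
    rw [hwh]
    congr 1
    refine sum_congr rfl fun t _ => ?_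
    rw [mul_assoc, ← ee_add]; congr 2; ring
  have e3 : ∀ γ : ℝ, ∑ j ∈ range N, wh L T0 (j / N) * (ES A (-(γ + j / N)) * ES B (-(γ + j / N))) =
      N * ∑ t ∈ range N, (wt L T0 t : ℂ) * ee (-(γ * t)) * rr A B t := by
    intro γ
    have := four N hN0 (range N) (fun t => (wt L T0 t : ℂ)) id
      (fun m hm => mem_range.1 hm) A B hAB γ
    simp only [id] at this
    rw [← this]
    exact sum_congr rfl fun j _ => by rw [hwh]
  set R : ℂ := ∑ s ∈ Icc 2 S0, ∑ b ∈ VV s, GS P b s / s * ∑ j ∈ range N,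
    wh L T0 (j / N) * (ES A (-(b / s + j / N)) * ES B (-(b / s + j / N))) with hR
  have e4 : ∑ j ∈ range N, (∑ s ∈ Icc 1 S0, ∑ b ∈ VV s,
      GS P b s / s * wh L T0 ((j : ℝ) / N - b / s)) * E j = ((N * W : ℝ) : ℂ) + R := by
    have : ∀ j ∈ range N, (∑ s ∈ Icc 1 S0, ∑ b ∈ VV s,
      GS P b s / s * wh L T0 ((j : ℝ) / N - b / s)) * E j = ∑ s ∈ Icc 1 S0, ∑ b ∈ VV s,
      GS P b s / s * (wh L T0 ((j : ℝ) / N - b / s) * E j) := by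
      intro j _
      rw [sum_mul]
      refine sum_congr rfl fun s _ => ?_
      rw [sum_mul]
      exact sum_congr rfl fun b _ => by ring
    rw [sum_congr rfl this, sum_comm]
    have h1 : ∀ s ∈ Icc 1 S0, ∑ j ∈ range N, ∑ b ∈ VV s,
        GS P b s / s * (wh L T0 ((j : ℝ) / N - b / s) * E j) = ∑ b ∈ VV s, GS P b s / s *
          (N * ∑ t ∈ range N, (wt L T0 t : ℂ) * ee (-((b : ℝ) / s * t)) * rr A B t) := by
      intro s _
      rw [sum_comm]
      refine sum_congr rfl fun b _ => ?_
      rw [← mul_sum, e2]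
    rw [sum_congr rfl h1]
    have h2 : Icc 1 S0 = insert 1 (Icc 2 S0) := by
      ext x; simp only [mem_Icc, mem_insert]; omega
    rw [h2, sum_insert (by simp), VV_one, sum_singleton, GS_one]
    congr 1
    · rw [hW]; push_cast; simp [ee_zero]
    · rw [hR]
      refine sum_congr rfl fun s _ => sum_congr rfl fun b _ => ?_
      rw [e3]
  have e5 : ∑ j ∈ range N, (∑ m ∈ range M, fz P L T0 (j / N) m - ∑ s ∈ Icc 1 S0, ∑ b ∈ VV s,
        GS P b s / s * wh L T0 ((j : ℝ) / N - b / s)) * E j =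
        ((N * Φ : ℝ) : ℂ) - (((N * W : ℝ) : ℂ) + R) := by
    rw [← e1, ← e4, ← sum_sub_distrib]
    exact sum_congr rfl fun j _ => by ring
  have b1 := cauchy_AB N hN0 A B hA' hB' (fun α => ∑ m ∈ range M, fz P L T0 α m -
    ∑ s ∈ Icc 1 S0, ∑ b ∈ VV s, GS P b s / s * wh L T0 (α - b / s)) Y hY
  rw [e5] at b1
  have b2 : ‖R‖ ≤ N * (L * Z) := by
    have c1 : ‖R‖ ≤ ∑ s ∈ Icc 2 S0, ∑ b ∈ VV s, ∑ j ∈ range N, ‖wh L T0 (j / N)‖ *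
        (‖GS P b s / s‖ * (‖ES A ((j : ℝ) / N + b / s)‖ * ‖ES B ((j : ℝ) / N + b / s)‖)) := by
      rw [hR]
      refine (norm_sum_le _ _).trans (sum_le_sum fun s _ => ?_)
      refine (norm_sum_le _ _).trans (sum_le_sum fun b _ => ?_)
      rw [mul_sum]
      refine (norm_sum_le _ _).trans (sum_le_sum fun j _ => le_of_eq ?_)
      rw [norm_mul, norm_mul, norm_mul, ES_neg, ES_neg, add_comm ((b : ℝ) / s)]; ring
    have c2 : ∑ s ∈ Icc 2 S0, ∑ b ∈ VV s, ∑ j ∈ range N, ‖wh L T0 (j / N)‖ *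
        (‖GS P b s / s‖ * (‖ES A ((j : ℝ) / N + b / s)‖ * ‖ES B ((j : ℝ) / N + b / s)‖)) =
        ∑ j ∈ range N, ‖wh L T0 (j / N)‖ * ∑ s ∈ Icc 2 S0, ∑ b ∈ VV s,
        (‖GS P b s / s‖ * (‖ES A ((j : ℝ) / N + b / s)‖ * ‖ES B ((j : ℝ) / N + b / s)‖)) := by
      simp_rw [mul_sum]
      rw [sum_comm (s := range N)]
      exact sum_congr rfl fun s _ => sum_comm
    rw [c2] at c1
    refine c1.trans ((sum_le_sum fun j _ => mul_le_mul_of_nonneg_left (hZ _) (norm_nonneg _)).trans ?_)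
    rw [← sum_mul, wh_l1 N L T0 hN0 (by omega), mul_assoc]
  have b3 : (N : ℝ) * W ≤ N * Φ + N * (Y * √(#A * #B)) + N * (L * Z) := by
    have t1 : ((N * W : ℝ) : ℂ) = ((N * Φ : ℝ) : ℂ) - (((N * Φ : ℝ) : ℂ) - (((N * W : ℝ) : ℂ) + R)) - R := by
      ring
    have hW0 : 0 ≤ W := sum_nonneg fun _ _ => by positivity
    have hΦ0 : 0 ≤ Φ := sum_nonneg fun _ _ => by positivity
    have t2 := congrArg norm t1
    rw [Complex.norm_real, Real.norm_of_nonneg (by positivity)] at t2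
    rw [t2]
    refine (norm_sub_le _ _).trans (add_le_add ((norm_sub_le _ _).trans (add_le_add ?_ b1)) b2)
    rw [Complex.norm_real, Real.norm_of_nonneg (by positivity)]
  have b4 : W ≤ Φ + Y * √(#A * #B) + L * Z := by
    rw [← mul_add, ← mul_add] at b3
    exact le_of_mul_le_mul_left b3 hNR
  have b5 : (h : ℝ) * (#A * #B) ≤ W := by
    have t1 : ∀ t ∈ range N, (h : ℝ) * rr A B t ≤ wt L T0 t * rr A B t := by
      intro t _
      rcases Nat.eq_zero_or_pos (rr A B t) with h0 | h0
      · rw [h0]; simp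
      · obtain ⟨p, hp⟩ := card_pos.1 h0
        obtain ⟨hp1, hp2⟩ := mem_filter.1 hp
        have hp3 := mem_product.1 hp1
        have := mem_Ico.1 (hA hp3.1); have := mem_Ico.1 (hB hp3.2)
        gcongr
        unfold wt; omega
    refine le_trans (le_of_eq ?_) (sum_le_sum t1)
    rw [← mul_sum]; congr 1
    rw [← Nat.cast_sum, ← Nat.cast_mul, ← card_product]
    congr 1
    unfold rr
    rw [card_eq_sum_card_fiberwise (f := fun p => p.1 + p.2) (t := range N)]
    intro p hp
    have hp3 := mem_product.1 (mem_coe.1 hp)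
    exact mem_coe.2 (mem_range.2 (hAB _ hp3.1 _ hp3.2))
  have b6 : Φ ≤ dl P M * (2 * h) * ∑ m ∈ range M, (rr A B (P.eval m) : ℝ) := by
    rw [hΦ, mul_sum]
    refine sum_le_sum fun m hm => ?_
    have t1 : (wt L T0 (P.eval m) : ℝ) ≤ 2 * h := by exact_mod_cast wt_le L T0 _
    have t2 : dl P m ≤ dl P M := dl_mono P (mem_range.1 hm).le
    gcongr
  have : (L : ℝ) = 2 * h := by rw [hL]; push_cast; rfl
  rw [this] at b4
  linarith

end

section
open Finset

lemma log_pow_ev (n : ℕ) (K : ℝ) : ∃ g0 : ℕ, 3 ≤ g0 ∧ ∀ g : ℕ, g0 ≤ g → K * Real.log g ^ n ≤ g := by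
  have h := (Real.isLittleO_pow_log_id_atTop (n := n)).def (show (0 : ℝ) < 1 / (|K| + 1) by positivity)
  have h2 := tendsto_natCast_atTop_atTop (R := ℝ) |>.eventually h
  obtain ⟨g0, hg0⟩ := Filter.eventually_atTop.1 h2
  refine ⟨max g0 3, le_max_right _ _, fun g hg => ?_⟩
  have h3 := hg0 g ((le_max_left _ _).trans hg)
  have hl : 0 ≤ Real.log g := Real.log_natCast_nonneg g
  simp only [id] at h3
  rw [Real.norm_of_nonneg (by positivity), Real.norm_of_nonneg (by positivity), one_div,
    inv_mul_eq_div, le_div_iff₀ (by positivity)] at h3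
  have h4 : K * Real.log g ^ n ≤ (|K| + 1) * Real.log g ^ n := by
    gcongr; linarith [le_abs_self K]
  linarith

theorem circle (D : ℕ) (hD : 4 ≤ D) : ∃ i0 : ℕ, 2 ≤ i0 ∧ ∀ P : Polynomial ℕ, P.natDegree ≤ D →
    P.eval 0 = 0 → 1 ≤ P.coeff D →
    (∀ s : ℕ, (∀ r, r.Prime → r ∣ s → 2 ^ i0 ≤ r) → s.Coprime (P.coeff D)) →
    (∀ s b r : ℕ, r.Prime → r ∣ s → r < 2 ^ i0 → 0 < s → b ∈ VV s → GS P b s = 0) →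
    ∀ k : ℕ, 1 ≤ k → ∃ c : ℝ, 0 < c ∧ ∃ g0 : ℕ, ∀ g : ℕ, g0 ≤ g → ∀ (XA XB : ℕ) (A B : Finset ℕ),
    A ⊆ Ico XA (XA + g ^ D) → B ⊆ Ico XB (XB + g ^ D) → g ^ D ≤ XA + XB →
    XA + XB + 3 * g ^ D ≤ P.eval (k * g) →
    ((g ^ D : ℕ) : ℝ) / (8 * Real.log (g ^ D : ℕ)) ≤ #A →
    ((g ^ D : ℕ) : ℝ) / (8 * Real.log (g ^ D : ℕ)) ≤ #B →
    (∀ u, 1 ≤ u → u ≤ g → Squarefree u → (∀ p, p.Prime → p ∣ u → 2 ^ i0 ≤ p) → ∃ t, ∀ n ∈ A, (n + t).Coprime u) →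
    (∀ u, 1 ≤ u → u ≤ g → Squarefree u → (∀ p, p.Prime → p ∣ u → 2 ^ i0 ≤ p) → ∃ t, ∀ n ∈ B, (n + t).Coprime u) →
    c * (g : ℝ) ^ (D + 1) / Real.log g ^ 2 ≤ ∑ m ∈ range (k * g), (rr A B (P.eval m) : ℝ) := by
  obtain ⟨Cg, hCg, hGB⟩ := GS_bound D (by omega)
  have hDR : (0 : ℝ) < D := by positivity
  obtain ⟨i1, hi1, hη1⟩ := tail_small Cg hCg (1 / (768 * Real.exp 4 * D)) (by positivity)
  obtain ⟨i0, hi0, hη⟩ : ∃ i0 : ℕ, 2 ≤ i0 ∧ ∀ I, ∑ i ∈ Ico i0 I, ((Cg : ℝ) / 2 ^ i) ^ (1 / Cg : ℝ) *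
      (i + 1) ^ 4 ≤ 1 / (768 * Real.exp 4 * D) :=
    ⟨i1 + 2, by omega, fun I => (sum_le_sum_of_subset_of_nonneg (Ico_subset_Ico_left (by omega))
      fun _ _ _ => by positivity).trans (hη1 I)⟩
  refine ⟨i0, hi0, fun P hP h0 hlc1 hlc hGS k hk => ?_⟩
  obtain ⟨C, hC, hkey⟩ := keyM P D (by omega) hP hlc1 h0 k hk
  obtain ⟨la, hla, hbd⟩ := poly_bds P D hP k hk
  have hCR : (1 : ℝ) ≤ C := by exact_mod_cast hC
  have hlaR : (1 : ℝ) ≤ la := by exact_mod_cast hla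
  obtain ⟨g0, hg03, hg0⟩ := log_pow_ev (C * 6 + 1) ((2 * C) ^ 6 * (32 * D * C) ^ (C * 6 + 1))
  refine ⟨1 / (256 * la * D ^ 2), by positivity, g0, ?_⟩
  intro g hg XA XB A B hA hB hX hX2 hcA hcB cA cB
  have hg3 : 3 ≤ g := hg03.trans hg
  set l := Real.log g with hl
  have hl1 : 1 ≤ l := by
    rw [hl, Real.le_log_iff_exp_le (by positivity)]
    have : (3 : ℝ) ≤ g := by exact_mod_cast hg3
    linarith [Real.exp_one_lt_d9]
  set y : ℝ := 32 * D * C * l with hy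
  have hD1 : (1 : ℝ) ≤ D := by exact_mod_cast (by omega : 1 ≤ D)
  have hy32 : 32 ≤ y := by
    have : 1 ≤ D * C * l := one_le_mul_of_one_le_of_one_le (one_le_mul_of_one_le_of_one_le hD1 hCR) hl1
    rw [hy]; linarith
  have hy1 : 1 ≤ y := by linarith
  set S0 := ⌈(C : ℝ) * y ^ C⌉₊ with hS0
  have hS0a : C * y ^ C ≤ S0 := Nat.le_ceil _
  have hyC : y ≤ y ^ C := le_self_pow₀ hy1 (by omega)
  have hCy : y ≤ C * y ^ C := hyC.trans (le_mul_of_one_le_left (by positivity) hCR)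
  have hS0b : (S0 : ℝ) ≤ 2 * C * y ^ C := by
    have := Nat.ceil_lt_add_one (a := (C : ℝ) * y ^ C) (by positivity)
    linarith
  have hS02 : (2 : ℝ) ≤ S0 := by linarith
  have hS02' : 2 ≤ S0 := by exact_mod_cast hS02
  have hSg : (S0 : ℝ) ^ 6 * y ≤ g := by
    calc (S0 : ℝ) ^ 6 * y ≤ (2 * C * y ^ C) ^ 6 * y := by gcongr
      _ = (2 * C) ^ 6 * y ^ (C * 6 + 1) := by rw [mul_pow, ← pow_mul, pow_succ]; ring
      _ = (2 * C) ^ 6 * (32 * D * C) ^ (C * 6 + 1) * l ^ (C * 6 + 1) := by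
        rw [hy, mul_pow]; ring
      _ ≤ g := hg0 g hg
  have hSg2 : 2 * S0 ≤ g := by
    have h1 : (S0 : ℝ) ^ 6 ≤ S0 ^ 6 * y := le_mul_of_one_le_right (by positivity) hy1
    have h2 : S0 ^ 6 ≤ g := by exact_mod_cast h1.trans hSg
    have h3 : S0 ^ 2 ≤ S0 ^ 6 := Nat.pow_le_pow_right (by omega) (by norm_num)
    nlinarith
  have hh : (2 * S0 * g) ^ 2 ≤ g ^ D := by
    calc (2 * S0 * g) ^ 2 ≤ (g * g) ^ 2 := by gcongr
      _ = g ^ 4 := by ring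
      _ ≤ g ^ D := Nat.pow_le_pow_right (by omega) hD
  have huu : ∀ i u, i0 ≤ i → u ∈ UU (2 ^ i) g → (1 ≤ u ∧ u ≤ g) ∧ Squarefree u ∧ ∀ p, p.Prime → p ∣ u → 2 ^ i0 ≤ p := by
    intro i u hi hu
    simp only [UU, mem_filter, mem_Icc] at hu
    refine ⟨hu.1, hu.2.1, fun p hp hpu => ?_⟩
    have h1 := hu.2.2 p hp hpu
    have h2 : 2 ^ i0 ≤ 2 ^ i := Nat.pow_le_pow_right (by norm_num) hi
    omega
  have hZ := Zbd D P hP Cg hCg hGB i0 _ hη hlc hGS (g ^ D) XA XB g S0 (by omega) hh A B hA hB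
    (fun i u hi hu => cA u (huu i u hi hu).1.1 (huu i u hi hu).1.2 (huu i u hi hu).2.1 (huu i u hi hu).2.2)
    (fun i u hi hu => cB u (huu i u hi hu).1.1 (huu i u hi hu).1.2 (huu i u hi hu).2.1 (huu i u hi hu).2.2)
  have hY := hkey g S0 (XA + XB + g ^ D) y hy1 hS0a hSg (by omega) (by omega)
  set a := √((#A : ℝ) * #B) with ha
  have ha0 : 0 ≤ a := Real.sqrt_nonneg _
  have hc := circ P (k * g) (g ^ D) XA XB S0 (by omega) A B hA hB hX hX2 _
    (12 * Real.exp 4 * (1 / (768 * Real.exp 4 * D)) * (((g ^ D : ℕ) : ℝ) * a) / l) hY (fun β => by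
      rw [le_div_iff₀ (by linarith), mul_comm]; exact hZ β)
  obtain ⟨-, hb2⟩ := hbd g (by omega)
  set T : ℝ := ∑ m ∈ range (k * g), (rr A B (P.eval m) : ℝ) with hT
  have hT0 : 0 ≤ T := sum_nonneg fun _ _ => by positivity
  have hhc : ((g ^ D : ℕ) : ℝ) = (g : ℝ) ^ D := by push_cast; rfl
  have hb2' : (g : ℝ) * dl P (k * g) ≤ la * (g : ℝ) ^ D := by exact_mod_cast hb2
  have hgR : (0 : ℝ) < g := by positivity
  rw [hhc] at hc hcA hcB
  rw [Real.log_pow, ← hl] at hcA hcB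
  set h : ℝ := (g : ℝ) ^ D with hhd
  have hh0 : 0 < h := by positivity
  have hl0 : 0 < l := by linarith
  have haa : a ^ 2 = #A * #B := Real.sq_sqrt (by positivity)
  set a1 := h / (8 * (D * l)) with ha1
  have ha10 : 0 < a1 := by positivity
  have ha1a : a1 ≤ a := by
    apply Real.le_sqrt_of_sq_le
    rw [sq]; exact mul_le_mul hcA hcB ha10.le (by positivity)
  have hha : h = 8 * D * l * a1 := by rw [ha1]; field_simp
  have t1 : C * h ^ 2 / y * a = h * (a1 * a) / 4 := by
    rw [hy, ha1]; field_simp; ring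
  have t2 : 2 * h * (12 * Real.exp 4 * (1 / (768 * Real.exp 4 * D)) * (h * a) / l) =
      h * (a1 * a) / 4 := by
    have hE := (Real.exp_pos 4).ne'
    rw [ha1]
    generalize Real.exp 4 = E at hE ⊢
    have : 12 * E * (1 / (768 * E * D)) = 1 / (64 * D : ℝ) := by field_simp; norm_num
    rw [this]; field_simp; ring
  rw [t1, t2, ← haa] at hc
  have t3 : h * (a1 * a) ≤ h * a ^ 2 := by
    rw [sq]; exact mul_le_mul_of_nonneg_left (mul_le_mul_of_nonneg_right ha1a ha0) hh0.le
  have t4 : h * a ^ 2 / 2 ≤ dl P (k * g) * (2 * h) * T := by linarith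
  have t5 : a1 ^ 2 ≤ 4 * dl P (k * g) * T := by
    have : a1 ^ 2 ≤ a ^ 2 := by gcongr
    have t6 : h * a ^ 2 ≤ h * (4 * dl P (k * g) * T) := by linarith
    exact this.trans (le_of_mul_le_mul_left t6 hh0)
  have t7 : g * a1 ^ 2 ≤ 4 * (la * h) * T := by
    calc g * a1 ^ 2 ≤ g * (4 * dl P (k * g) * T) := by gcongr
      _ = 4 * (g * dl P (k * g)) * T := by ring
      _ ≤ _ := by gcongr
  have t8 : 1 / (256 * la * D ^ 2) * (g : ℝ) ^ (D + 1) / l ^ 2 = g * a1 ^ 2 / (4 * (la * h)) := by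
    rw [ha1, pow_succ (g : ℝ) D, ← hhd]; field_simp; ring
  rw [t8, div_le_iff₀ (by positivity)]
  linarith

end

section
open Finset

noncomputable def TQ (E W : ℕ) : Polynomial ℕ :=
  ∑ j ∈ range (E + 1), Polynomial.C ((E + 2).choose (j + 2) * W ^ j) * Polynomial.X ^ (j + 2)

noncomputable def QQ (E V W : ℕ) : Polynomial ℕ := Polynomial.X + Polynomial.C V * TQ E W

lemma TQ_eval (E W m : ℕ) :
    (TQ E W).eval m = ∑ j ∈ range (E + 1), (E + 2).choose (j + 2) * W ^ j * m ^ (j + 2) := by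
  simp [TQ, Polynomial.eval_finsetSum]

lemma QQ_eval (E V W m : ℕ) : (QQ E V W).eval m = m + V * (TQ E W).eval m := by
  simp [QQ]

lemma QQ_id (E V D : ℕ) (hD : D = E + 2) (m : ℕ) : 1 + D * (D * V) * (QQ E V (D * V)).eval m =
    (1 + D * V * m) ^ D := by
  have this : ∀ j ∈ range (E + 1), D * (D * V) * (V * (D.choose (j + 2) *
      (D * V) ^ j * m ^ (j + 2))) = (D * V * m) ^ (j + 1 + 1) * (D.choose (j + 1 + 1)) := by
    intro j _
    rw [mul_pow _ m]; ring
  have h2 : D * (D * V) * (V * (TQ E (D * V)).eval m) =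
      ∑ j ∈ range (E + 1), (D * V * m) ^ (j + 1 + 1) * (D.choose (j + 1 + 1)) := by
    rw [TQ_eval, ← hD, mul_sum, mul_sum]; exact sum_congr rfl this
  rw [add_comm 1 (D * V * m), add_pow, QQ_eval, mul_add, h2, hD, sum_range_succ' _ (E + 2),
    sum_range_succ' _ (E + 1)]
  simp only [one_pow, mul_one, zero_add, pow_one, pow_zero, Nat.choose_one_right,
    Nat.choose_zero_right, Nat.cast_id]
  ring

lemma QQ_deg (E V W : ℕ) : (QQ E V W).natDegree ≤ E + 2 := by
  unfold QQ
  refine (Polynomial.natDegree_add_le _ _).trans (max_le (Polynomial.natDegree_X_le.trans (by omega)) ?_)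
  refine (Polynomial.natDegree_C_mul_le _ _).trans (Polynomial.natDegree_sum_le_of_forall_le _ _ ?_)
  intro j hj
  refine (Polynomial.natDegree_C_mul_X_pow_le _ _).trans ?_
  have := mem_range.1 hj; omega

lemma QQ_coeff (E V W : ℕ) : (QQ E V W).coeff (E + 2) = V * W ^ E := by
  unfold QQ TQ
  rw [Polynomial.coeff_add, Polynomial.coeff_X_of_ne_one (by omega), Polynomial.coeff_C_mul,
    Polynomial.finsetSum_coeff, sum_eq_single E]
  · rw [Polynomial.coeff_C_mul, Polynomial.coeff_X_pow]; simp
  · intro j hj hne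
    rw [Polynomial.coeff_C_mul, Polynomial.coeff_X_pow, if_neg (by omega), mul_zero]
  · intro h; exact absurd (mem_range.2 (by omega)) h

lemma QQ_zero (E V W : ℕ) : (QQ E V W).eval 0 = 0 := by
  rw [QQ_eval, TQ_eval]; simp

lemma QQ_ge (E V W m : ℕ) (hV : 1 ≤ V) (hW : 1 ≤ W) : m ^ (E + 2) ≤ (QQ E V W).eval m := by
  rw [QQ_eval, TQ_eval]
  have h1 := single_le_sum (f := fun j => (E + 2).choose (j + 2) * W ^ j * m ^ (j + 2))
    (fun i _ => Nat.zero_le _) (show E ∈ range (E + 1) by simp)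
  simp only [Nat.choose_self, one_mul] at h1
  calc m ^ (E + 2) ≤ W ^ E * m ^ (E + 2) := Nat.le_mul_of_pos_left _ (by positivity)
    _ ≤ _ := h1
    _ ≤ V * _ := Nat.le_mul_of_pos_left _ hV
    _ ≤ _ := Nat.le_add_left _ _

lemma QQ_strict (E V W : ℕ) : StrictMono fun m => (QQ E V W).eval m := by
  intro m n h
  simp only [QQ_eval, TQ_eval]
  apply add_lt_add_of_lt_of_le h
  gcongr

lemma sum_shift (f : ℕ → ℂ) (s : ℕ) (hf : ∀ x, f (x + s) = f x) (t : ℕ) :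
    ∑ x ∈ range s, f (x + t) = ∑ x ∈ range s, f x := by
  induction t with
  | zero => rfl
  | succ t ih =>
    rw [← ih]
    have h1 := sum_range_succ (fun x => f (x + t)) s
    have h2 := sum_range_succ' (fun x => f (x + t)) s
    rw [h1, zero_add, add_comm s t, hf] at h2
    have h3 := add_right_cancel h2
    rw [h3]; refine sum_congr rfl fun x _ => by congr 1; ring

lemma GS_QQ (E V W s b r : ℕ) (hr : r.Prime) (hrs : r ∣ s) (hrV : r ∣ V) (hs : 0 < s)
    (hb : b ∈ VV s) : GS (QQ E V W) b s = 0 := by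
  obtain ⟨s1, rfl⟩ := hrs
  have hr0 := hr.pos
  have hs1 : 0 < s1 := Nat.pos_of_mul_pos_left hs
  have hcop : (r * s1).Coprime b := (mem_filter.1 hb).2
  have hmod : ∀ x, (QQ E V W).eval (x + s1) ≡ (QQ E V W).eval x + s1 [MOD r * s1] := by
    intro x
    rw [QQ_eval, QQ_eval]
    have h1 : (TQ E W).eval (x + s1) ≡ (TQ E W).eval x [MOD s1] :=
      pe_modEq _ (by simp [Nat.ModEq])
    have h2 := (Nat.ModEq.mul_left' V h1).of_dvd (Nat.mul_dvd_mul_right hrV s1)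
    have h3 := Nat.ModEq.add_left (x + s1) h2
    refine h3.trans ?_
    rw [show x + s1 + V * (TQ E W).eval x = x + V * (TQ E W).eval x + s1 by ring]
  set f : ℕ → ℂ := fun x => ee ((b : ℝ) / (r * s1 : ℕ) * ((QQ E V W).eval x : ℕ)) with hf
  have hGS : GS (QQ E V W) b (r * s1) = ∑ x ∈ range (r * s1), f x := rfl
  have hper : ∀ x, f (x + r * s1) = f x := fun x =>
    ee_frac hs b (pe_modEq _ (by simp [Nat.ModEq]))
  have hsh : ∀ x, f (x + s1) = ee ((b : ℝ) / r) * f x := by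
    intro x
    simp only [hf]
    rw [ee_frac hs b (hmod x), ← ee_add]
    congr 1
    have : (s1 : ℝ) ≠ 0 := by positivity
    have : (r : ℝ) ≠ 0 := by positivity
    push_cast; field_simp; ring
  have h1 := sum_shift f (r * s1) hper s1
  simp only [hsh] at h1
  rw [← mul_sum, ← hGS] at h1
  have h2 : ee ((b : ℝ) / r) - 1 ≠ 0 := by
    intro h
    have h3 := ee_sub_one_ge ((b : ℝ) / r)
    rw [h, norm_zero] at h3
    have h4 := nd_ge_of_not_dvd hr0 (b : ℤ) (by
      intro hd
      have hd' : r ∣ b := by exact_mod_cast hd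
      have := Nat.dvd_gcd (dvd_mul_right r s1) hd'
      rw [hcop] at this
      exact hr.one_lt.ne' (Nat.dvd_one.1 this))
    have : (0 : ℝ) < 1 / r := by positivity
    push_cast at h4
    linarith
  have h5 : (ee ((b : ℝ) / r) - 1) * GS (QQ E V W) b (r * s1) = 0 := by
    rw [sub_mul, h1]; ring
  exact (mul_eq_zero.1 h5).resolve_left h2

lemma cop_aux (W u a : ℕ) (h : W.Coprime u) (hu : 1 ≤ u) (e : ℕ) :
    ∃ t, ∀ n, (a + W * n).Coprime u → (n + e + t).Coprime u := by
  obtain ⟨w, hw⟩ : ∃ w, W * w ≡ 1 [MOD u] := by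
    rcases Nat.lt_or_ge 1 u with h1 | h1
    · obtain ⟨w, -, hw⟩ := Nat.exists_mul_mod_eq_one_of_coprime h h1
      exact ⟨w, by rw [Nat.ModEq, hw, Nat.mod_eq_of_lt h1]⟩
    · obtain rfl : u = 1 := by omega
      exact ⟨0, Nat.modEq_one⟩
  refine ⟨w * a + e * (u - 1), fun n hn => ?_⟩
  have h1 : n + e + (w * a + e * (u - 1)) = n + w * a + e * u := by
    obtain ⟨v, rfl⟩ : ∃ v, u = v + 1 := ⟨u - 1, by omega⟩
    rw [Nat.add_sub_cancel]; ring
  rw [h1, Nat.coprime_add_mul_right_left]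
  have h2 : W * (n + w * a) ≡ a + W * n [MOD u] := by
    have := (hw.mul_right a).add_right (W * n)
    rw [one_mul] at this
    rw [show W * (n + w * a) = W * w * a + W * n by ring]
    exact this
  have h3 : (W * (n + w * a)).Coprime u := by
    rw [Nat.Coprime, h2.gcd_eq]; exact hn
  exact h3.coprime_mul_left

lemma cop_two (j i v : ℕ) (hj : 1 ≤ j) (hv : v % 2 = 1) : (2 ^ j + 3 * v ^ 2).Coprime (2 ^ i * v) := by
  apply Nat.Coprime.mul_right
  · apply Nat.Coprime.pow_right
    rw [Nat.coprime_two_right, Nat.odd_iff]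
    obtain ⟨j', rfl⟩ : ∃ j', j = j' + 1 := ⟨j - 1, by omega⟩
    have h1 : v ^ 2 % 2 = 1 := by rw [Nat.pow_mod, hv]
    omega
  · rw [show 3 * v ^ 2 = 3 * v * v by ring, Nat.coprime_add_mul_right_left]
    apply Nat.Coprime.pow_left
    rw [Nat.coprime_two_left, Nat.odd_iff]; exact hv

end

section
open Finset

lemma pars (ℓ D k V : ℕ) (hD : D = 2 ^ ℓ) (hV : 1 ≤ V) (hk : 1 ≤ k) : ∃ a b e : ℕ,
    a.Coprime (2 ^ (k + 2) * D * (D * V)) ∧ b.Coprime (2 ^ (k + 2) * D * (D * V)) ∧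
    a % 8 = 3 ∧ b % 8 = 5 ∧ a + b = 2 ^ (k + 2) + 2 ^ (k + 2) * D * (D * V) * e := by
  obtain ⟨v, w, hw, hVw⟩ := Nat.exists_eq_two_pow_mul_odd (n := V) (by omega)
  have hw2 := Nat.odd_iff.1 hw
  have hW : 2 ^ (k + 2) * D * (D * V) = 2 ^ (k + 2 + ℓ + ℓ + v) * w := by
    rw [hD, hVw]; ring
  have h8 : (2 ^ (k + 2) * D * (D * V)) % 8 = 0 := by
    obtain ⟨k', rfl⟩ : ∃ k', k = k' + 1 := ⟨k - 1, by omega⟩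
    have : 2 ^ (k' + 1 + 2) * D * (D * V) = 8 * (2 ^ k' * D * (D * V)) := by ring
    omega
  have hk8 : 2 ^ (k + 2) % 8 = 0 := by
    obtain ⟨k', rfl⟩ : ∃ k', k = k' + 1 := ⟨k - 1, by omega⟩
    have : 2 ^ (k' + 1 + 2) = 8 * 2 ^ k' := by ring
    omega
  have c1 := cop_two (k + 3) (k + 2 + ℓ + ℓ + v) w (by omega) hw2
  have c2 := cop_two (k + 2) (k + 2 + ℓ + ℓ + v) w (by omega) hw2
  rw [← hW] at c1 c2
  have hW0 : 1 ≤ 2 ^ (k + 2) * D * (D * V) := by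
    rw [hD]; exact Nat.mul_pos (by positivity) (Nat.mul_pos (by positivity) hV)
  set W := 2 ^ (k + 2) * D * (D * V) with hWd
  clear_value W
  obtain ⟨W0, rfl⟩ : ∃ W0, W = W0 + 1 := ⟨W - 1, by omega⟩
  have hw8 : w ^ 2 % 8 = 1 := by
    have : w % 8 = 1 ∨ w % 8 = 3 ∨ w % 8 = 5 ∨ w % 8 = 7 := by omega
    rcases this with h | h | h | h <;> rw [Nat.pow_mod, h]
  set t := 2 ^ (k + 2) + 3 * w ^ 2 with ht
  have ht8 : t % 8 = 3 := by omega
  refine ⟨2 ^ (k + 3) + 3 * w ^ 2, W0 * t, t, c1, ?_, ?_, ?_, ?_⟩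
  · exact Nat.Coprime.mul_left (by simp) c2
  · have : 2 ^ (k + 3) = 2 * 2 ^ (k + 2) := by ring
    omega
  · have h1 : W0 * t % 8 = 7 * 3 % 8 := by
      rw [Nat.mul_mod, ht8, show W0 % 8 = 7 by omega]
    omega
  · rw [ht]; ring

theorem GB (ℓ : ℕ) (hℓ : 2 ≤ ℓ) : ∃ c : ℝ, 0 < c ∧ ∃ κ g0 : ℕ, 1 ≤ κ ∧ ∀ g : ℕ, g0 ≤ g →
    ∃ S : Finset (ℕ × ℕ), (∀ x ∈ S, x.1.Prime ∧ x.2.Prime ∧ x.1 % 8 = 3 ∧ x.2 % 8 = 5 ∧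
      (∃ m, x.1 + x.2 = 4 * (2 * m ^ 2) ^ (2 ^ (ℓ - 1))) ∧
      x.1 ≤ κ * g ^ 2 ^ ℓ ∧ x.2 ≤ κ * g ^ 2 ^ ℓ) ∧
    c * (g : ℝ) ^ (2 ^ ℓ + 1) / Real.log g ^ 2 ≤ #S := by
  obtain ⟨k, hk⟩ : ∃ k, k = 2 ^ (ℓ - 1) := ⟨_, rfl⟩
  obtain ⟨D, hD⟩ : ∃ D, D = 2 ^ ℓ := ⟨_, rfl⟩
  have hDk : D = 2 * k := by rw [hD, hk, ← pow_succ']; congr 1; omega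
  have hk2 : 2 ≤ k := by
    rw [hk]; calc 2 = 2 ^ 1 := rfl
      _ ≤ _ := Nat.pow_le_pow_right (by norm_num) (by omega)
  rw [← hk, ← hD]
  obtain ⟨E, hE⟩ : ∃ E, D = E + 2 := ⟨D - 2, by omega⟩
  obtain ⟨i0, hi0, hcirc⟩ := circle D (by omega)
  set V := (2 ^ i0 - 1).factorial with hVd
  have hV1 : 1 ≤ V := Nat.factorial_pos _
  have hVp : ∀ r : ℕ, r.Prime → (r ∣ V ↔ r < 2 ^ i0) := by
    intro r hr
    rw [hVd, hr.dvd_factorial]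
    have : 0 < 2 ^ i0 := by positivity
    omega
  have h2i : 4 ≤ 2 ^ i0 := by
    calc 4 = 2 ^ 2 := rfl
      _ ≤ _ := Nat.pow_le_pow_right (by norm_num) hi0
  have hcopD : ∀ s : ℕ, (∀ r, r.Prime → r ∣ s → 2 ^ i0 ≤ r) → s.Coprime 2 ∧ s.Coprime V := by
    intro s hs
    constructor
    · rw [Nat.coprime_comm, Nat.prime_two.coprime_iff_not_dvd]
      intro h; have := hs 2 Nat.prime_two h; omega
    · refine Nat.coprime_of_dvd fun r hr h1 h2 => ?_
      have := hs r hr h1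
      have := (hVp r hr).1 h2
      omega
  have hcopD' : ∀ s : ℕ, (∀ r, r.Prime → r ∣ s → 2 ^ i0 ≤ r) → s.Coprime D ∧ s.Coprime V := by
    intro s hs
    refine ⟨?_, (hcopD s hs).2⟩
    rw [hD]; exact (hcopD s hs).1.pow_right _
  clear_value V
  obtain ⟨a, b, e, ha, hb, ha8, hb8, hab⟩ := pars ℓ D k V hD hV1 (by omega)
  obtain ⟨W, hW⟩ : ∃ W, W = 2 ^ (k + 2) * D * (D * V) := ⟨_, rfl⟩
  rw [← hW] at ha hb hab
  have hD0 : 0 < D := by omega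
  have hW1 : 1 ≤ W := by
    rw [hW]; exact Nat.mul_pos (by positivity) (Nat.mul_pos hD0 hV1)
  have hW8 : W % 8 = 0 := by
    obtain ⟨k', rfl⟩ : ∃ k', k = k' + 1 := ⟨k - 1, by omega⟩
    have : 2 ^ (k' + 1 + 2) * D * (D * V) = 8 * (2 ^ k' * D * (D * V)) := by ring
    omega
  have hcopW : ∀ s : ℕ, (∀ r, r.Prime → r ∣ s → 2 ^ i0 ≤ r) → W.Coprime s := by
    intro s hs
    rw [Nat.coprime_comm, hW]
    obtain ⟨h1, h2⟩ := hcopD' s hs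
    exact Nat.Coprime.mul_right (Nat.Coprime.mul_right ((hcopD s hs).1.pow_right _) h1)
      (Nat.Coprime.mul_right h1 h2)
  obtain ⟨KA, hA0, hKA, hA⟩ := prime_blocks W a hW1 ha
  obtain ⟨KB, hB0, hKB, hB⟩ := prime_blocks W b hW1 hb
  obtain ⟨Q, hQ⟩ : ∃ Q, Q = QQ E V (D * V) := ⟨_, rfl⟩
  have hQid : ∀ m, 1 + D * (D * V) * Q.eval m = (1 + D * V * m) ^ D := by
    intro m; rw [hQ]; exact QQ_id E V D hE m
  have hQge : ∀ m, m ^ D ≤ Q.eval m := by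
    intro m; rw [hQ, hE]; exact QQ_ge E V _ m hV1 (Nat.mul_pos (by omega) hV1)
  have hQs : StrictMono fun m => Q.eval m := by rw [hQ]; exact QQ_strict _ _ _
  have hQc : Q.coeff D = V * (D * V) ^ E := by
    have := QQ_coeff E V (D * V)
    rw [← hE] at this; rw [hQ]; exact this
  obtain ⟨c, hc, g0, hmain⟩ := hcirc Q (by rw [hQ, hE]; exact QQ_deg _ _ _)
    (by rw [hQ]; exact QQ_zero _ _ _)
    (by rw [hQc]; exact Nat.mul_pos hV1 (Nat.pow_pos (Nat.mul_pos hD0 hV1)))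
    (by
      intro s hs
      rw [hQc]
      obtain ⟨h1, h2⟩ := hcopD' s hs
      exact Nat.Coprime.mul_right h2 ((Nat.Coprime.mul_right h1 h2).pow_right _))
    (by
      intro s b r hr hrs hri hs hb
      rw [hQ]; exact GS_QQ _ _ _ _ _ r hr hrs ((hVp r hr).2 hri) hs hb)
    (KA + KB + e + 3) (by omega)
  refine ⟨c, hc, a + b + W * (KA + KB + 1), g0 + hA0 + hB0 + 1, by
    have := Nat.mul_pos hW1 (by omega : 0 < KA + KB + 1); omega, fun g hg => ?_⟩
  have hgh : g ≤ g ^ D := Nat.le_self_pow (by omega) g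
  obtain ⟨i, hi1, hiK, hAc⟩ := hA (g ^ D) (by omega)
  obtain ⟨j, hj1, hjK, hBc⟩ := hB (g ^ D) (by omega)
  obtain ⟨h, hh⟩ : ∃ h, h = g ^ D := ⟨_, rfl⟩
  specialize hmain g (by omega)
  rw [← hh] at hAc hBc hgh hmain ⊢
  set A := {n ∈ Ico (i * h) ((i + 1) * h) | (a + W * n).Prime} with hAd
  set B0 := {n ∈ Ico (j * h) ((j + 1) * h) | (b + W * n).Prime} with hBd
  have hh1 : 1 ≤ h := by omega
  have hih : i * h ≤ KA * h := Nat.mul_le_mul_right _ hiK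
  have hjh : j * h ≤ KB * h := Nat.mul_le_mul_right _ hjK
  have hih1 : h ≤ i * h := Nat.le_mul_of_pos_left _ hi1
  have hjh1 : h ≤ j * h := Nat.le_mul_of_pos_left _ hj1
  have hAm : ∀ n ∈ A, i * h ≤ n ∧ n < i * h + h ∧ (a + W * n).Prime := by
    intro n hn
    obtain ⟨h1, h2⟩ := mem_filter.1 hn
    rw [mem_Ico, add_one_mul] at h1
    exact ⟨h1.1, h1.2, h2⟩
  have hBm : ∀ n ∈ B0, j * h ≤ n ∧ n < j * h + h ∧ (b + W * n).Prime := by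
    intro n hn
    obtain ⟨h1, h2⟩ := mem_filter.1 hn
    rw [mem_Ico, add_one_mul] at h1
    exact ⟨h1.1, h1.2, h2⟩
  set B := B0.image (· + e) with hBi
  have hBcard : #B = #B0 := card_image_of_injective _ (add_left_injective e)
  have hpc : ∀ a n u : ℕ, 1 ≤ a → h ≤ n → 1 ≤ u → u ≤ g → (a + W * n).Prime → (a + W * n).Coprime u := by
    intro a n u ha1 hn hu hug hp
    rw [hp.coprime_iff_not_dvd]
    intro hd
    have h1 := Nat.le_of_dvd hu hd
    have h2 : n ≤ W * n := Nat.le_mul_of_pos_left _ hW1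
    omega
  have hm := hmain (i * h) (j * h + e) A B
    (fun n hn => by obtain ⟨h1, h2, -⟩ := hAm n hn; exact mem_Ico.2 ⟨h1, h2⟩)
    (fun n hn => by
      obtain ⟨n', hn', rfl⟩ := mem_image.1 hn
      obtain ⟨h1, h2, -⟩ := hBm n' hn'
      exact mem_Ico.2 ⟨by omega, by omega⟩)
    (by omega)
    (by
      refine le_trans ?_ (hQge _)
      rw [mul_pow, ← hh]
      calc i * h + (j * h + e) + 3 * h ≤ KA * h + KB * h + e * h + 3 * h := by
            have : e ≤ e * h := Nat.le_mul_of_pos_right _ hh1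
            omega
        _ = (KA + KB + e + 3) * h := by ring
        _ ≤ _ := Nat.mul_le_mul_right _ (Nat.le_self_pow (by omega) _))
    hAc (by rw [hBcard]; exact hBc)
    (by
      intro u hu1 hug _ hup
      obtain ⟨t, ht⟩ := cop_aux W u a (hcopW u hup) hu1 0
      refine ⟨t, fun n hn => ?_⟩
      obtain ⟨h1, h2, h3⟩ := hAm n hn
      exact ht n (hpc a n u (by omega) (by omega) hu1 hug h3))
    (by
      intro u hu1 hug _ hup
      obtain ⟨t, ht⟩ := cop_aux W u b (hcopW u hup) hu1 e
      refine ⟨t, fun n hn => ?_⟩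
      obtain ⟨n', hn', rfl⟩ := mem_image.1 hn
      obtain ⟨h1, h2, h3⟩ := hBm n' hn'
      exact ht n' (hpc b n' u (by omega) (by omega) hu1 hug h3))
  set M := (KA + KB + e + 3) * g with hM
  set S0 := (range M).biUnion fun m => {p ∈ A ×ˢ B | p.1 + p.2 = Q.eval m} with hS0
  have hcS0 : #S0 = ∑ m ∈ range M, rr A B (Q.eval m) := by
    rw [hS0, card_biUnion]
    · rfl
    · intro m _ m' _ hne
      rw [Function.onFun, disjoint_left]
      intro p hp hp'
      exact hne (hQs.injective ((mem_filter.1 hp).2.symm.trans (mem_filter.1 hp').2))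
  have hS0m : ∀ p ∈ S0, p.1 ∈ A ∧ (∃ n ∈ B0, p.2 = n + e) ∧ ∃ m, p.1 + p.2 = Q.eval m := by
    intro p hp
    obtain ⟨m, -, hp⟩ := mem_biUnion.1 hp
    obtain ⟨h1, h2⟩ := mem_filter.1 hp
    obtain ⟨h3, h4⟩ := mem_product.1 h1
    obtain ⟨n, hn, hne⟩ := mem_image.1 h4
    exact ⟨h3, ⟨n, hn, hne.symm⟩, m, h2⟩
  refine ⟨S0.image fun p => (a + W * p.1, b + W * (p.2 - e)), ?_, ?_⟩
  · intro x hx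
    obtain ⟨p, hp, rfl⟩ := mem_image.1 hx
    obtain ⟨h1, ⟨n, hn, hne⟩, m, hm⟩ := hS0m p hp
    obtain ⟨h2, h3, h4⟩ := hAm _ h1
    obtain ⟨h5, h6, h7⟩ := hBm _ hn
    have hpe : p.2 - e = n := by omega
    simp only [hpe]
    have hWn : ∀ y, W * y % 8 = 0 := fun y => by rw [Nat.mul_mod, hW8, zero_mul, Nat.zero_mod]
    have hbd : ∀ y, y ≤ (KA + KB + 1) * h → W * y ≤ W * (KA + KB + 1) * h := by
      intro y hy; rw [mul_assoc]; exact Nat.mul_le_mul_left _ hy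
    have hah : a ≤ a * h := Nat.le_mul_of_pos_right _ hh1
    have hbh : b ≤ b * h := Nat.le_mul_of_pos_right _ hh1
    have hex : (KA + KB + 1) * h = KA * h + KB * h + h := by ring
    have hex2 : (a + b + W * (KA + KB + 1)) * h = a * h + b * h + W * (KA + KB + 1) * h := by ring
    refine ⟨h4, h7, ?_, ?_, ⟨1 + D * V * m, ?_⟩, ?_, ?_⟩
    · have := hWn p.1; omega
    · have := hWn n; omega
    · have e1 : a + W * p.1 + (b + W * n) = 2 ^ (k + 2) * (1 + D * (D * V) * Q.eval m) := by
        rw [← hm, hne]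
        calc a + W * p.1 + (b + W * n) = (a + b) + W * (p.1 + n) := by ring
          _ = _ := by rw [hab, hW]; ring
      rw [e1, hQid, hDk]
      generalize 1 + 2 * k * V * m = z
      rw [mul_pow, ← pow_mul]; ring
    · have := hbd p.1 (by omega); omega
    · have := hbd n (by omega); omega
  · rw [card_image_of_injOn, hcS0]
    · push_cast; exact hm
    · intro p hp p' hp' heq
      obtain ⟨-, ⟨n, -, hn⟩, -⟩ := hS0m p hp
      obtain ⟨-, ⟨n', -, hn'⟩, -⟩ := hS0m p' hp'
      simp only [Prod.mk.injEq] at heq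
      obtain ⟨h1, h2⟩ := heq
      have h3 := Nat.eq_of_mul_eq_mul_left hW1 (Nat.add_left_cancel h1)
      have h4 := Nat.eq_of_mul_eq_mul_left hW1 (Nat.add_left_cancel h2)
      exact Prod.ext h3 (by omega)

end

section
open Finset

lemma mul_inj_aux {p q p' q' : ℕ} (hp : p.Prime) (hp' : p'.Prime) (hq' : q'.Prime)
    (h1 : p % 8 = 3) (h3 : q' % 8 = 5) (h : p * q = p' * q') :
    p = p' ∧ q = q' := by
  have hd : p ∣ p' * q' := h ▸ dvd_mul_right p q
  have hpp : p = p' := by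
    rcases (hp.dvd_mul).1 hd with h5 | h5
    · exact (Nat.prime_dvd_prime_iff_eq hp hp').1 h5
    · have := (Nat.prime_dvd_prime_iff_eq hp hq').1 h5
      omega
  subst hpp
  exact ⟨rfl, Nat.eq_of_mul_eq_mul_left hp.pos h⟩

theorem final_count (ℓ : ℕ) (hℓ : 2 ≤ ℓ) :
    ∃ c : ℝ, 0 < c ∧ ∃ X₀ : ℝ, ∀ X : ℝ, X₀ ≤ X →
      c * X ^ ((1 : ℝ) / 2 + 1 / 2 ^ (ℓ + 1)) / (Real.log X) ^ 2 ≤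
        ({d : ℕ | (d : ℝ) ≤ X ∧ Squarefree d ∧
          twoClassGroupIso d (Multiplicative (ZMod (2 ^ ℓ)))}.ncard : ℝ) := by
  obtain ⟨c, hc, κ, g0, hκ, hGB⟩ := GB ℓ hℓ
  obtain ⟨D, hD⟩ : ∃ D, D = 2 ^ ℓ := ⟨_, rfl⟩
  have hD0 : 0 < D := by rw [hD]; positivity
  have hDR : (0 : ℝ) < D := by exact_mod_cast hD0
  have hκR : (0 : ℝ) < κ := by exact_mod_cast hκ
  rw [← hD] at hGB
  obtain ⟨κ1, hκ1⟩ : ∃ κ1 : ℝ, κ1 = (κ : ℝ)⁻¹ ^ (1 / D : ℝ) := ⟨_, rfl⟩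
  have hκ0 : 0 < κ1 := by rw [hκ1]; positivity
  have hκD : κ1 ^ D = (κ : ℝ)⁻¹ := by
    rw [hκ1, one_div, Real.rpow_inv_natCast_pow (by positivity) (by omega)]
  refine ⟨c * (κ1 / 2) ^ (D + 1), by positivity, max 1 (((g0 + 2) / κ1) ^ (2 * D)), fun X hX => ?_⟩
  have hX1 : 1 ≤ X := (le_max_left _ _).trans hX
  have hX2 : ((g0 + 2) / κ1) ^ (2 * D) ≤ X := (le_max_right _ _).trans hX
  have hX0 : 0 < X := by linarith
  obtain ⟨Z, hZ⟩ : ∃ Z : ℝ, Z = X ^ (1 / (2 * D) : ℝ) := ⟨_, rfl⟩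
  have hZ0 : 0 < Z := by rw [hZ]; positivity
  have hZX : Z ^ (2 * D) = X := by
    rw [hZ, one_div, show (2 * D : ℝ) = ((2 * D : ℕ) : ℝ) by push_cast; rfl,
      Real.rpow_inv_natCast_pow hX0.le (by omega)]
  have hZexp : X ^ ((1 : ℝ) / 2 + 1 / 2 ^ (ℓ + 1)) = Z ^ (D + 1) := by
    rw [hZ, ← Real.rpow_natCast (X ^ (1 / (2 * D) : ℝ)), ← Real.rpow_mul hX0.le]
    congr 1
    rw [pow_succ, show ((2 : ℝ) ^ ℓ) = D by rw [hD]; push_cast; rfl]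
    push_cast; field_simp
  have hZg : (g0 + 2) / κ1 ≤ Z := by
    rw [← hZX] at hX2
    exact (pow_le_pow_iff_left₀ (by positivity) hZ0.le (by omega)).1 hX2
  rw [div_le_iff₀ hκ0] at hZg
  obtain ⟨g, hg⟩ : ∃ g, g = ⌊Z * κ1⌋₊ := ⟨_, rfl⟩
  have hg1 : (g : ℝ) ≤ Z * κ1 := by rw [hg]; exact Nat.floor_le (by positivity)
  have hg2 : Z * κ1 < g + 1 := by rw [hg]; exact Nat.lt_floor_add_one _
  have hg3 : g0 + 2 ≤ g := by
    rw [hg]; apply Nat.le_floor; push_cast; exact hZg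
  have hg4 : (2 : ℝ) ≤ g := by exact_mod_cast (by omega : 2 ≤ g)
  have hg5 : Z * κ1 / 2 ≤ g := by linarith
  obtain ⟨S, hS, hcS⟩ := hGB g (by omega)
  have hbnd : (κ : ℝ) * g ^ D ≤ Z ^ D := by
    calc (κ : ℝ) * g ^ D ≤ κ * (Z * κ1) ^ D := by gcongr
      _ = Z ^ D := by rw [mul_pow, hκD]; field_simp
  have hgX : (g : ℝ) ≤ X := by
    have h1 : (1 : ℝ) ≤ κ := by exact_mod_cast hκ
    have hg6 : (1 : ℝ) ≤ (g : ℝ) ^ D := one_le_pow₀ (by linarith)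
    have h2 : (g : ℝ) ≤ g ^ D := le_self_pow₀ (by linarith) (by omega)
    have h3 : (g : ℝ) ^ D ≤ κ * g ^ D := le_mul_of_one_le_left (by positivity) h1
    have h4 : Z ^ D ≤ Z ^ D * Z ^ D := le_mul_of_one_le_left (by positivity) (by linarith)
    have h5 : Z ^ D * Z ^ D = X := by rw [← hZX, two_mul, pow_add]
    linarith
  have hlog : Real.log g ≤ Real.log X := Real.log_le_log (by linarith) hgX
  have hlog0 : 0 < Real.log g := Real.log_pos (by linarith)
  have hstep : c * (κ1 / 2) ^ (D + 1) * X ^ ((1 : ℝ) / 2 + 1 / 2 ^ (ℓ + 1)) / (Real.log X) ^ 2 ≤ #S := by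
    refine le_trans ?_ hcS
    rw [hZexp, mul_assoc, ← mul_pow]
    have : κ1 / 2 * Z ≤ g := by linarith
    gcongr
  refine hstep.trans ?_
  have hfin : {d : ℕ | (d : ℝ) ≤ X ∧ Squarefree d ∧
      twoClassGroupIso d (Multiplicative (ZMod (2 ^ ℓ)))}.Finite :=
    (Set.finite_Iic ⌊X⌋₊).subset fun d hd => Nat.le_floor hd.1
  have hinj : Set.InjOn (fun x : ℕ × ℕ => x.1 * x.2) S := by
    intro x hx y hy hxy
    obtain ⟨a1, a2, a3, a4, -⟩ := hS x hx
    obtain ⟨b1, b2, b3, b4, -⟩ := hS y hy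
    obtain ⟨h1, h2⟩ := mul_inj_aux a1 b1 b2 a3 b4 hxy
    exact Prod.ext h1 h2
  rw [← card_image_of_injOn hinj, ← Set.ncard_coe_finset]
  refine Nat.cast_le.2 (Set.ncard_le_ncard (fun d hd => by
    obtain ⟨x, hx, rfl⟩ := mem_image.1 (mem_coe.1 hd)
    obtain ⟨a1, a2, a3, a4, ⟨m, hm⟩, a5, a6⟩ := hS x hx
    refine ⟨?_, cl_main (by omega) a1 a2 a3 a4 hm⟩
    have e1 : (x.1 : ℝ) ≤ κ * g ^ D := by exact_mod_cast a5
    have e2 : (x.2 : ℝ) ≤ κ * g ^ D := by exact_mod_cast a6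
    push_cast
    calc (x.1 : ℝ) * x.2 ≤ Z ^ D * Z ^ D := by
          apply mul_le_mul (e1.trans hbnd) (e2.trans hbnd) (by positivity) (by positivity)
      _ = X := by rw [← hZX, two_mul, pow_add]) hfin)

end

/-- For every `ℓ ≥ 2` there are `≫ X^(1/2 + 1/2^(ℓ+1)) / (log X)²` squarefree positive
integers `d ≤ X` whose 2-class group `Cl₂(-d)` is cyclic of order `2^ℓ`. -/
theorem count_cyclic_two_class_groups (ℓ : ℕ) (hℓ : 2 ≤ ℓ) :
    ∃ c : ℝ, 0 < c ∧ ∃ X₀ : ℝ, ∀ X : ℝ, X₀ ≤ X →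
      c * X ^ ((1 : ℝ) / 2 + 1 / 2 ^ (ℓ + 1)) / (Real.log X) ^ 2 ≤
        ({d : ℕ | (d : ℝ) ≤ X ∧ Squarefree d ∧
          twoClassGroupIso d (Multiplicative (ZMod (2 ^ ℓ)))}.ncard : ℝ) := by
  exact final_count ℓ hℓ
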